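/- arXiv:2503.05275 — 2 statements merged into one kernel-verified Lean document; each statement's English description precedes it below -/
import Mathlib

section
/- Suppose k ≥ 3 and 1 ≤ ℓ < k/2. For every η > 0 there exist γ > 0, θ > 0 with θ ≪ γ ≪ η and n₀ such that the following holds for all n ≥ n₀. Let H be a k-graph on n vertices satisfying either δ_ℓ(H) ≥ (max{1/3, (1/2)^{(k−ℓ)/ℓ}} + η)·C(n, k−ℓ) with ℓ ≥ 2, or δ_{ℓ+1}(H) ≥ (1/3 + η)·C(n, k−ℓ−1). Then there exists an ℓ-path P in H with |V(P)| ≤ γn such that for every set X ⊆ V(H)∖V(P) with |X| ≤ θn and (k−ℓ) ∣ |X|, there exists an ℓ-path Q in H with the same ordered ends as P and with V(Q) = V(P) ∪ X. -/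
/-- `H` is a `k`-uniform hypergraph (a `k`-graph) on the vertex set `Fin n`. -/
def IsKGraph (n k : ℕ) (H : Finset (Finset (Fin n))) : Prop :=
  ∀ e ∈ H, e.card = k

/-- The degree `deg_H(S)` of a vertex set `S` in the `k`-graph `H`: the number of
`(k - |S|)`-sets `T` disjoint from `S` with `S ∪ T ∈ H`. -/
noncomputable def hDeg (n k : ℕ) (H : Finset (Finset (Fin n))) (S : Finset (Fin n)) : ℕ :=
  Nat.card {T : Finset (Fin n) // T.card = k - S.card ∧ Disjoint S T ∧ S ∪ T ∈ H}

/-- The minimum `d`-degree `δ_d(H)` of a `k`-graph `H` on `Fin n`. -/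
noncomputable def minDeg (n k d : ℕ) (H : Finset (Finset (Fin n))) : ℕ :=
  sInf { m : ℕ | ∃ S : Finset (Fin n), S.card = d ∧ hDeg n k H S = m }

/-- `H` contains a Hamilton `ℓ`-cycle: there is a cyclic ordering of all the vertices such
that the `n / (k - ℓ)` segments of `k` consecutive vertices starting at the positions
divisible by `k - ℓ` are all edges of `H` (hence every two consecutive edges share
exactly `ℓ` vertices). -/
def HasHamiltonCycle (n k l : ℕ) (H : Finset (Finset (Fin n))) : Prop :=
  ∃ f : ZMod n → Fin n, Function.Bijective f ∧
    ∀ j < n / (k - l),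
      ((Finset.range k).image (fun i => f ((j * (k - l) + i : ℕ) : ZMod n))) ∈ H

/-- `f` enumerates (the vertices, in order, of) an `ℓ`-path with `t` edges in `H`:
the `j`-th edge consists of the `k` consecutive vertices starting at position `j * (k - ℓ)`,
so every two consecutive edges share exactly `ℓ` vertices. -/
def IsLPath (n k l t : ℕ) (H : Finset (Finset (Fin n))) (f : ℕ → Fin n) : Prop :=
  Set.InjOn f (Set.Iio (t * (k - l) + l)) ∧
  ∀ j < t, ((Finset.range k).image (fun i => f (j * (k - l) + i))) ∈ H

/-- The vertex set of the `ℓ`-path with `t` edges enumerated by `f`. -/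
def pathVerts (n k l t : ℕ) (f : ℕ → Fin n) : Finset (Fin n) :=
  (Finset.range (t * (k - l) + l)).image f

/-- The first `ℓ` vertices (as an ordered `ℓ`-set) of the path enumerated by `f`. -/
def pathBeg (n l : ℕ) (f : ℕ → Fin n) : Fin l → Fin n := fun i => f (i : ℕ)

/-- The last `ℓ` vertices (as an ordered `ℓ`-set) of an `ℓ`-path with `t` edges
enumerated by `f`. -/
def pathEnd (n k l t : ℕ) (f : ℕ → Fin n) : Fin l → Fin n := fun i => f (t * (k - l) + (i : ℕ))

/-- `T` is a reachable set for the pair `{u, v}` (with parameter `i`): there are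
vertex-disjoint `ℓ`-paths `P₁, …, Pᵢ` of length two covering exactly `T ∪ {u}` and
vertex-disjoint `ℓ`-paths `P₁', …, Pᵢ'` of length two covering exactly `T ∪ {v}`,
where `P_j` and `P_j'` have the same (ordered) ends for all `j`. -/
def ReachSet (n k l i : ℕ) (H : Finset (Finset (Fin n))) (u v : Fin n)
    (T : Finset (Fin n)) : Prop :=
  ∃ P P' : Fin i → ℕ → Fin n,
    (∀ j, IsLPath n k l 2 H (P j)) ∧ (∀ j, IsLPath n k l 2 H (P' j)) ∧
    (∀ j j', j ≠ j' → Disjoint (pathVerts n k l 2 (P j)) (pathVerts n k l 2 (P j'))) ∧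
    (∀ j j', j ≠ j' → Disjoint (pathVerts n k l 2 (P' j)) (pathVerts n k l 2 (P' j'))) ∧
    (Finset.univ.biUnion (fun j => pathVerts n k l 2 (P j)) = insert u T) ∧
    (Finset.univ.biUnion (fun j => pathVerts n k l 2 (P' j)) = insert v T) ∧
    (∀ j, pathBeg n l (P j) = pathBeg n l (P' j) ∧
      pathEnd n k l 2 (P j) = pathEnd n k l 2 (P' j))

/-- `u` and `v` are `(β, i)`-reachable in the `k`-graph `H` on `n` vertices: there are at
least `β * n ^ ((2k - ℓ) i - 1)` sets `T` of size `(2k - ℓ) i - 1` that are reachable sets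
for `{u, v}`. -/
def Reachable (n k l : ℕ) (H : Finset (Finset (Fin n))) (β : ℝ) (i : ℕ) (u v : Fin n) : Prop :=
  β * (n : ℝ) ^ ((2 * k - l) * i - 1) ≤
    (Nat.card {T : Finset (Fin n) // T.card = (2 * k - l) * i - 1 ∧
      ReachSet n k l i H u v T} : ℝ)

/-- `H` contains a `Y_{k,2ℓ}`-tiling (vertex-disjoint copies of the `k`-graph consisting of
two edges intersecting in exactly `2ℓ` vertices) covering all but at most `u` vertices. -/
def HasYTilingCover (n l : ℕ) (H : Finset (Finset (Fin n))) (u : ℝ) : Prop :=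
  ∃ (m : ℕ) (e₁ e₂ : Fin m → Finset (Fin n)),
    (∀ j, e₁ j ∈ H ∧ e₂ j ∈ H ∧ ((e₁ j) ∩ (e₂ j)).card = 2 * l) ∧
    (∀ j j', j ≠ j' → Disjoint ((e₁ j) ∪ (e₂ j)) ((e₁ j') ∪ (e₂ j'))) ∧
    (n : ℝ) - ((Finset.univ.biUnion fun j => (e₁ j) ∪ (e₂ j)).card : ℝ) ≤ u

/-- The tiling threshold `t_d^ℓ(k, n, ε)`: the minimum `t` such that every `k`-graph `H`
on `n` vertices with `δ_d(H) ≥ t` contains a `Y_{k,2ℓ}`-tiling covering all but at most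
`ε n` vertices. -/
noncomputable def tThreshold (k d l n : ℕ) (ε : ℝ) : ℕ :=
  sInf { t : ℕ | ∀ H : Finset (Finset (Fin n)), IsKGraph n k H →
    t ≤ minDeg n k d H → HasYTilingCover n l H (ε * n) }

/-- `t(k,d,ℓ) := limsup_{ε → 0⁺} limsup_{n → ∞} t_d^ℓ(k,n,ε) / C(n, k-d)`. -/
noncomputable def tVal (k d l : ℕ) : ℝ :=
  Filter.limsup
    (fun ε : ℝ => Filter.limsup
      (fun n : ℕ => (tThreshold k d l n ε : ℝ) / (n.choose (k - d) : ℝ)) Filter.atTop)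
    (nhdsWithin (0 : ℝ) (Set.Ioi (0 : ℝ)))

/-- The Dirac threshold `h_d^ℓ(k, n)`: the smallest `h` such that every `k`-graph `H` on
`n` vertices with `δ_d(H) ≥ h` contains a Hamilton `ℓ`-cycle. -/
noncomputable def hThreshold (k d l n : ℕ) : ℕ :=
  sInf { h : ℕ | ∀ H : Finset (Finset (Fin n)), IsKGraph n k H →
    h ≤ minDeg n k d H → HasHamiltonCycle n k l H }

/-- `h_d^ℓ(k) := limsup_{n → ∞, (k-ℓ) ∣ n} h_d^ℓ(k,n) / C(n, k-d)`. -/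
noncomputable def hVal (k d l : ℕ) : ℝ :=
  Filter.limsup (fun n : ℕ => (hThreshold k d l n : ℝ) / (n.choose (k - d) : ℝ))
    (Filter.atTop ⊓ Filter.principal { m : ℕ | (k - l) ∣ m })

/-- The generalized binomial coefficient `C(x, r)` for a real `x`. -/
noncomputable def genChoose (x : ℝ) (r : ℕ) : ℝ :=
  (∏ i ∈ Finset.range r, (x - (i : ℝ))) / (r.factorial : ℝ)

/-- The number of sets in the `ε`-robust `r`-shadow `∂_ε^r(G)` of the `K`-graph `G` on
`Fin n`: the number of `(K - r)`-sets lying in more than `ε * n ^ r` edges of `G`. -/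
noncomputable def shadowCard (n K r : ℕ) (G : Finset (Finset (Fin n))) (ε : ℝ) : ℕ :=
  Nat.card {F : Finset (Fin n) // F.card = K - r ∧ ε * (n : ℝ) ^ r < (hDeg n K G F : ℝ)}

/-- `g` is an `S`-absorber, given as a `b`-tuple of distinct vertices avoiding `S`: the
tuple spans a family of `2k - 2ℓ + 1` vertex-disjoint `ℓ`-paths, and there is another
family of `2k - 2ℓ + 1` vertex-disjoint `ℓ`-paths, with the same ordered ends, spanning
the tuple together with `S`. -/
def IsAbsorberTuple (n k l b : ℕ) (H : Finset (Finset (Fin n))) (S : Finset (Fin n))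
    (g : Fin b → Fin n) : Prop :=
  Function.Injective g ∧ (∀ i, g i ∉ S) ∧
  ∃ (t t' : Fin (2 * k - 2 * l + 1) → ℕ) (Q Q' : Fin (2 * k - 2 * l + 1) → ℕ → Fin n),
    (∀ j, IsLPath n k l (t j) H (Q j)) ∧ (∀ j, IsLPath n k l (t' j) H (Q' j)) ∧
    (∀ j j', j ≠ j' → Disjoint (pathVerts n k l (t j) (Q j)) (pathVerts n k l (t j') (Q j'))) ∧
    (∀ j j', j ≠ j' →
      Disjoint (pathVerts n k l (t' j) (Q' j)) (pathVerts n k l (t' j') (Q' j'))) ∧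
    (∀ j, pathBeg n l (Q j) = pathBeg n l (Q' j) ∧
      pathEnd n k l (t j) (Q j) = pathEnd n k l (t' j) (Q' j)) ∧
    Finset.univ.biUnion (fun j => pathVerts n k l (t' j) (Q' j)) = Finset.image g Finset.univ ∧
    Finset.univ.biUnion (fun j => pathVerts n k l (t j) (Q j)) = Finset.image g Finset.univ ∪ S

section Density

open scoped Classical in
/-- At least a proportion `c` of the elements of the finite type `α` satisfy `Φ`. -/
def DenseIn {α : Type*} [Fintype α] (c : ℝ) (Φ : α → Prop) : Prop :=
  c * (Fintype.card α : ℝ) ≤ ((Finset.univ.filter Φ).card : ℝ)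

theorem denseIn_iff {α : Type*} [Fintype α] {c : ℝ} {Φ : α → Prop} [DecidablePred Φ] :
    DenseIn c Φ ↔ c * (Fintype.card α : ℝ) ≤ ((Finset.univ.filter Φ).card : ℝ) := by
  unfold DenseIn
  convert Iff.rfl

namespace DenseIn

variable {α β : Type*} [Fintype α] [Fintype β] {c c' ε : ℝ}

theorem mono {Φ Ψ : α → Prop} (h : DenseIn c Φ) (hc : c' ≤ c) (hΦ : ∀ a, Φ a → Ψ a) :
    DenseIn c' Ψ := by
  classical
  simp only [denseIn_iff] at *
  have h1 : (Finset.univ.filter Φ).card ≤ (Finset.univ.filter Ψ).card :=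
    Finset.card_le_card fun a => by simpa using hΦ a
  have h2 : c' * (Fintype.card α : ℝ) ≤ c * (Fintype.card α : ℝ) := by gcongr
  have h3 : ((Finset.univ.filter Φ).card : ℝ) ≤ (Finset.univ.filter Ψ).card := by
    exact_mod_cast h1
  linarith

theorem exists_of_pos [Nonempty α] {Φ : α → Prop} (h : DenseIn c Φ) (hc : 0 < c) :
    ∃ a, Φ a := by
  classical
  unfold DenseIn at h
  have : (0 : ℝ) < (Finset.univ.filter Φ).card :=
    lt_of_lt_of_le (mul_pos hc (by exact_mod_cast Fintype.card_pos)) h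
  obtain ⟨a, ha⟩ := Finset.card_pos.1 (by exact_mod_cast this)
  exact ⟨a, by simpa using ha⟩

theorem card_filter_prod (Φ : α × β → Prop) [DecidablePred Φ] :
    (Finset.univ.filter Φ).card = ∑ a, (Finset.univ.filter fun b => Φ (a, b)).card := by
  simp only [Finset.card_filter, Fintype.sum_prod_type]

theorem bind {Φ : α → Prop} {Ψ : α → β → Prop} (h : DenseIn c Φ) (hc' : 0 ≤ c')
    (hΨ : ∀ a, Φ a → DenseIn c' (Ψ a)) :
    DenseIn (c * c') fun x : α × β => Φ x.1 ∧ Ψ x.1 x.2 := by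
  classical
  simp only [denseIn_iff] at *
  rw [card_filter_prod, Fintype.card_prod]
  push_cast
  calc c * c' * ((Fintype.card α : ℝ) * Fintype.card β)
      = (c * Fintype.card α) * (c' * Fintype.card β) := by ring
    _ ≤ ((Finset.univ.filter Φ).card : ℝ) * (c' * Fintype.card β) := by gcongr
    _ = ∑ a ∈ Finset.univ.filter Φ, (c' * Fintype.card β) := by simp
    _ ≤ ∑ a ∈ Finset.univ.filter Φ,
          ((Finset.univ.filter fun b => Φ a ∧ Ψ a b).card : ℝ) := by
        refine Finset.sum_le_sum fun a ha => ?_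
        have ha' : Φ a := by simpa using ha
        simpa [ha'] using hΨ a ha'
    _ ≤ ∑ a, ((Finset.univ.filter fun b => Φ a ∧ Ψ a b).card : ℝ) :=
        Finset.sum_le_univ_sum_of_nonneg fun _ => by positivity

theorem map {Φ : α → Prop} {Ψ : β → Prop} (h : DenseIn c Φ) (f : α → β)
    (hf : Function.Injective f) (hcard : Fintype.card α = Fintype.card β)
    (hΨ : ∀ a, Φ a → Ψ (f a)) : DenseIn c Ψ := by
  classical
  simp only [denseIn_iff] at *
  rw [← hcard]
  refine h.trans ?_
  have : ((Finset.univ.filter Φ).image f).card ≤ (Finset.univ.filter Ψ).card := by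
    refine Finset.card_le_card fun b hb => ?_
    obtain ⟨a, ha, rfl⟩ := Finset.mem_image.1 hb
    simpa using hΨ a (by simpa using ha)
  rw [Finset.card_image_of_injective _ hf] at this
  exact_mod_cast this

theorem fst [Nonempty β] {Φ : α × β → Prop} (h : DenseIn c Φ) :
    DenseIn c fun a => ∃ b, Φ (a, b) := by
  classical
  simp only [denseIn_iff] at *
  rw [card_filter_prod, Fintype.card_prod] at h
  have hβ : (0 : ℝ) < Fintype.card β := by exact_mod_cast Fintype.card_pos
  refine le_of_mul_le_mul_right ?_ hβ
  push_cast at h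
  calc c * (Fintype.card α : ℝ) * Fintype.card β
      = c * ((Fintype.card α : ℝ) * Fintype.card β) := by ring
    _ ≤ ∑ a, ((Finset.univ.filter fun b => Φ (a, b)).card : ℝ) := h
    _ ≤ ∑ a, if ∃ b, Φ (a, b) then (Fintype.card β : ℝ) else 0 := by
        refine Finset.sum_le_sum fun a _ => ?_
        split_ifs with hb
        · exact_mod_cast Finset.card_le_univ _
        · push Not at hb
          simp [hb]
    _ = _ := by rw [← Finset.sum_filter, Finset.sum_const, nsmul_eq_mul]

/-- Cauchy–Schwarz: duplicate the second coordinate. -/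
theorem fork {Φ : α × β → Prop} (h : DenseIn c Φ) (hc : 0 ≤ c) :
    DenseIn (c ^ 2) fun x : α × β × β => Φ (x.1, x.2.1) ∧ Φ (x.1, x.2.2) := by
  classical
  simp only [denseIn_iff] at *
  rcases isEmpty_or_nonempty α with hα | hα
  · simp
  rw [card_filter_prod, Fintype.card_prod] at h
  rw [card_filter_prod, Fintype.card_prod, Fintype.card_prod]
  have hα' : (0 : ℝ) < Fintype.card α := by exact_mod_cast Fintype.card_pos
  have hcount : ∀ a, (Finset.univ.filter fun y : β × β => Φ (a, y.1) ∧ Φ (a, y.2)).card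
      = (Finset.univ.filter fun b => Φ (a, b)).card ^ 2 := fun a => by
    rw [sq, ← Finset.card_product, ← Finset.univ_product_univ, ← Finset.filter_product]
  have hcs := sq_sum_le_card_mul_sum_sq (s := (Finset.univ : Finset α))
    (f := fun a => ((Finset.univ.filter fun b => Φ (a, b)).card : ℝ))
  simp only [hcount]
  push_cast at h ⊢
  refine le_of_mul_le_mul_left ?_ hα'
  refine le_trans ?_ hcs
  calc (Fintype.card α : ℝ) * (c ^ 2 * ((Fintype.card α : ℝ) * (Fintype.card β * Fintype.card β)))
      = (c * ((Fintype.card α : ℝ) * Fintype.card β)) ^ 2 := by ring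
    _ ≤ _ := by gcongr

theorem and_of_dense {Φ Ψ : α → Prop} (h : DenseIn c Φ) (hΨ : DenseIn (1 - ε) Ψ) :
    DenseIn (c - ε) fun a => Φ a ∧ Ψ a := by
  classical
  simp only [denseIn_iff] at *
  have h1 : (Finset.univ.filter Φ).card + (Finset.univ.filter Ψ).card
      ≤ (Finset.univ.filter fun a => Φ a ∧ Ψ a).card + Fintype.card α := by
    rw [← Finset.card_union_add_card_inter, Finset.filter_and, add_comm]
    exact Nat.add_le_add_left (Finset.card_le_univ _) _
  have h2 : ((Finset.univ.filter Φ).card : ℝ) + (Finset.univ.filter Ψ).card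
      ≤ (Finset.univ.filter fun a => Φ a ∧ Ψ a).card + Fintype.card α := by
    exact_mod_cast h1
  linarith

theorem compl {Φ : α → Prop} (h : ¬ DenseIn c Φ) : DenseIn (1 - c) fun a => ¬ Φ a := by
  classical
  simp only [denseIn_iff] at *
  have h1 := Finset.card_filter_add_card_filter_not (s := (Finset.univ : Finset α)) Φ
  rw [Finset.card_univ] at h1
  have h2 : ((Finset.univ.filter Φ).card : ℝ) + (Finset.univ.filter fun a => ¬ Φ a).card
      = Fintype.card α := by exact_mod_cast h1
  linarith

theorem univ {Φ : α → Prop} (h : ∀ a, Φ a) : DenseIn 1 Φ := by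
  classical
  simp [denseIn_iff, h]

/-- Elements of a dense set, moved along a map with small fibres. -/
theorem of_fibers {Φ : α → Prop} {Ψ : β → Prop} (h : DenseIn c Φ) (N : ℕ) (hN : 0 < N)
    (r : α → β → Prop) (hcard : Fintype.card α = Fintype.card β)
    (hr : ∀ a, Φ a → ∃ b, Ψ b ∧ r a b)
    (hfib : ∀ b, ∃ s : Finset α, s.card ≤ N ∧ ∀ a, r a b → a ∈ s) : DenseIn (c / N) Ψ := by
  classical
  simp only [denseIn_iff] at *
  choose s hs hrs using hfib
  have h1 : (Finset.univ.filter Φ) ⊆ (Finset.univ.filter Ψ).biUnion s := by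
    intro a ha
    obtain ⟨b, hb, hab⟩ := hr a (by simpa using ha)
    exact Finset.mem_biUnion.2 ⟨b, by simpa using hb, hrs b a hab⟩
  have h2 : (Finset.univ.filter Φ).card ≤ (Finset.univ.filter Ψ).card * N :=
    (Finset.card_le_card h1).trans (Finset.card_biUnion_le_card_mul _ _ _ fun b _ => hs b)
  have h3 : ((Finset.univ.filter Φ).card : ℝ) ≤ (Finset.univ.filter Ψ).card * N := by
    exact_mod_cast h2
  have hN' : (0 : ℝ) < N := by exact_mod_cast hN
  rw [div_mul_eq_mul_div, div_le_iff₀ hN', ← hcard]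
  linarith

end DenseIn

end Density

section ListDensity

open scoped List

/-- At least a proportion `c` of the lists of length `m` satisfy `P`. -/
def LDense {V : Type*} [Fintype V] (c : ℝ) (m : ℕ) (P : List V → Prop) : Prop :=
  DenseIn c fun L : List.Vector V m => P L.toList

variable {V : Type*} [Fintype V] {c c' : ℝ} {a b m : ℕ}

/-- Transfer of density along an injective encoding by lists of length `m`. -/
theorem DenseIn.toLDense {α : Type*} [Fintype α] {Φ : α → Prop} {P : List V → Prop}
    (h : DenseIn c Φ) (f : α → List V) (hlen : ∀ x, (f x).length = m)
    (hinj : Function.Injective f) (hcard : Fintype.card α = Fintype.card V ^ m)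
    (hP : ∀ x, Φ x → P (f x)) : LDense c m P :=
  h.map (fun x => (⟨f x, hlen x⟩ : List.Vector V m))
    (fun _ _ hxy => hinj (congrArg Subtype.val hxy)) (by rw [hcard, card_vector])
    fun x hx => hP x hx

namespace LDense

theorem mono {P Q : List V → Prop} (h : LDense c m P) (hc : c' ≤ c)
    (hPQ : ∀ L, L.length = m → P L → Q L) : LDense c' m Q :=
  DenseIn.mono h hc fun L => hPQ _ L.2

theorem append {P : List V → Prop} {Q : List V → List V → Prop} {R : List V → Prop}
    (h : LDense c a P) (hc' : 0 ≤ c') (hQ : ∀ L, L.length = a → P L → LDense c' b (Q L))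
    (hR : ∀ L M, L.length = a → M.length = b → P L → Q L M → R (L ++ M)) :
    LDense (c * c') (a + b) R := by
  have h1 := DenseIn.bind (Ψ := fun (L : List.Vector V a) (M : List.Vector V b) =>
    Q L.toList M.toList) h hc' fun L hL => hQ _ L.2 hL
  refine h1.toLDense (fun x => x.1.toList ++ x.2.toList) (by simp) ?_ ?_ ?_
  · rintro ⟨L, M⟩ ⟨L', M'⟩ hLM
    have := List.append_inj hLM (by simp)
    exact Prod.ext (Subtype.ext this.1) (Subtype.ext this.2)
  · simp [card_vector, pow_add]
  · rintro ⟨L, M⟩ ⟨h1, h2⟩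
    exact hR _ _ L.2 M.2 h1 h2

theorem split {P : List V → Prop} (h : LDense c (a + b) P) :
    DenseIn c fun x : List.Vector V a × List.Vector V b => P (x.1.toList ++ x.2.toList) := by
  refine DenseIn.map h (fun L => (⟨L.toList.take a, by simp⟩, ⟨L.toList.drop a, by simp⟩)) ?_ ?_ ?_
  · intro L M hLM
    have h1 : L.toList.take a = M.toList.take a := congrArg (fun x => x.1.1) hLM
    have h2 : L.toList.drop a = M.toList.drop a := congrArg (fun x => x.2.1) hLM
    refine Subtype.ext ?_
    calc L.toList = _ := (List.take_append_drop a _).symm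
      _ = M.toList.take a ++ M.toList.drop a := by rw [h1, h2]
      _ = M.toList := List.take_append_drop a _
  · simp [card_vector, pow_add]
  · intro L hL
    change P (L.toList.take a ++ L.toList.drop a)
    rwa [List.take_append_drop]

theorem exists_of_pos [Nonempty V] {P : List V → Prop} (h : LDense c m P) (hc : 0 < c) :
    ∃ L, L.length = m ∧ P L := by
  have : Nonempty (List.Vector V m) := ⟨List.Vector.replicate m (Classical.arbitrary V)⟩
  obtain ⟨L, hL⟩ := DenseIn.exists_of_pos h hc
  exact ⟨L.toList, L.2, hL⟩

theorem and_of_dense {ε : ℝ} {P Q : List V → Prop} (h : LDense c m P)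
    (hQ : LDense (1 - ε) m Q) : LDense (c - ε) m fun L => P L ∧ Q L :=
  DenseIn.and_of_dense h hQ

theorem cons {P : List V → Prop} {Φ : V → Prop} (h : DenseIn c Φ) (hc' : 0 ≤ c')
    (hP : ∀ v, Φ v → LDense c' m fun L => P (v :: L)) : LDense (c * c') (m + 1) P := by
  have h1 := DenseIn.bind (Ψ := fun v (M : List.Vector V m) => P (v :: M.toList)) h hc' hP
  refine h1.toLDense (fun x => x.1 :: x.2.toList) (by simp) ?_ ?_ ?_
  · rintro ⟨v, M⟩ ⟨w, M'⟩ h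
    simp only [List.cons.injEq] at h
    exact Prod.ext h.1 (Subtype.ext h.2)
  · simp [card_vector, pow_succ, mul_comm]
  · exact fun x hx => hx.2

/-- Building lists one element at a time, most choices being good at every step. -/
theorem of_step {δ : ℝ} {P : List V → Prop} (hδ : δ ≤ 1) (h0 : P [])
    (hs : ∀ L, L.length < m → P L → DenseIn (1 - δ) fun v => P (v :: L)) :
    LDense (1 - m * δ) m P := by
  have key : ∀ j ≤ m, LDense ((1 - δ) ^ j) j P := by
    intro j
    induction j with
    | zero =>
      intro _
      refine (DenseIn.univ fun L => ?_).mono (by simp) fun _ h => h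
      have : L.toList = [] := List.length_eq_zero_iff.1 L.2
      rwa [this]
    | succ j ih =>
      intro hj
      have h1 := DenseIn.bind (Ψ := fun (M : List.Vector V j) v => P (v :: M.toList))
        (ih (by omega)) (by linarith : 0 ≤ 1 - δ)
        fun L hL => hs _ (by rw [L.toList_length]; omega) hL
      rw [← pow_succ] at h1
      refine h1.toLDense (fun x => x.2 :: x.1.toList) (by simp) ?_ ?_ ?_
      · rintro ⟨M, v⟩ ⟨M', w⟩ h
        simp only [List.cons.injEq] at h
        exact Prod.ext (Subtype.ext h.2) h.1
      · simp [card_vector, pow_succ]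
      · exact fun x hx => hx.2
  refine (key m le_rfl).mono ?_ fun _ _ h => h
  have := one_add_mul_le_pow (a := -δ) (by linarith) m
  rw [← sub_eq_add_neg] at this
  linarith

theorem forall_mem {δ : ℝ} {W : V → Prop} (hδ : δ ≤ 1) (hW : DenseIn (1 - δ) W) (m : ℕ) :
    LDense (1 - m * δ) m fun L => ∀ x ∈ L, W x :=
  of_step hδ (by simp) fun L _ hL => hW.mono le_rfl fun v hv => by simpa [hv] using hL

end LDense

theorem denseIn_notMem_list (L : List V) {δ : ℝ} (hL : (L.length : ℝ) ≤ δ * Fintype.card V) :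
    DenseIn (1 - δ) fun v : V => v ∉ L := by
  classical
  rw [denseIn_iff]
  have h1 := Finset.card_filter_add_card_filter_not (s := (Finset.univ : Finset V)) (· ∈ L)
  rw [Finset.card_univ] at h1
  have h2 : (Finset.univ.filter (· ∈ L)).card ≤ L.length := by
    rw [show Finset.univ.filter (· ∈ L) = L.toFinset by ext; simp]
    exact L.toFinset_card_le
  have h3 : ((Finset.univ.filter (· ∈ L)).card : ℝ) ≤ L.length := by exact_mod_cast h2
  have h4 : ((Finset.univ.filter (· ∈ L)).card : ℝ) + (Finset.univ.filter fun v => v ∉ L).card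
      = Fintype.card V := by exact_mod_cast h1
  linarith

theorem LDense.nodup_append (U : List V) (hU : U.Nodup) {δ : ℝ} (hδ : δ ≤ 1) (m : ℕ)
    (h : ((U.length + m : ℕ) : ℝ) ≤ δ * Fintype.card V) :
    LDense (1 - m * δ) m fun L => (U ++ L).Nodup := by
  refine LDense.of_step hδ (by simpa using hU) fun L hL hN => ?_
  refine (denseIn_notMem_list (U ++ L) (δ := δ) ?_).mono le_rfl fun v hv => ?_
  · refine le_trans ?_ h
    rw [List.length_append]
    exact_mod_cast (by omega : U.length + L.length ≤ U.length + m)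
  · rw [List.nodup_middle]
    exact List.nodup_cons.2 ⟨hv, hN⟩

theorem LDense.perm_of_forall {P Q : List V → Prop} (h : LDense c m P)
    (hPQ : ∀ L, P L → ∃ L', L ~ L' ∧ Q L') : LDense (c / m.factorial) m Q := by
  classical
  refine DenseIn.of_fibers h m.factorial (Nat.factorial_pos m)
    (fun L L' => L.toList ~ L'.toList) rfl ?_ ?_
  · intro L hL
    obtain ⟨L', h1, h2⟩ := hPQ _ hL
    exact ⟨⟨L', by rw [← h1.length_eq, L.toList_length]⟩, h2, h1⟩
  · intro L'
    let g : List V → Option (List.Vector V m) := fun l =>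
      if hl : l.length = m then some ⟨l, hl⟩ else none
    refine ⟨(L'.toList.permutations.filterMap g).toFinset, ?_, ?_⟩
    · refine (List.toFinset_card_le _).trans ((List.length_filterMap_le _ _).trans ?_)
      rw [List.length_permutations, L'.toList_length]
    · intro L hL
      rw [List.mem_toFinset, List.mem_filterMap]
      refine ⟨L.toList, List.mem_permutations.2 hL, ?_⟩
      exact dif_pos L.toList_length

end ListDensity

section Paths

open scoped List

variable {V : Type*}

/-- `E` is the family of all orderings of the edges of a `k`-graph. -/
structure IsEdgeFamily (k : ℕ) (E : List V → Prop) : Prop where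
  length_eq : ∀ {L}, E L → L.length = k
  nodup : ∀ {L}, E L → L.Nodup
  perm : ∀ {L L'}, L ~ L' → E L → E L'

/-- `A ++ Z ++ B` is an `l`-walk with ends `A`, `B`, whose edges of size `2 * l + p` lie in `E`. -/
inductive Conn (E : List V → Prop) (l p : ℕ) : List V → List V → List V → Prop
  | edge {A X B : List V} : A.length = l → X.length = p → B.length = l → E (A ++ X ++ B) →
      Conn E l p A X B
  | cons {A X C Z B : List V} : A.length = l → X.length = p → C.length = l → E (A ++ X ++ C) →
      Conn E l p C Z B → Conn E l p A (X ++ C ++ Z) B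

variable {E : List V → Prop} {l p : ℕ} {A B C Z Z' : List V}

namespace Conn

theorem trans (h : Conn E l p A Z C) (h' : Conn E l p C Z' B) :
    Conn E l p A (Z ++ C ++ Z') B := by
  induction h with
  | edge h1 h2 h3 h4 => exact .cons h1 h2 h3 h4 h'
  | cons h1 h2 h3 h4 _ ih => simpa using Conn.cons h1 h2 h3 h4 (ih h')

theorem length_left (h : Conn E l p A Z B) : A.length = l := by cases h <;> assumption

theorem length_right (h : Conn E l p A Z B) : B.length = l := by induction h <;> assumption

theorem nodup_left {k : ℕ} (hE : IsEdgeFamily k E) (h : Conn E l p A Z B) : A.Nodup := by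
  cases h with
  | edge _ _ _ h => exact (List.nodup_append.1 (List.nodup_append.1 (hE.nodup h)).1).1
  | cons _ _ _ h => exact (List.nodup_append.1 (List.nodup_append.1 (hE.nodup h)).1).1

theorem nodup_right {k : ℕ} (hE : IsEdgeFamily k E) (h : Conn E l p A Z B) : B.Nodup := by
  induction h with
  | edge _ _ _ h => exact (List.nodup_append.1 (hE.nodup h)).2.1
  | cons _ _ _ _ _ ih => exact ih

end Conn

/-- `L` together with `P`, as well as `L` together with `Q`, can be ordered as an `l`-walk, with
the same ends in `L`. -/
def Flex (E : List V → Prop) (l p : ℕ) (P Q L : List V) : Prop :=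
  ∃ A Z B Z₁ Z₂, L ~ A ++ Z ++ B ∧ Z₁ ~ P ++ Z ∧ Z₂ ~ Q ++ Z ∧
    Conn E l p A Z₁ B ∧ Conn E l p A Z₂ B

namespace Flex

variable {P Q P' Q' L L' : List V}

theorem symm (h : Flex E l p P Q L) : Flex E l p Q P L := by
  obtain ⟨A, Z, B, Z₁, Z₂, h1, h2, h3, h4, h5⟩ := h
  exact ⟨A, Z, B, Z₂, Z₁, h1, h3, h2, h5, h4⟩

theorem perm (h : Flex E l p P Q L) (hP : P ~ P') (hQ : Q ~ Q') (hL : L ~ L') :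
    Flex E l p P' Q' L' := by
  obtain ⟨A, Z, B, Z₁, Z₂, h1, h2, h3, h4, h5⟩ := h
  exact ⟨A, Z, B, Z₁, Z₂, hL.symm.trans h1, h2.trans (hP.append_right Z),
    h3.trans (hQ.append_right Z), h4, h5⟩

/-- Vertices used by both walks may be moved to the common part. -/
theorem internalize {I : List V} (h : Flex E l p (P ++ I) (Q ++ I) L) :
    Flex E l p P Q (I ++ L) := by
  obtain ⟨A, Z, B, Z₁, Z₂, h1, h2, h3, h4, h5⟩ := h
  refine ⟨A, I ++ Z, B, Z₁, Z₂, ?_, by simpa using h2, by simpa using h3, h4, h5⟩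
  classical
  rw [List.perm_iff_count] at h1 ⊢
  intro a
  have := h1 a
  simp only [List.count_append] at this ⊢
  omega

theorem concat {k : ℕ} (hE : IsEdgeFamily k E) (h : Flex E l p P Q L)
    (h' : Flex E l p P' Q' L') :
    ∃ B A, B.length = l ∧ B.Nodup ∧ A.length = l ∧ A.Nodup ∧
      ∀ K, Conn E l p B K A → Flex E l p (P ++ P') (Q ++ Q') (L ++ (L' ++ K)) := by
  classical
  obtain ⟨A, Z, B, Z₁, Z₂, h1, h2, h3, h4, h5⟩ := h
  obtain ⟨A', Z', B', Z₁', Z₂', h1', h2', h3', h4', h5'⟩ := h'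
  refine ⟨B, A', h4.length_right, h4.nodup_right hE, h4'.length_left, h4'.nodup_left hE, ?_⟩
  intro K hK
  refine ⟨A, Z ++ B ++ K ++ A' ++ Z', B', _, _, ?_, ?_, ?_, (h4.trans hK).trans h4',
    (h5.trans hK).trans h5'⟩ <;>
  · rw [List.perm_iff_count] at *
    intro a
    specialize h1 a; specialize h2 a; specialize h3 a
    specialize h1' a; specialize h2' a; specialize h3' a
    simp only [List.count_append] at *
    omega

theorem extend {k : ℕ} (hE : IsEdgeFamily k E) (h : Flex E l p P Q L) :
    ∃ B, B.length = l ∧ B.Nodup ∧ ∀ Y, Y.length = p + l → E (B ++ Y) →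
      Flex E l p P Q (L ++ Y) := by
  classical
  obtain ⟨A, Z, B, Z₁, Z₂, h1, h2, h3, h4, h5⟩ := h
  refine ⟨B, h4.length_right, h4.nodup_right hE, fun Y hY hBY => ?_⟩
  have hc : Conn E l p B (Y.take p) (Y.drop p) :=
    .edge h4.length_right (by simp [hY]) (by simp [hY]) (by simpa using hBY)
  refine ⟨A, Z ++ B ++ Y.take p, Y.drop p, _, _, ?_, ?_, ?_, h4.trans hc, h5.trans hc⟩
  · rw [List.perm_iff_count] at *
    intro a
    specialize h1 a
    have := congrArg (List.count a) (List.take_append_drop p Y)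
    simp only [List.count_append] at *
    omega
  · simpa using h2.append_right (B ++ Y.take p)
  · simpa using h3.append_right (B ++ Y.take p)

theorem of_conn {Z₁ Z₂ : List V} (h₁ : Conn E l p A Z₁ B) (h₂ : Conn E l p A Z₂ B) :
    Flex E l p Z₁ Z₂ (A ++ B) :=
  ⟨A, [], B, Z₁, Z₂, by simp, by simp, by simp, h₁, h₂⟩

end Flex

section Density

variable [Fintype V] {k : ℕ} {c c₀ c₁ : ℝ} {m m₀ m₁ : ℕ}

/-- Any two ends are joined by a proportion `c` of the lists of length `m`. -/
def ConnDense (E : List V → Prop) (l p : ℕ) (c : ℝ) (m : ℕ) : Prop :=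
  ∀ A B : List V, A.length = l → A.Nodup → B.length = l → B.Nodup →
    LDense c m fun K => Conn E l p A K B

/-- Every `d`-set has relative degree at least `c`, in terms of ordered edges. -/
def DegDense (E : List V → Prop) (k d : ℕ) (c : ℝ) : Prop :=
  ∀ A : List V, A.length = d → A.Nodup → LDense c (k - d) fun Y => E (A ++ Y)

theorem Flex.dense_append_exchanges (hE : IsEdgeFamily k E) (hC : ConnDense E l p c₀ m₀)
    (hc₀ : 0 ≤ c₀) (hc₁ : 0 ≤ c₁) {as bs : List V}
    (h : List.Forall₂ (fun a b => LDense c₁ m₁ (Flex E l p [a] [b])) as bs) :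
    ∀ {P Q L : List V}, Flex E l p P Q L →
      LDense ((c₁ * c₀) ^ as.length) (as.length * (m₁ + m₀))
        fun G => Flex E l p (P ++ as) (Q ++ bs) (L ++ G) := by
  induction h with
  | nil =>
    intro P Q L hL
    refine (DenseIn.univ fun G => ?_).mono (by simp) fun _ h => h
    have : G.toList = [] :=
      List.length_eq_zero_iff.1 (G.toList_length.trans (by rw [List.length_nil, zero_mul]))
    simpa [this] using hL
  | @cons a b as bs hab _ ih =>
    intro P Q L hL
    have h1 : LDense (c₁ * c₀) (m₁ + m₀)
        fun G => Flex E l p (P ++ [a]) (Q ++ [b]) (L ++ G) := by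
      classical
      choose! B A hB hBn hA hAn hK using fun L' (h' : Flex E l p [a] [b] L') => hL.concat hE h'
      exact LDense.append hab hc₀ (Q := fun L' K => Conn E l p (B L') K (A L'))
        (fun L' _ h' => hC _ _ (hB _ h') (hBn _ h') (hA _ h') (hAn _ h'))
        fun L' K _ _ h' hK' => hK L' h' K hK'
    have h2 := LDense.append h1 (by positivity) (fun G _ hG => ih hG)
      (R := fun G => Flex E l p (P ++ a :: as) (Q ++ b :: bs) (L ++ G))
      (fun G G' _ _ _ h => by simpa using h)
    have e : (a :: as).length * (m₁ + m₀) = (m₁ + m₀) + as.length * (m₁ + m₀) := by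
      simp; ring
    rw [e, List.length_cons, pow_succ']
    exact h2

/-- Combining a dense family of flexible walks with exchanges. -/
theorem LDense.flex_of_exchanges (hE : IsEdgeFamily k E) (hC : ConnDense E l p c₀ m₀)
    (hc₀ : 0 ≤ c₀) (hc₁ : 0 ≤ c₁) {Φ : List V → Prop} (hΦ : LDense c m Φ) (r : ℕ)
    (P₀ Q₀ : List V)
    (h : ∀ M, M.length = m → Φ M → ∃ P Q L as bs I, Flex E l p P Q L ∧ as.length = r ∧
      List.Forall₂ (fun a b => LDense c₁ m₁ (Flex E l p [a] [b])) as bs ∧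
      P ++ as ~ P₀ ++ I ∧ Q ++ bs ~ Q₀ ++ I ∧ I ++ L ~ M) :
    LDense (c * (c₁ * c₀) ^ r) (m + r * (m₁ + m₀)) (Flex E l p P₀ Q₀) := by
  refine LDense.append hΦ (by positivity) (Q := fun M G => Flex E l p P₀ Q₀ (M ++ G)) ?_
    (fun M G _ _ _ h => h)
  intro M hM hΦM
  obtain ⟨P, Q, L, as, bs, I, h1, rfl, h2, h3, h4, h5⟩ := h M hM hΦM
  refine (Flex.dense_append_exchanges hE hC hc₀ hc₁ h2 h1).mono le_rfl fun G _ hG => ?_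
  exact ((hG.perm h3 h4 (List.Perm.refl _)).internalize).perm (List.Perm.refl _)
    (List.Perm.refl _) (by simpa using h5.append_right G)

theorem LDense.flex_extend (hE : IsEdgeFamily (2 * l + p) E) (hD : DegDense E (2 * l + p) l c₀)
    (hc₀ : 0 ≤ c₀) {P Q : List V} (h : LDense c m (Flex E l p P Q)) (j : ℕ) :
    LDense (c * c₀ ^ j) (m + j * (l + p)) (Flex E l p P Q) := by
  induction j with
  | zero => simpa using h
  | succ j ih =>
    have e : m + (j + 1) * (l + p) = (m + j * (l + p)) + (2 * l + p - l) := by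
      have : 2 * l + p - l = l + p := by omega
      rw [this]; ring
    rw [e, pow_succ, ← mul_assoc]
    choose! B hB hBn hK using fun L (h : Flex E l p P Q L) => h.extend hE
    exact LDense.append ih hc₀ (Q := fun L Y => E (B L ++ Y))
      (fun L _ hL => hD _ (hB L hL) (hBn L hL))
      fun L Y _ hY hL hLY => hK L hL Y (by omega) hLY

theorem ConnDense.extend (hE : IsEdgeFamily (2 * l + p) E) (hD : DegDense E (2 * l + p) l c₁)
    (hC : ConnDense E l p c₀ m₀) (hc₀ : 0 ≤ c₀) : ConnDense E l p (c₁ * c₀) (m₀ + (l + p)) := by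
  intro A B hA hAn hB hBn
  have e : m₀ + (l + p) = (2 * l + p - l) + m₀ := by omega
  rw [e]
  refine LDense.append (hD A hA hAn) hc₀ (Q := fun Y K => Conn E l p (Y.drop p) K B) ?_ ?_
  · intro Y hY hAY
    refine hC _ _ (by simp; omega) ?_ hB hBn
    exact (List.nodup_append.1 (hE.nodup hAY)).2.1.sublist (List.drop_sublist _ _)
  · intro Y K hY _ hAY hK
    have := Conn.cons hA (X := Y.take p) (C := Y.drop p) (by simp; omega) (by simp; omega)
      (by simpa using hAY) hK
    simpa using this

end Density

end Paths

section Exchange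

open scoped List

theorem DenseIn.pair_of_three {α : Type*} [Fintype α] [Nonempty α] {ε : ℝ} {Φ₁ Φ₂ Φ₃ : α → Prop}
    (h₁ : DenseIn (1 / 3 + ε) Φ₁) (h₂ : DenseIn (1 / 3 + ε) Φ₂) (h₃ : DenseIn (1 / 3 + ε) Φ₃) :
    (DenseIn ε fun a => Φ₁ a ∧ Φ₂ a) ∨ (DenseIn ε fun a => Φ₁ a ∧ Φ₃ a) ∨
      DenseIn ε fun a => Φ₂ a ∧ Φ₃ a := by
  classical
  by_contra! h
  simp only [denseIn_iff, not_le] at *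
  obtain ⟨h12, h13, h23⟩ := h
  have key : (Finset.univ.filter Φ₁).card + (Finset.univ.filter Φ₂).card
      + (Finset.univ.filter Φ₃).card ≤ Fintype.card α
      + (Finset.univ.filter fun a => Φ₁ a ∧ Φ₂ a).card
      + (Finset.univ.filter fun a => Φ₁ a ∧ Φ₃ a).card
      + (Finset.univ.filter fun a => Φ₂ a ∧ Φ₃ a).card := by
    rw [show Fintype.card α = ∑ _a : α, 1 by simp]
    simp only [Finset.card_filter, ← Finset.sum_add_distrib]
    refine Finset.sum_le_sum fun a _ => ?_
    by_cases h1 : Φ₁ a <;> by_cases h2 : Φ₂ a <;> by_cases h3 : Φ₃ a <;> simp [h1, h2, h3]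
  have key' : ((Finset.univ.filter Φ₁).card : ℝ) + (Finset.univ.filter Φ₂).card
      + (Finset.univ.filter Φ₃).card ≤ Fintype.card α
      + (Finset.univ.filter fun a => Φ₁ a ∧ Φ₂ a).card
      + (Finset.univ.filter fun a => Φ₁ a ∧ Φ₃ a).card
      + (Finset.univ.filter fun a => Φ₂ a ∧ Φ₃ a).card := by exact_mod_cast key
  linarith

/-- A reflexive symmetric relation without independent triples is close to a union of two
cliques, unless any two elements are related or have many common neighbours. -/
theorem two_cliques_of_no_independent_triple {α : Type*} [Fintype α] {R : α → α → Prop}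
    (hs : ∀ x y, R x y → R y x) (h3 : ∀ x y z, R x y ∨ R x z ∨ R y z) (δ : ℝ) :
    (∀ x y, R x y ∨ DenseIn δ fun z => R x z ∧ R z y) ∨
    (∃ W : α → Prop, DenseIn (1 - 2 * δ) W ∧ ∀ x y, W x → W y → R x y) ∨
    ∃ W₁ W₂ : α → Prop, DenseIn (1 - δ) (fun x => W₁ x ∨ W₂ x) ∧ DenseIn δ W₁ ∧ DenseIn δ W₂ ∧
      (∀ x y, W₁ x → W₁ y → R x y) ∧ ∀ x y, W₂ x → W₂ y → R x y := by
  rw [or_iff_not_imp_left]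
  intro h
  push Not at h
  obtain ⟨u, v, huv, hd⟩ := h
  have hcl : ∀ w x y, ¬ R w x → ¬ R w y → R x y := fun w x y hx hy => by
    have := h3 w x y
    tauto
  have hU := (DenseIn.compl hd).mono le_rfl (Ψ := fun x => ¬ R u x ∨ ¬ R v x) fun x hx => by
    have := hs x v
    by_contra! h
    exact hx ⟨h.1, hs _ _ h.2⟩
  by_cases h1 : DenseIn δ fun x => ¬ R u x
  · by_cases h2 : DenseIn δ fun x => ¬ R v x
    · exact .inr ⟨_, _, hU, h1, h2, fun x y => hcl u x y, fun x y => hcl v x y⟩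
    · refine .inl ⟨fun x => ¬ R u x, ?_, fun x y => hcl u x y⟩
      refine (hU.and_of_dense (DenseIn.compl h2)).mono (by linarith) ?_
      rintro x ⟨hx, hx'⟩
      tauto
  · refine .inl ⟨fun x => ¬ R v x, ?_, fun x y => hcl v x y⟩
    refine (hU.and_of_dense (DenseIn.compl h1)).mono (by linarith) ?_
    rintro x ⟨hx, hx'⟩
    tauto

variable {V : Type*} {E : List V → Prop} {l p : ℕ}

theorem Flex.of_edges (hE : IsEdgeFamily (2 * l + p) E) (hp : 1 ≤ p) {u v : V} {Y : List V}
    (hY : Y.length = 2 * l + p - 1) (hu : E (u :: Y)) (hv : E (v :: Y)) :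
    Flex E l p [u] [v] Y := by
  obtain ⟨A, X, B, rfl, hA, hX, hB⟩ : ∃ A X B, Y = A ++ X ++ B ∧ A.length = l ∧
      X.length = p - 1 ∧ B.length = l :=
    ⟨Y.take l, (Y.drop l).take (p - 1), (Y.drop l).drop (p - 1), by simp, by simp; omega,
      by simp; omega, by simp; omega⟩
  have key : ∀ w, E (w :: (A ++ X ++ B)) → Conn E l p A ([w] ++ X) B := fun w hw =>
    .edge hA (by simp [hX]; omega) hB (hE.perm (by simpa using List.perm_middle.symm) hw)
  exact ⟨A, X, B, _, _, List.Perm.refl _, List.Perm.refl _, List.Perm.refl _, key u hu, key v hv⟩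

/-- The configuration exchanging `y` and `c'` in a walk of two edges. -/
theorem Flex.of_crossing (hE : IsEdgeFamily (2 * l + p) E) (hl : 1 ≤ l) (hp : 1 ≤ p)
    {x y c c' : V} {C r r' : List V} (hC : C.length = l - 1) (hr : r.length = l + p - 1)
    (hr' : r'.length = l + p - 1) (h₁ : E (y :: c :: C ++ r)) (h₂ : E (x :: c' :: C ++ r))
    (h₃ : E (x :: c :: C ++ r')) : Flex E l p [y] [c'] (x :: c :: C ++ r ++ r') := by
  classical
  obtain ⟨A, P, rfl, hA, hP⟩ : ∃ A P, r' = A ++ P ∧ A.length = l ∧ P.length = p - 1 :=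
    ⟨r'.take l, r'.drop l, by simp, by simp; omega, by simp; omega⟩
  obtain ⟨Q, B, rfl, hQ, hB⟩ : ∃ Q B, r = Q ++ B ∧ Q.length = p - 1 ∧ B.length = l :=
    ⟨r.take (p - 1), r.drop (p - 1), by simp, by simp; omega, by simp; omega⟩
  refine ⟨A, x :: c :: (C ++ P ++ Q), B, (x :: P) ++ (c :: C) ++ (y :: Q),
    (c :: P) ++ (x :: C) ++ (c' :: Q), ?_, ?_, ?_, ?_, ?_⟩
  · rw [List.perm_iff_count]; intro a; simp only [List.count_append, List.count_cons]; omega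
  · rw [List.perm_iff_count]; intro a
    simp only [List.count_append, List.count_cons, List.count_nil]; omega
  · rw [List.perm_iff_count]; intro a
    simp only [List.count_append, List.count_cons, List.count_nil]; omega
  · refine .cons hA (by simp [hP]; omega) (by simp [hC]; omega) (hE.perm ?_ h₃)
      (.edge (by simp [hC]; omega) (by simp [hQ]; omega) hB (hE.perm ?_ h₁)) <;>
    · rw [List.perm_iff_count]; intro a; simp only [List.count_append, List.count_cons]; omega
  · refine .cons hA (by simp [hP]; omega) (by simp [hC]; omega) (hE.perm ?_ h₃)
      (.edge (by simp [hC]; omega) (by simp [hQ]; omega) hB (hE.perm ?_ h₂)) <;>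
    · rw [List.perm_iff_count]; intro a; simp only [List.count_append, List.count_cons]; omega

/-- Crossing configurations in a dense tripartite structure. -/
theorem DenseIn.crossing {α β γ δ : Type*} [Fintype α] [Fintype β] [Fintype γ] [Fintype δ]
    [Nonempty β] [Nonempty γ] {c : ℝ} {Θ : δ → α → β → γ → Prop}
    (h : DenseIn c fun x : δ × α × β × γ => Θ x.1 x.2.1 x.2.2.1 x.2.2.2) (hc : 0 ≤ c) :
    DenseIn (c ^ 8) fun x : (δ × γ × γ) × (α × α) × (β × β) =>
      Θ x.1.1 x.2.1.1 x.2.2.1 x.1.2.1 ∧ Θ x.1.1 x.2.1.2 x.2.2.2 x.1.2.1 ∧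
        Θ x.1.1 x.2.1.2 x.2.2.1 x.1.2.2 := by
  have h1 := (h.map (Ψ := fun x : (δ × α × β) × γ => Θ x.1.1 x.1.2.1 x.1.2.2 x.2)
    (fun x => ((x.1, x.2.1, x.2.2.1), x.2.2.2)) (by rintro ⟨⟩ ⟨⟩; grind)
    (by simp only [Fintype.card_prod]; ring) fun x hx => hx).fork hc
  have h2 := (h1.map (Ψ := fun x : (δ × α × γ) × β × γ =>
      Θ x.1.1 x.1.2.1 x.2.1 x.1.2.2 ∧ Θ x.1.1 x.1.2.1 x.2.1 x.2.2)
    (fun x => ((x.1.1, x.1.2.1, x.2.1), x.1.2.2, x.2.2)) (by rintro ⟨⟩ ⟨⟩; grind)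
    (by simp only [Fintype.card_prod]; ring) fun x hx => hx).fork (by positivity)
  have h3 := ((h2.map (Ψ := fun x : ((δ × β × γ) × α × γ × β) × γ =>
      Θ x.1.1.1 x.1.2.1 x.1.1.2.1 x.1.1.2.2 ∧ Θ x.1.1.1 x.1.2.1 x.1.1.2.1 x.1.2.2.1 ∧
        Θ x.1.1.1 x.1.2.1 x.1.2.2.2 x.1.1.2.2)
    (fun x => (((x.1.1, x.2.1.1, x.1.2.2), x.1.2.1, x.2.1.2, x.2.2.1), x.2.2.2))
    (by rintro ⟨⟩ ⟨⟩; grind) (by simp only [Fintype.card_prod]; ring)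
    fun x hx => ⟨hx.1.1, hx.1.2, hx.2.1⟩).fst.mono (Ψ := fun x : (δ × β × γ) × α × γ × β =>
      Θ x.1.1 x.2.1 x.1.2.1 x.1.2.2 ∧ Θ x.1.1 x.2.1 x.1.2.1 x.2.2.1 ∧
        Θ x.1.1 x.2.1 x.2.2.2 x.1.2.2) le_rfl fun x ⟨_, hx⟩ => hx).fork (by positivity)
  have h4 := (h3.map (Ψ := fun x : ((δ × γ × γ) × (α × α) × (β × β)) × γ × β =>
      Θ x.1.1.1 x.1.2.1.1 x.1.2.2.1 x.1.1.2.1 ∧ Θ x.1.1.1 x.1.2.1.2 x.1.2.2.2 x.1.1.2.1 ∧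
        Θ x.1.1.1 x.1.2.1.2 x.1.2.2.1 x.1.1.2.2)
    (fun x => (((x.1.1, x.1.2.2, x.2.1.2.1), (x.2.2.1, x.2.1.1), (x.1.2.1, x.2.1.2.2)),
      x.2.2.2)) (by rintro ⟨⟩ ⟨⟩; grind) (by simp only [Fintype.card_prod]; ring)
    fun x hx => ⟨hx.2.1, hx.1.2.2, hx.1.2.1⟩).fst
  exact h4.mono (by rw [← pow_mul, ← pow_mul]) fun x ⟨_, hx⟩ => hx

end Exchange

section Bulk

open scoped List

variable {V : Type*} {E : List V → Prop} {l p : ℕ} {ε c : ℝ}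

/-- The degree and connection properties from which absorbers are built. -/
structure Robust [Fintype V] (E : List V → Prop) (l p m₀ : ℕ) (ε c : ℝ) : Prop where
  isEdgeFamily : IsEdgeFamily (2 * l + p) E
  deg_one : DegDense E (2 * l + p) 1 (1 / 3 + ε)
  deg_two : DegDense E (2 * l + p) 2 c
  deg_ends : DegDense E (2 * l + p) l c
  conn : ConnDense E l p c m₀

namespace Robust

variable [Fintype V] {m₀ s : ℕ}

/-- `u` and `v` have many common links. -/
def Rel (E : List V → Prop) (l p : ℕ) (ε : ℝ) (u v : V) : Prop :=
  LDense ε (2 * l + p - 1) fun Y => E (u :: Y) ∧ E (v :: Y)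

theorem Rel.symm {u v : V} (h : Rel E l p ε u v) : Rel E l p ε v u :=
  h.mono le_rfl fun _ _ h => h.symm

theorem rel_three [Nonempty V] (h : Robust E l p m₀ ε c) (u v w : V) :
    Rel E l p ε u v ∨ Rel E l p ε u w ∨ Rel E l p ε v w := by
  have : Nonempty (List.Vector V (2 * l + p - 1)) :=
    ⟨List.Vector.replicate _ (Classical.arbitrary V)⟩
  have hd : ∀ u, LDense (1 / 3 + ε) (2 * l + p - 1) fun Y => E (u :: Y) := fun u =>
    h.deg_one [u] rfl (by simp)
  exact (hd u).pair_of_three (hd v) (hd w)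

theorem flex_of_rel (h : Robust E l p m₀ ε c) (hp : 1 ≤ p) {u v : V} (huv : Rel E l p ε u v) :
    LDense ε (2 * l + p - 1) (Flex E l p [u] [v]) :=
  huv.mono le_rfl fun _ hY hE => .of_edges h.isEdgeFamily hp hY hE.1 hE.2

/-- Exchanging via a common neighbour. -/
theorem flex_of_common (h : Robust E l p m₀ ε c) (hε : 0 ≤ ε) (hc : 0 ≤ c) (hp : 1 ≤ p)
    {δ : ℝ} {u v : V} (huv : DenseIn δ fun w => Rel E l p ε u w ∧ Rel E l p ε w v) :
    LDense ((δ * ε) * (ε * c) ^ 1) ((2 * l + p - 1 + 1) + 1 * (2 * l + p - 1 + m₀))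
      (Flex E l p [u] [v]) := by
  have h1 : LDense (δ * ε) (2 * l + p - 1 + 1)
      fun M => ∃ w L, M = w :: L ∧ Rel E l p ε w v ∧ Flex E l p [u] [w] L :=
    LDense.cons huv hε fun w hw => (h.flex_of_rel hp hw.1).mono le_rfl
      fun L _ hL => ⟨w, L, rfl, hw.2, hL⟩
  refine h1.flex_of_exchanges h.isEdgeFamily h.conn hc hε 1 _ _ ?_
  rintro _ - ⟨w, L, rfl, hw, hL⟩
  refine ⟨_, _, L, [w], [v], [w], hL, rfl, ?_, by simp, ?_, by simp⟩
  · simpa using h.flex_of_rel hp hw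
  · exact List.Perm.swap _ _ _

theorem dense_crossing (h : Robust E l p m₀ ε c) (hc : 0 ≤ c) (hl : 1 ≤ l) (hp : 1 ≤ p) [Nonempty V]
    {δ : ℝ} {W₁ W₂ : V → Prop} (h₁ : DenseIn δ W₁) (h₂ : DenseIn δ W₂) (hδ : 0 ≤ δ)
    (hV : 1 ≤ δ / 2 * Fintype.card V) :
    LDense ((δ * (δ / 2 * c)) ^ 8) (3 * l + 2 * p + 1) fun M => ∃ y c' L, M = y :: c' :: L ∧
      W₁ y ∧ W₂ c' ∧ Flex E l p [y] [c'] L := by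
  have : Nonempty (List.Vector V (l + p - 1)) :=
    ⟨List.Vector.replicate _ (Classical.arbitrary V)⟩
  have e1 : (l - 1) + (l + p - 1) = 2 * l + p - 2 := by omega
  have key : DenseIn (δ * (δ / 2 * c))
      fun x : V × V × (List.Vector V (l - 1) × List.Vector V (l + p - 1)) =>
        W₁ x.1 ∧ (W₂ x.2.1 ∧ x.2.1 ∉ [x.1]) ∧
          E (x.1 :: x.2.1 :: x.2.2.1.toList ++ x.2.2.2.toList) := by
    refine h₁.bind (Ψ := fun (y : V) (x : V × List.Vector V (l - 1) × List.Vector V (l + p - 1)) =>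
      (W₂ x.1 ∧ x.1 ∉ [y]) ∧ E (y :: x.1 :: x.2.1.toList ++ x.2.2.toList)) (by positivity)
      fun y _ => ?_
    have hy := h₂.and_of_dense (denseIn_notMem_list [y] (δ := δ / 2) (by simpa using hV))
    refine (DenseIn.mono hy (c' := δ / 2) (by linarith) fun _ h => h).bind
      (Ψ := fun (b : V) (x : List.Vector V (l - 1) × List.Vector V (l + p - 1)) =>
        E (y :: b :: x.1.toList ++ x.2.toList)) hc fun b hb => ?_
    have hb' := h.deg_two [y, b] rfl (by simpa [eq_comm] using hb.2)
    rw [← e1] at hb'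
    exact hb'.split
  have key2 := DenseIn.crossing (Θ := fun (C : List.Vector V (l - 1)) (y b : V)
      (r : List.Vector V (l + p - 1)) => W₁ y ∧ (W₂ b ∧ b ∉ [y]) ∧
      E (y :: b :: C.toList ++ r.toList)) (key.map
    (fun x => (x.2.2.1, x.1, x.2.1, x.2.2.2)) (by rintro ⟨⟩ ⟨⟩; grind)
    (by simp only [Fintype.card_prod]; ring) fun x hx => hx) (by positivity)
  refine key2.toLDense (fun x => x.2.1.1 :: x.2.2.2 :: (x.2.1.2 :: x.2.2.1 :: x.1.1.toList ++
    x.1.2.1.toList ++ x.1.2.2.toList)) ?_ ?_ ?_ ?_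
  · intro x; simp; omega
  · rintro ⟨⟨C, r, r'⟩, ⟨y, x⟩, b, b'⟩ ⟨⟨D, q, q'⟩, ⟨z, w⟩, d, d'⟩ hxx
    simp only [List.cons_append, List.cons.injEq] at hxx
    obtain ⟨rfl, rfl, rfl, rfl, h5⟩ := hxx
    obtain ⟨h5, h6⟩ := List.append_inj h5 (by simp)
    obtain ⟨h5, h7⟩ := List.append_inj h5 (by simp)
    rw [Subtype.ext h5, Subtype.ext h6, Subtype.ext h7]
  · obtain ⟨l, rfl⟩ := Nat.exists_eq_add_of_le' hl
    simp only [Fintype.card_prod, card_vector, show l + 1 + p - 1 = l + p by omega,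
      Nat.add_sub_cancel]
    ring
  · rintro ⟨⟨C, r, r'⟩, ⟨y, x⟩, b, b'⟩ ⟨h1, h2, h3⟩
    exact ⟨y, b', _, rfl, h1.1, h2.2.1.1, .of_crossing h.isEdgeFamily hl hp C.2 r.2 r'.2
      h1.2.2 h2.2.2 h3.2.2⟩

/-- Exchanging between two cliques. -/
theorem flex_of_cliques (h : Robust E l p m₀ ε c) (hε : 0 ≤ ε) (hc : 0 ≤ c) (hl : 1 ≤ l)
    (hp : 1 ≤ p) [Nonempty V] {δ : ℝ} {W₁ W₂ : V → Prop} (h₁ : DenseIn δ W₁) (h₂ : DenseIn δ W₂)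
    (hδ : 0 ≤ δ) (hV : 1 ≤ δ / 2 * Fintype.card V)
    (hW₁ : ∀ x y, W₁ x → W₁ y → Rel E l p ε x y) (hW₂ : ∀ x y, W₂ x → W₂ y → Rel E l p ε x y)
    {u v : V} (hu : W₁ u) (hv : W₂ v) :
    LDense ((δ * (δ / 2 * c)) ^ 8 * (ε * c) ^ 2)
      ((3 * l + 2 * p + 1) + 2 * (2 * l + p - 1 + m₀)) (Flex E l p [u] [v]) := by
  refine (h.dense_crossing hc hl hp h₁ h₂ hδ hV).flex_of_exchanges h.isEdgeFamily h.conn hc hε 2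
    _ _ ?_
  rintro _ - ⟨y, b, L, rfl, hy, hb, hL⟩
  refine ⟨_, _, L, [u, b], [y, v], [y, b], hL, rfl, ?_, ?_, ?_, by simp⟩
  · simpa using ⟨h.flex_of_rel hp (hW₁ _ _ hu hy), h.flex_of_rel hp (hW₂ _ _ hb hv)⟩
  · exact List.Perm.swap _ _ _
  · exact (List.perm_append_comm (l₁ := [b, y]) (l₂ := [v])).trans
      ((List.Perm.swap _ _ _).cons _)

/-- Almost all vertices can be exchanged with each other. -/
theorem exchange_bulk (h : Robust E l p (s * (l + p) + p) ε c) (hε : 0 ≤ ε) (hc : 0 ≤ c)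
    (hl : 1 ≤ l) (hp : 1 ≤ p) [Nonempty V] {δ c' : ℝ} (hδ : 0 ≤ δ)
    (hV : 1 ≤ δ / 2 * Fintype.card V) (hc₁ : c' ≤ ε * c ^ (2 * s + 5))
    (hc₂ : c' ≤ (δ * ε) * (ε * c) ^ 1 * c ^ (s + 3))
    (hc₃ : c' ≤ (δ * (δ / 2 * c)) ^ 8 * (ε * c) ^ 2) :
    ∃ W : V → Prop, DenseIn (1 - 2 * δ) W ∧ ∀ u v, W u → W v →
      LDense c' (2 * l + p - 1 + (2 * s + 5) * (l + p)) (Flex E l p [u] [v]) := by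
  obtain ⟨l, rfl⟩ := Nat.exists_eq_add_of_le' hl
  obtain ⟨p, rfl⟩ := Nat.exists_eq_add_of_le' hp
  have key : ∀ u v, Rel E (l + 1) (p + 1) ε u v → LDense c'
      (2 * (l + 1) + (p + 1) - 1 + (2 * s + 5) * (l + 1 + (p + 1)))
      (Flex E (l + 1) (p + 1) [u] [v]) := fun u v huv =>
    ((h.flex_of_rel hp huv).flex_extend h.isEdgeFamily h.deg_ends hc _).mono hc₁ fun _ _ h => h
  rcases two_cliques_of_no_independent_triple (R := Rel E (l + 1) (p + 1) ε)
    (fun _ _ => Rel.symm) h.rel_three δ with hd | ⟨W, hW, hR⟩ | ⟨W₁, W₂, hW, h₁, h₂, hR₁, hR₂⟩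
  · refine ⟨fun _ => True, (DenseIn.univ fun _ => trivial).mono (by linarith) fun _ h => h,
      fun u v _ _ => ?_⟩
    rcases hd u v with huv | huv
    · exact key u v huv
    · have := ((h.flex_of_common hε hc hp huv).flex_extend h.isEdgeFamily h.deg_ends hc (s + 3)).mono
        hc₂ fun _ _ h => h
      convert this using 1
      simp only [show ∀ a b, 2 * (a + 1) + (b + 1) - 1 = 2 * a + b + 2 by omega]
      ring
  · exact ⟨W, hW, fun u v hu hv => key u v (hR u v hu hv)⟩
  · refine ⟨_, hW.mono (by linarith) fun _ h => h, ?_⟩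
    have hcr : ∀ u v, W₁ u → W₂ v → LDense c'
        (2 * (l + 1) + (p + 1) - 1 + (2 * s + 5) * (l + 1 + (p + 1)))
        (Flex E (l + 1) (p + 1) [u] [v]) := fun u v hu hv => by
      have := (h.flex_of_cliques hε hc hl hp h₁ h₂ hδ hV hR₁ hR₂ hu hv).mono hc₃ fun _ _ h => h
      convert this using 1
      simp only [show ∀ a b, 2 * (a + 1) + (b + 1) - 1 = 2 * a + b + 2 by omega]
      ring
    rintro u v (hu | hu) (hv | hv)
    · exact key u v (hR₁ u v hu hv)
    · exact hcr u v hu hv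
    · exact (hcr v u hv hu).mono le_rfl fun _ _ h => h.symm
    · exact key u v (hR₂ u v hu hv)

end Robust

end Bulk

section Absorber

open scoped List

variable {V : Type*} [Fintype V] {E : List V → Prop} {l p m₀ m₁ : ℕ} {ε c c₁ : ℝ}

theorem LDense.nodup_half (m : ℕ) (hV : 2 * m ^ 2 ≤ Fintype.card V) :
    LDense (1 / 2) m fun L : List V => L.Nodup := by
  rcases Nat.eq_zero_or_pos m with rfl | hm
  · exact (DenseIn.univ fun L => by simp).mono (by norm_num)
      fun _ h => h
  have hm' : (1 : ℝ) ≤ m := by exact_mod_cast hm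
  have hV' : 2 * (m : ℝ) ^ 2 ≤ Fintype.card V := by exact_mod_cast hV
  have := LDense.nodup_append (V := V) [] List.nodup_nil (δ := 1 / (2 * m))
    (by rw [div_le_one (by positivity)]; linarith) m (by
      rw [div_mul_eq_mul_div, le_div_iff₀ (by positivity)]
      simp only [List.length_nil, zero_add]
      nlinarith)
  refine this.mono (le_of_eq ?_) fun _ _ h => by simpa using h
  field_simp
  norm_num

/-- Data from which `u` may be exchanged with `v` inside the set `W`. -/
theorem Robust.dense_detour (h : Robust E l p m₀ ε c) (hp : 1 ≤ p) (hε : 0 ≤ ε) (hc : 0 ≤ c)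
    (hV : 2 * l ^ 2 ≤ Fintype.card V) (u : V) :
    LDense (1 / 3 * (1 / 2) * c * (c * c)) (2 * l + p - 1 + l + m₀ + (m₀ + (l + p))) fun M =>
      ∃ A X C B K K', M = A ++ X ++ C ++ B ++ K ++ K' ∧ 1 + X.length + C.length = l + p ∧
        K.length = m₀ ∧ K'.length = m₀ + (l + p) ∧
        Conn E l p A ((u :: X) ++ C ++ K) B ∧ Conn E l p A K' B := by
  have hE := h.isEdgeFamily
  have h1 : LDense (1 / 3) (2 * l + p - 1) fun Y => ∃ A X C, Y = A ++ X ++ C ∧ A.length = l ∧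
      X.length = p - 1 ∧ C.length = l ∧ E (u :: Y) :=
    (h.deg_one [u] rfl (by simp)).mono (by linarith) fun Y hY hEY =>
      ⟨Y.take l, (Y.drop l).take (p - 1), (Y.drop l).drop (p - 1), by simp, by simp; omega,
      by simp; omega, by simp; omega, hEY⟩
  have h2 : LDense (1 / 3 * (1 / 2)) (2 * l + p - 1 + l) fun Y => ∃ A X C B,
      Y = A ++ X ++ C ++ B ∧ A.length = l ∧ X.length = p - 1 ∧ C.length = l ∧ B.length = l ∧
      B.Nodup ∧ A.Nodup ∧ C.Nodup ∧ E (A ++ (u :: X) ++ C) := by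
    refine h1.append (by norm_num) (fun _ _ _ => LDense.nodup_half l hV) ?_
    rintro _ B - hB ⟨A, X, C, rfl, hA, hX, hC, hEu⟩ hBn
    have hEu' : E (A ++ (u :: X) ++ C) := hE.perm (by simpa using List.perm_middle.symm) hEu
    have hn := hE.nodup hEu'
    exact ⟨A, X, C, B, rfl, hA, hX, hC, hB, hBn,
      (List.nodup_append.1 (List.nodup_append.1 hn).1).1, (List.nodup_append.1 hn).2.1, hEu'⟩
  choose! A X C B hY hA hX hC hB hBn hAn hCn hEu using fun Y (hY : ∃ A X C B,
      Y = A ++ X ++ C ++ B ∧ A.length = l ∧ X.length = p - 1 ∧ C.length = l ∧ B.length = l ∧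
      B.Nodup ∧ A.Nodup ∧ C.Nodup ∧ E (A ++ (u :: X) ++ C)) => hY
  have h3 : LDense (1 / 3 * (1 / 2) * c) (2 * l + p - 1 + l + m₀) fun Y => ∃ A X C B K,
      Y = A ++ X ++ C ++ B ++ K ∧ A.length = l ∧ A.Nodup ∧ B.length = l ∧ B.Nodup ∧
      1 + X.length + C.length = l + p ∧ K.length = m₀ ∧
      Conn E l p A ((u :: X) ++ C ++ K) B := by
    refine h2.append hc (Q := fun Y K => Conn E l p (C Y) K (B Y))
      (fun Y _ hY => h.conn _ _ (hC Y hY) (hCn Y hY) (hB Y hY) (hBn Y hY)) ?_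
    intro Y K _ hK hYY hQ
    refine ⟨A Y, X Y, C Y, B Y, K, by rw [← hY Y hYY], hA Y hYY, hAn Y hYY, hB Y hYY, hBn Y hYY,
      by rw [hX Y hYY, hC Y hYY]; omega, hK, ?_⟩
    exact .cons (hA Y hYY) (by rw [List.length_cons, hX Y hYY]; omega) (hC Y hYY) (hEu Y hYY) hQ
  clear hY hA hX hC hB hBn hAn hCn hEu
  choose! A X C B K hY hA hAn hB hBn hXC hK hconn using fun Y (hY : ∃ A X C B K,
      Y = A ++ X ++ C ++ B ++ K ∧ A.length = l ∧ A.Nodup ∧ B.length = l ∧ B.Nodup ∧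
      1 + X.length + C.length = l + p ∧ K.length = m₀ ∧
      Conn E l p A ((u :: X) ++ C ++ K) B) => hY
  refine h3.append (by positivity) (Q := fun Y K => Conn E l p (A Y) K (B Y))
    (fun Y _ hY => h.conn.extend hE h.deg_ends hc _ _ (hA Y hY) (hAn Y hY) (hB Y hY) (hBn Y hY)) ?_
  intro Y K' _ hK' hYY hQ
  exact ⟨A Y, X Y, C Y, B Y, K Y, K', by rw [← hY Y hYY], hXC Y hYY, hK Y hYY, hK', hconn Y hYY, hQ⟩

theorem List.forall₂_of_length_eq {α β : Type*} {R : α → β → Prop} {as : List α} {bs : List β}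
    (h : as.length = bs.length) (hR : ∀ a ∈ as, ∀ b ∈ bs, R a b) : List.Forall₂ R as bs := by
  rw [List.forall₂_iff_get]
  exact ⟨h, fun i _ _ => hR _ (List.get_mem _ _) _ (List.get_mem _ _)⟩

theorem Robust.exchange_into (h : Robust E l p m₀ ε c) (hp : 1 ≤ p) (hε : 0 ≤ ε)
    (hc : 0 ≤ c) (hc₁ : 0 ≤ c₁) (hV : 2 * l ^ 2 ≤ Fintype.card V) {δ : ℝ} (hδ₁ : δ ≤ 1)
    (hδ : (2 * l + p - 1 + l + m₀ + (m₀ + (l + p)) : ℕ) * δ ≤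
      1 / 3 * (1 / 2) * c * (c * c) / 2) {W : V → Prop}
    (hW : DenseIn (1 - δ) W)
    (hx : ∀ u v, W u → W v → LDense c₁ m₁ (Flex E l p [u] [v])) (u v : V) (hv : W v) :
    LDense ((1 / 3 * (1 / 2) * c * (c * c) / 2) * (c₁ * c) ^ (m₀ + (l + p)))
      ((2 * l + p - 1 + l + m₀ + (m₀ + (l + p))) + (m₀ + (l + p)) * (m₁ + m₀))
      (Flex E l p [u] [v]) := by
  have h1 := ((h.dense_detour hp hε hc hV u).and_of_dense
    (LDense.forall_mem hδ₁ hW _)).mono (c' := 1 / 3 * (1 / 2) * c * (c * c) / 2) (by linarith)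
    fun _ _ h => h
  refine h1.flex_of_exchanges h.isEdgeFamily h.conn hc hc₁ _ _ _ ?_
  rintro _ - ⟨⟨A, X, C, B, K, K', rfl, hXC, hK, hK', h2, h3⟩, hm⟩
  refine ⟨_, _, _, K', v :: (X ++ C ++ K), X ++ C ++ K ++ K', Flex.of_conn h2 h3, hK', ?_, ?_, ?_, ?_⟩
  · refine List.forall₂_of_length_eq (by simp; omega) fun a ha b hb => hx a b (hm a (by simp [ha])) ?_
    rcases List.mem_cons.1 hb with rfl | hb
    · exact hv
    · simp only [List.mem_append] at hb
      exact hm b (by simp only [List.mem_append]; tauto)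
  all_goals
    classical
    rw [List.perm_iff_count]; intro a
    simp only [List.count_append, List.count_cons, List.count_nil]; omega

theorem Robust.exchange_via (h : Robust E l p m₀ ε c) (hc : 0 ≤ c) (hc₁ : 0 ≤ c₁) {δ : ℝ}
    {W : V → Prop} (hW : DenseIn δ W)
    (hx : ∀ u v, W v → LDense c₁ m₁ (Flex E l p [u] [v])) (u v : V) :
    LDense ((δ * c₁) * (c₁ * c) ^ 1) ((m₁ + 1) + 1 * (m₁ + m₀)) (Flex E l p [u] [v]) := by
  have h1 : LDense (δ * c₁) (m₁ + 1) fun M => ∃ w L, M = w :: L ∧ W w ∧ Flex E l p [u] [w] L :=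
    LDense.cons hW hc₁ fun w hw => (hx u w hw).mono le_rfl fun L _ hL => ⟨w, L, rfl, hw, hL⟩
  refine h1.flex_of_exchanges h.isEdgeFamily h.conn hc hc₁ 1 _ _ ?_
  rintro _ - ⟨w, L, rfl, hw, hL⟩
  refine ⟨_, _, L, [w], [v], [w], hL, rfl, ?_, by simp, ?_, by simp⟩
  · simpa using (hx v w hw).mono le_rfl fun _ _ h => h.symm
  · exact List.Perm.swap _ _ _

theorem Robust.dense_absorbers (h : Robust E l p m₀ ε c) (hc : 0 ≤ c) (hc₁ : 0 ≤ c₁)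
    (hV : 2 * l ^ 2 ≤ Fintype.card V) (hx : ∀ u v, LDense c₁ m₁ (Flex E l p [u] [v]))
    {S : List V} (hS : S.length = l + p) :
    LDense ((1 / 2 * (1 / 2) * c * (c * c)) * (c₁ * c) ^ (m₀ + (l + p)))
      ((l + l + m₀ + (m₀ + (l + p))) + (m₀ + (l + p)) * (m₁ + m₀)) (Flex E l p [] S) := by
  have h1 : LDense (1 / 2 * (1 / 2)) (l + l) fun M : List V => ∃ A B, M = A ++ B ∧ A.length = l ∧
      A.Nodup ∧ B.length = l ∧ B.Nodup :=
    (LDense.nodup_half l hV).append (by norm_num) (fun _ _ _ => LDense.nodup_half l hV)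
      fun A B hA hB hAn hBn => ⟨A, B, rfl, hA, hAn, hB, hBn⟩
  choose! A B hM hA hAn hB hBn using fun M (hM : ∃ A B : List V, M = A ++ B ∧ A.length = l ∧
      A.Nodup ∧ B.length = l ∧ B.Nodup) => hM
  have h2 : LDense (1 / 2 * (1 / 2) * c) (l + l + m₀) fun M => ∃ A B Z, M = A ++ B ++ Z ∧
      A.length = l ∧ A.Nodup ∧ B.length = l ∧ B.Nodup ∧ Z.length = m₀ ∧ Conn E l p A Z B := by
    refine h1.append hc (Q := fun M Z => Conn E l p (A M) Z (B M))
      (fun M _ h' => h.conn _ _ (hA M h') (hAn M h') (hB M h') (hBn M h')) ?_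
    intro M Z _ hZ h' hQ
    exact ⟨A M, B M, Z, by rw [← hM M h'], hA M h', hAn M h', hB M h', hBn M h', hZ, hQ⟩
  clear hM hA hAn hB hBn
  choose! A B Z hM hA hAn hB hBn hZ hconn using fun M (hM : ∃ A B Z, M = A ++ B ++ Z ∧
      A.length = l ∧ A.Nodup ∧ B.length = l ∧ B.Nodup ∧ Z.length = m₀ ∧ Conn E l p A Z B) => hM
  have h3 : LDense (1 / 2 * (1 / 2) * c * (c * c)) (l + l + m₀ + (m₀ + (l + p))) fun M =>
      ∃ A B Z Z', M = A ++ B ++ Z ++ Z' ∧ Z.length = m₀ ∧ Z'.length = m₀ + (l + p) ∧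
        Conn E l p A Z B ∧ Conn E l p A Z' B := by
    refine h2.append (by positivity) (Q := fun M Z => Conn E l p (A M) Z (B M))
      (fun M _ h' => h.conn.extend h.isEdgeFamily h.deg_ends hc _ _ (hA M h') (hAn M h') (hB M h')
        (hBn M h')) ?_
    intro M Z' _ hZ' h' hQ
    exact ⟨A M, B M, Z M, Z', by rw [← hM M h'], hZ M h', hZ', hconn M h', hQ⟩
  refine h3.flex_of_exchanges h.isEdgeFamily h.conn hc hc₁ _ _ _ ?_
  rintro _ - ⟨A, B, Z, Z', rfl, hZ, hZ', h4, h5⟩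
  refine ⟨_, _, _, Z', Z ++ S, Z ++ Z', Flex.of_conn h4 h5, hZ', ?_, ?_, ?_, ?_⟩
  · exact List.forall₂_of_length_eq (by simp; omega) fun a _ b _ => hx a b
  all_goals
    classical
    rw [List.perm_iff_count]; intro a
    simp only [List.count_append, List.count_nil]; omega

/-- Robust families have, for every list `S` of length `l + p`, many absorbers. -/
theorem Robust.exists_dense_absorbers (hl : 1 ≤ l) (hp : 1 ≤ p) (s : ℕ) (hε : 0 < ε)
    (hc : 0 < c) : ∃ β : ℝ, 0 < β ∧ ∃ b N : ℕ, ∀ (V : Type) [Fintype V], N ≤ Fintype.card V →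
      ∀ E : List V → Prop, Robust E l p (s * (l + p) + p) ε c → ∀ S, S.length = l + p →
        LDense β b (Flex E l p [] S) := by
  set m₀ := s * (l + p) + p with hm₀
  set d := 1 / 3 * (1 / 2) * c * (c * c) / 2 with hd
  have hdpos : 0 < d := by positivity
  obtain ⟨δ, hδ, hδ1, hδ2⟩ : ∃ δ : ℝ, 0 < δ ∧ 2 * δ ≤ 1 / 2 ∧
      (2 * l + p - 1 + l + m₀ + (m₀ + (l + p)) : ℕ) * (2 * δ) ≤ d := by
    set q : ℕ := 2 * l + p - 1 + l + m₀ + (m₀ + (l + p))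
    refine ⟨min (1 / 4) (d / (2 * (q + 1))), by positivity, ?_, ?_⟩
    · linarith [min_le_left (1 / 4 : ℝ) (d / (2 * (q + 1)))]
    · calc (q : ℝ) * (2 * min (1 / 4) (d / (2 * (q + 1)))) ≤ q * (2 * (d / (2 * (q + 1)))) := by
            gcongr; exact min_le_right _ _
        _ = d * (q / (q + 1)) := by field_simp
        _ ≤ d * 1 := by
            gcongr; rw [div_le_one (by positivity)]; linarith
        _ = d := mul_one d
  obtain ⟨c', hc', h1, h2, h3⟩ : ∃ c' : ℝ, 0 < c' ∧ c' ≤ ε * c ^ (2 * s + 5) ∧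
      c' ≤ (δ * ε) * (ε * c) ^ 1 * c ^ (s + 3) ∧ c' ≤ (δ * (δ / 2 * c)) ^ 8 * (ε * c) ^ 2 :=
    ⟨min (ε * c ^ (2 * s + 5)) (min ((δ * ε) * (ε * c) ^ 1 * c ^ (s + 3))
      ((δ * (δ / 2 * c)) ^ 8 * (ε * c) ^ 2)), by positivity, min_le_left _ _,
      (min_le_right _ _).trans (min_le_left _ _), (min_le_right _ _).trans (min_le_right _ _)⟩
  obtain ⟨c₂, hc₂, hc₂'⟩ : ∃ c₂ : ℝ, 0 < c₂ ∧ c₂ = d * (c' * c) ^ (m₀ + (l + p)) :=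
    ⟨_, by positivity, rfl⟩
  obtain ⟨c₃, hc₃, hc₃'⟩ : ∃ c₃ : ℝ, 0 < c₃ ∧ c₃ = 1 / 2 * c₂ * (c₂ * c) ^ 1 :=
    ⟨_, by positivity, rfl⟩
  let mW := 2 * l + p - 1 + (2 * s + 5) * (l + p)
  let mI := 2 * l + p - 1 + l + m₀ + (m₀ + (l + p)) + (m₀ + (l + p)) * (mW + m₀)
  let mV := (mI + 1) + 1 * (mI + m₀)
  have main : ∀ (V : Type) [Fintype V], max 1 (max (2 * l ^ 2) ⌈2 / δ⌉₊) ≤ Fintype.card V →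
      ∀ E : List V → Prop, Robust E l p m₀ ε c → ∀ S, S.length = l + p →
        LDense ((1 / 2 * (1 / 2) * c * (c * c)) * (c₃ * c) ^ (m₀ + (l + p)))
          ((l + l + m₀ + (m₀ + (l + p))) + (m₀ + (l + p)) * (mV + m₀)) (Flex E l p [] S) := by
    intro V _ hV E h S hS
    have hV1 : 0 < Fintype.card V := (le_max_left _ _).trans hV
    have hV2 : 2 * l ^ 2 ≤ Fintype.card V :=
      (le_max_left _ _).trans ((le_max_right _ _).trans hV)
    have hV3 : 1 ≤ δ / 2 * Fintype.card V := by
      have : 2 / δ ≤ Fintype.card V := Nat.ceil_le.1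
        ((le_max_right _ _).trans ((le_max_right _ _).trans hV))
      rw [div_le_iff₀ hδ] at this
      linarith
    have : Nonempty V := Fintype.card_pos_iff.1 hV1
    obtain ⟨W, hW, hx⟩ := h.exchange_bulk hε.le hc.le hl hp hδ.le hV3 h1 h2 h3
    have hx2 := h.exchange_into hp hε.le hc.le hc'.le hV2 (by linarith) hδ2 hW hx
    rw [← hd, ← hc₂'] at hx2
    have hx3 := h.exchange_via hc.le hc₂.le (hW.mono (c' := 1 / 2) (by linarith)
      fun _ h => h) hx2
    rw [← hc₃'] at hx3
    exact h.dense_absorbers hc.le hc₃.le hV2 hx3 hS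
  exact ⟨_, by positivity, _, _, main⟩

end Absorber

section Connecting

open scoped List

variable {V : Type*} {E : List V → Prop} {l p : ℕ} {c c₀ : ℝ}

theorem DegDense.step_down [Fintype V] {k d : ℕ} {ρ ε : ℝ} (h : DegDense E k (d + 1) ρ)
    (hd : d + 1 ≤ k) (hρ : 0 ≤ ρ) (hρ₁ : ρ ≤ 1) (hε : 0 ≤ ε) (hk : (k : ℝ) ≤ ε * Fintype.card V) :
    DegDense E k d (ρ - ε) := by
  intro A hA hAn
  have hA' : (A.length : ℝ) ≤ ε * Fintype.card V :=
    le_trans (by rw [hA]; exact_mod_cast (by omega : d ≤ k)) hk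
  have := LDense.cons (P := fun Y => E (A ++ Y)) (denseIn_notMem_list A hA') hρ fun v hv => by
    refine (h (A ++ [v]) (by simp [hA]) ?_).mono le_rfl fun Y _ hY => by simpa using hY
    rw [List.nodup_append]
    exact ⟨hAn, by simp, by rintro a ha b hb rfl; simp_all⟩
  rw [show k - (d + 1) + 1 = k - d by omega] at this
  refine this.mono ?_ fun _ _ h => h
  nlinarith

/-- Pulling density back along an injective encoding by lists of length `m`. -/
theorem LDense.pull [Fintype V] {α : Type*} [Fintype α] {m : ℕ} {P : List V → Prop}
    (h : LDense c m P) (f : α → List V) (hlen : ∀ x, (f x).length = m)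
    (hinj : Function.Injective f) (hcard : Fintype.card α = Fintype.card V ^ m) :
    DenseIn c fun x => P (f x) := by
  let g : α → List.Vector V m := fun x => ⟨f x, hlen x⟩
  have hb : Function.Bijective g := by
    rw [Fintype.bijective_iff_injective_and_card]
    exact ⟨fun x y hxy => hinj (congrArg Subtype.val hxy), by rw [hcard, card_vector]⟩
  refine DenseIn.map h (Equiv.ofBijective g hb).symm (Equiv.injective _)
    (by rw [hcard, card_vector]) fun L hL => ?_
  have h1 : g ((Equiv.ofBijective g hb).symm L) = L :=
    (Equiv.ofBijective g hb).apply_symm_apply L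
  have h2 : f ((Equiv.ofBijective g hb).symm L) = L.toList := congrArg Subtype.val h1
  rw [h2]
  exact hL

/-- Two copies sharing only the first coordinate, keeping parts of each of them. -/
theorem DenseIn.fork_cross {α β₁ β₂ β₃ : Type*} [Fintype α] [Fintype β₁] [Fintype β₂] [Fintype β₃]
    [Nonempty β₁] [Nonempty β₃] {Φ : α × β₁ × β₂ × β₃ → Prop} (h : DenseIn c Φ) (hc : 0 ≤ c) :
    DenseIn (c ^ 2) fun x : α × β₁ × β₂ × β₂ × β₃ =>
      (∃ b, Φ (x.1, x.2.1, x.2.2.1, b)) ∧ ∃ b, Φ (x.1, b, x.2.2.2.1, x.2.2.2.2) := by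
  have h1 := ((h.fork hc).map (Ψ := fun x : (α × β₁ × β₂ × β₂ × β₃) × β₃ × β₁ =>
      Φ (x.1.1, x.1.2.1, x.1.2.2.1, x.2.1) ∧ Φ (x.1.1, x.2.2, x.1.2.2.2.1, x.1.2.2.2.2))
    (fun x => ((x.1, x.2.1.1, x.2.1.2.1, x.2.2.2.1, x.2.2.2.2), x.2.1.2.2, x.2.2.1))
    (by rintro ⟨⟩ ⟨⟩; grind) (by simp only [Fintype.card_prod]; ring) fun x hx => hx).fst
  exact h1.mono le_rfl fun x ⟨b, hx⟩ => ⟨⟨_, hx.1⟩, _, hx.2⟩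

/-- The vertices of `H` can be replaced by those of `D` one at a time, each step being supported
by an edge whose remaining vertices are taken from `Y`. -/
def Link (E : List V → Prop) (q : ℕ) : List V → List V → List V → Prop
  | [], _, _ => True
  | _ :: _, [], _ => False
  | d :: D, c :: G, Y => E (c :: d :: G ++ Y.take q) ∧ Link E q D (G ++ [d]) (Y.drop q)

theorem dense_link [Fintype V] {k : ℕ} (hl : 1 ≤ l) (h : DegDense E k (l + 1) c) (hc : 0 ≤ c) :
    ∀ D H : List V, H.length = l → (H ++ D).Nodup →
      LDense (c ^ D.length) (D.length * (k - (l + 1))) (Link E (k - (l + 1)) D H)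
  | [], H, _, _ => (DenseIn.univ fun _ => by simp [Link]).mono (by simp) fun _ h => h
  | d :: D, [], hH, _ => by simp at hH; omega
  | d :: D, b :: G, hH, hn => by
    have hn1 : (b :: d :: G).Nodup := by
      have : (b :: (G ++ [d])).Nodup :=
        hn.sublist (by simp)
      exact (List.Perm.nodup_iff ((List.perm_append_singleton d G).cons b)).1 this
    have hn2 : ((G ++ [d]) ++ D).Nodup := by
      have := (List.nodup_cons.1 (show (b :: (G ++ d :: D)).Nodup from hn)).2
      simpa using this
    have h1 := LDense.append (h (b :: d :: G) (by simp at hH ⊢; omega) hn1)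
      (b := D.length * (k - (l + 1))) (c' := c ^ D.length) (by positivity)
      (Q := fun _ => Link E (k - (l + 1)) D (G ++ [d]))
      (R := Link E (k - (l + 1)) (d :: D) (b :: G))
      (fun _ _ _ => dense_link hl h hc D (G ++ [d]) (by simpa using hH) hn2) ?_
    · rw [List.length_cons, pow_succ', Nat.succ_mul, add_comm (D.length * _)]
      exact h1
    · intro L M hL hM h2 h3
      simp only [Link]
      rw [List.take_left' hL, List.drop_left' hL]
      exact ⟨h2, h3⟩

/-- A partial connection from `A` to `B`. -/
def PreConn (E : List V → Prop) (l p q : ℕ) (A B : List V) (κ j : ℕ) (L : List V) : Prop :=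
  ∃ K H D X Y, L = K ++ H ++ D ++ X ++ Y ∧ K.length = κ ∧ H.length = l ∧ D.length = j ∧
    X.length = p ∧ Y.length = j * q ∧ Conn E l p A K H ∧ Link E q D H Y ∧
    E ((H ++ D).drop j ++ X ++ B)

theorem preConn_append {q κ j : ℕ} {A B K H D X Y : List V}
    (h : PreConn E l p q A B κ j (K ++ H ++ D ++ X ++ Y)) (hK : K.length = κ) (hH : H.length = l)
    (hD : D.length = j) (hX : X.length = p) :
    Conn E l p A K H ∧ Link E q D H Y ∧ E ((H ++ D).drop j ++ X ++ B) := by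
  obtain ⟨K', H', D', X', Y', h, hK', hH', hD', hX', hY', h1, h2, h3⟩ := h
  obtain ⟨h, e5⟩ := List.append_inj h (by simp [hK, hH, hD, hX, hK', hH', hD', hX'])
  obtain ⟨h, e4⟩ := List.append_inj h (by simp [hK, hH, hD, hK', hH', hD'])
  obtain ⟨h, e3⟩ := List.append_inj h (by simp [hK, hH, hK', hH'])
  obtain ⟨e1, e2⟩ := List.append_inj h (by simp [hK, hK'])
  subst e1 e2 e3 e4 e5
  exact ⟨h1, h2, h3⟩

theorem dense_preConn_succ [Fintype V] [Nonempty V] {A B : List V} {κ j : ℕ}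
    (hE : IsEdgeFamily (2 * (l + 1) + (p + 1)) E) (hc : 0 ≤ c)
    (h : LDense c (κ + (l + 1) + (j + 1) + (p + 1) + (j + 1) * (l + p + 1))
      (PreConn E (l + 1) (p + 1) (l + p + 1) A B κ (j + 1))) :
    LDense (c ^ 2) ((κ + 2 * (l + p + 2)) + (l + 1) + j + (p + 1) + j * (l + p + 1))
      (PreConn E (l + 1) (p + 1) (l + p + 1) A B (κ + 2 * (l + p + 2)) j) := by
  have : ∀ n, Nonempty (List.Vector V n) := fun n =>
    ⟨List.Vector.replicate _ (Classical.arbitrary V)⟩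
  let α := List.Vector V (l + 1)
  let β₁ := List.Vector V κ
  let β₂ := V × List.Vector V l × V × List.Vector V p
  let β₃ := List.Vector V j × List.Vector V (p + 1) × List.Vector V (j * (l + p + 1))
  have h1 := h.pull (α := α × β₁ × β₂ × β₃) (fun x => x.2.1.toList ++
    (x.2.2.1.1 :: x.2.2.1.2.1.toList) ++ (x.2.2.1.2.2.1 :: x.2.2.2.1.toList) ++
    x.2.2.2.2.1.toList ++ (x.2.2.1.2.2.2.toList ++ x.1.toList ++ x.2.2.2.2.2.toList))
    (by intro x; simp; ring) ?_ ?_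
  · have h2 := h1.fork_cross hc
    refine h2.toLDense (fun x => (x.2.1.toList ++ (x.2.2.1.1 :: x.2.2.1.2.1.toList) ++
      ((x.2.2.1.2.2.1 :: x.2.2.1.2.2.2.toList) ++ x.1.toList ++
      (x.2.2.2.1.1 :: x.2.2.2.1.2.2.2.toList))) ++
      (x.2.2.2.1.2.1.toList ++ [x.2.2.2.1.2.2.1]) ++ x.2.2.2.2.1.toList ++ x.2.2.2.2.2.1.toList ++
      x.2.2.2.2.2.2.toList) ?_ ?_ ?_ ?_
    · intro x; simp; ring
    · rintro ⟨C, K, ⟨c, G, d, P⟩, ⟨c', G', d', P'⟩, D, X, Y⟩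
        ⟨C₁, K₁, ⟨c₁, G₁, d₁, P₁⟩, ⟨c₁', G₁', d₁', P₁'⟩, D₁, X₁, Y₁⟩ h
      dsimp only at h
      obtain ⟨h, hY⟩ := List.append_inj h (by simp)
      obtain ⟨h, hX⟩ := List.append_inj h (by simp)
      obtain ⟨h, hD⟩ := List.append_inj h (by simp)
      obtain ⟨h, hG'⟩ := List.append_inj h (by simp)
      obtain ⟨hG', hd'⟩ := List.append_inj hG' (by simp)
      obtain ⟨h, h'⟩ := List.append_inj h (by simp)
      obtain ⟨hK, hG⟩ := List.append_inj h (by simp)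
      obtain ⟨h', hP'⟩ := List.append_inj h' (by simp)
      obtain ⟨hP, hC⟩ := List.append_inj h' (by simp)
      simp only [List.cons.injEq] at hG hP hP' hd'
      rw [Subtype.ext hY, Subtype.ext hX, Subtype.ext hD, Subtype.ext hG', Subtype.ext hK,
        Subtype.ext hC, Subtype.ext hG.2, Subtype.ext hP.2, Subtype.ext hP'.2, hG.1, hP.1, hP'.1,
        hd'.1]
    · simp only [α, β₁, β₂, β₃, Fintype.card_prod, card_vector]; ring
    · rintro ⟨C, K, ⟨c, G, d, P⟩, ⟨c', G', d', P'⟩, D, X, Y⟩ ⟨⟨⟨D₁, X₁, Y₁⟩, h₁⟩, K₁, h₂⟩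
      simp only at h₁ h₂ ⊢
      obtain ⟨hc₁, ⟨he₁, -⟩, -⟩ := preConn_append h₁ K.2 (by simp) (by simp) (by simp)
      obtain ⟨-, ⟨he₂, hl₂⟩, hf⟩ := preConn_append h₂ K₁.2 (by simp) (by simp) (by simp)
      rw [List.take_left' (by simp; ring)] at he₁ he₂
      rw [List.drop_left' (by simp; ring)] at hl₂
      refine ⟨_, _, _, _, _, rfl, by simp; ring, by simp, by simp, by simp, by simp, ?_, hl₂,
        by simpa using hf⟩
      refine hc₁.trans (.cons (by simp) (by simp) (by simp) (hE.perm ?_ he₁)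
        (.edge (by simp) (by simp) (by simp) (hE.perm ?_ he₂)))
      all_goals
        classical
        rw [List.perm_iff_count]; intro a
        simp only [List.count_append, List.count_cons, List.count_nil]; omega
  · rintro ⟨C, K, ⟨c, G, d, P⟩, D, X, Y⟩ ⟨C₁, K₁, ⟨c₁, G₁, d₁, P₁⟩, D₁, X₁, Y₁⟩ h
    dsimp only at h
    obtain ⟨h, hY⟩ := List.append_inj h (by simp)
    obtain ⟨hY', hY⟩ := List.append_inj hY (by simp)
    obtain ⟨hP, hC⟩ := List.append_inj hY' (by simp)
    obtain ⟨h, hX⟩ := List.append_inj h (by simp)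
    obtain ⟨h, hD⟩ := List.append_inj h (by simp)
    obtain ⟨hK, hG⟩ := List.append_inj h (by simp)
    simp only [List.cons.injEq] at hG hD
    rw [Subtype.ext hY, Subtype.ext hX, Subtype.ext hP, Subtype.ext hC, Subtype.ext hK,
      Subtype.ext hG.2, Subtype.ext hD.2, hG.1, hD.1]
  · simp only [α, β₁, β₂, β₃, Fintype.card_prod, card_vector]; ring

theorem dense_preConn_zero [Fintype V] [Nonempty V] {A B : List V}
    (hE : IsEdgeFamily (2 * (l + 1) + (p + 1)) E) : ∀ (j κ : ℕ) (c : ℝ), 0 ≤ c →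
    LDense c (κ + (l + 1) + j + (p + 1) + j * (l + p + 1))
      (PreConn E (l + 1) (p + 1) (l + p + 1) A B κ j) →
    LDense (c ^ 2 ^ j) ((κ + j * (2 * (l + p + 2))) + (l + 1) + (p + 1))
      (PreConn E (l + 1) (p + 1) (l + p + 1) A B (κ + j * (2 * (l + p + 2))) 0)
  | 0, κ, c, _, h => by simpa using h
  | j + 1, κ, c, hc, h => by
    have := dense_preConn_zero hE j _ _ (by positivity) (dense_preConn_succ hE hc h)
    rw [← pow_mul, ← pow_succ'] at this
    rwa [show κ + (j + 1) * (2 * (l + p + 2)) = κ + 2 * (l + p + 2) + j * (2 * (l + p + 2)) by ring]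

/-- Degree conditions on `l`-sets and on `(l + 1)`-sets suffice to connect ends robustly. -/
theorem connDense_of_degDense [Fintype V] [Nonempty V] {δ : ℝ}
    (hE : IsEdgeFamily (2 * (l + 1) + (p + 1)) E)
    (h₁ : DegDense E (2 * (l + 1) + (p + 1)) (l + 1) c)
    (h₂ : DegDense E (2 * (l + 1) + (p + 1)) (l + 1 + 1) c) (hc : 0 ≤ c) (hδ : δ ≤ 1)
    (hδc : ((l + p + 2 : ℕ) : ℝ) * δ ≤ c / 2)
    (hV : ((l + 1 + (l + p + 2) : ℕ) : ℝ) ≤ δ * Fintype.card V) :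
    ConnDense E (l + 1) (p + 1) ((c * (c / 2 * c ^ (l + 1))) ^ 2 ^ (l + 1))
      ((2 * (l + 1) + 1) * (l + 1 + (p + 1)) + (p + 1)) := by
  intro A B hA hAn hB hBn
  have hk₁ : 2 * (l + 1) + (p + 1) - (l + 1) = l + p + 2 := by omega
  have hk₂ : 2 * (l + 1) + (p + 1) - (l + 1 + 1) = l + p + 1 := by omega
  have h0 : LDense (c * (c / 2 * c ^ (l + 1)))
      ((p + 1) + (l + 1) + (l + 1) + (p + 1) + (l + 1) * (l + p + 1))
      (PreConn E (l + 1) (p + 1) (l + p + 1) A B (p + 1) (l + 1)) := by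
    have e1 := h₁ A hA hAn
    rw [hk₁] at e1
    have := e1.append (b := (l + p + 2) + (l + 1) * (l + p + 1)) (c' := c / 2 * c ^ (l + 1))
      (by positivity)
      (Q := fun L M => (E (B ++ M.take (l + p + 2))) ∧
        Link E (l + p + 1) ((M.take (l + p + 2)).take (l + 1)) (L.drop (p + 1))
          (M.drop (l + p + 2)))
      (R := PreConn E (l + 1) (p + 1) (l + p + 1) A B (p + 1) (l + 1)) ?_ ?_
    · convert this using 1; ring
    · intro L hL hAL
      have e2 := h₁ B hB hBn
      rw [hk₁] at e2
      have hLn : (L.drop (p + 1)).Nodup :=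
        (List.nodup_append.1 (hE.nodup hAL)).2.1.sublist (List.drop_sublist _ _)
      have e3 := (e2.and_of_dense (LDense.nodup_append (L.drop (p + 1)) hLn hδ (l + p + 2)
        (by rw [List.length_drop, hL]; refine le_trans ?_ hV; norm_cast; omega))).mono
        (show c / 2 ≤ _ by linarith) fun _ _ h => h
      refine e3.append (c' := c ^ (l + 1)) (by positivity)
        (Q := fun M Y => Link E (l + p + 1) (M.take (l + 1)) (L.drop (p + 1)) Y) ?_ ?_
      · rintro M hM ⟨-, hMn⟩
        have := dense_link (by omega) h₂ hc (M.take (l + 1)) (L.drop (p + 1))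
          (by simp; omega) (hMn.sublist (by
            exact (List.Sublist.refl _).append (List.take_sublist _ _)))
        rw [hk₂] at this
        have hM' : (M.take (l + 1)).length = l + 1 := by simp; omega
        rw [hM'] at this
        exact this
      · rintro M Y hM hY ⟨hM₁, -⟩ hl
        rw [List.take_left' hM, List.drop_left' hM]
        exact ⟨hM₁, hl⟩
    · rintro L M hL hM hAL ⟨hBM, hlink⟩
      refine ⟨L.take (p + 1), L.drop (p + 1), (M.take (l + p + 2)).take (l + 1),
        (M.take (l + p + 2)).drop (l + 1), M.drop (l + p + 2), ?_, ?_, ?_, ?_, ?_, ?_, ?_, hlink, ?_⟩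
      · rw [List.take_append_drop, List.append_assoc, List.append_assoc, ← List.append_assoc
          (List.take _ (List.take _ _)), List.take_append_drop, List.take_append_drop]
      · simp; omega
      · simp; omega
      · simp; omega
      · simp; omega
      · simp; omega
      · exact .edge hA (by simp; omega) (by simp; omega) (by simpa using hAL)
      · rw [List.drop_left' (by simp; omega), List.take_append_drop]
        exact hE.perm List.perm_append_comm hBM
  refine (dense_preConn_zero hE _ _ _ (by positivity) h0).mono le_rfl ?_ |> fun h => by
    convert h using 1; ring
  rintro L - ⟨K, H, D, X, Y, rfl, hK, hH, hD, hX, hY, hc, -, he⟩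
  obtain rfl := List.length_eq_zero_iff.1 hD
  obtain rfl := List.length_eq_zero_iff.1 (hY.trans (by simp))
  simpa using hc.trans (.edge hH hX hB (by simpa using he))

end Connecting

section Shadow

open scoped List

variable {V : Type*}

theorem List.nodup_of_card_toFinset [DecidableEq V] {L : List V}
    (h : L.length ≤ L.toFinset.card) : L.Nodup := by
  have h1 : L.toFinset.card = Multiset.card (L : Multiset V) :=
    le_antisymm L.toFinset_card_le h
  exact Multiset.coe_nodup.1 (Multiset.toFinset_card_eq_card_iff_nodup.1 h1)

/-- Every set of size `m` has `m!` enumerations. -/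
theorem card_filter_toFinset_mem [Fintype V] [DecidableEq V] {m : ℕ} (𝒮 : Finset (Finset V))
    (h𝒮 : ∀ s ∈ 𝒮, s.card = m) :
    (Finset.univ.filter fun L : List.Vector V m => L.toList.toFinset ∈ 𝒮).card
      = m.factorial * 𝒮.card := by
  rw [Finset.card_eq_sum_card_fiberwise (f := fun L : List.Vector V m => L.toList.toFinset)
    (t := 𝒮) (by intro L; simp), mul_comm, ← smul_eq_mul, ← Finset.sum_const]
  refine Finset.sum_congr rfl fun s hs => ?_
  have hperm : ∀ L : List.Vector V m, L.toList.toFinset = s ↔ L.toList ~ s.toList := by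
    intro L
    constructor
    · intro h
      refine List.perm_of_nodup_nodup_toFinset_eq (List.nodup_of_card_toFinset ?_)
        s.nodup_toList (by simpa using h)
      rw [h, h𝒮 s hs, L.toList_length]
    · intro h
      rw [List.toFinset_eq_of_perm _ _ h, Finset.toList_toFinset]
  have hcard : m.factorial = s.toList.permutations.toFinset.card := by
    rw [List.toFinset_card_of_nodup (List.nodup_permutations _ s.nodup_toList),
      List.length_permutations, Finset.length_toList, h𝒮 s hs]
  rw [hcard]
  refine Finset.card_bij (fun L _ => L.toList) ?_ ?_ ?_
  · intro L hL
    simp only [Finset.mem_filter] at hL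
    simpa using (hperm L).1 hL.2
  · intro L _ L' _ h
    exact Subtype.ext h
  · intro L hL
    have h1 : L ~ s.toList := by simpa using hL
    have h2 : L.length = m := by rw [h1.length_eq, Finset.length_toList, h𝒮 s hs]
    let L' : List.Vector V m := ⟨L, h2⟩
    have h3 : L'.toList.toFinset = s := (hperm L').2 h1
    refine ⟨L', ?_, rfl⟩
    rw [Finset.mem_filter, Finset.mem_filter]
    exact ⟨⟨Finset.mem_univ _, by rw [h3]; exact hs⟩, h3⟩

/-- A form of the Kruskal–Katona theorem for lists. -/
theorem LDense.shadow {n p l : ℕ} {P Q : List (Fin n) → Prop} {y δ : ℝ}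
    (h : LDense (y ^ (p + l)) (p + l) P) (hP : ∀ L, P L → L.Nodup)
    (hPQ : ∀ L X C, P L → L ~ X ++ C → C.length = l → Q C) (hδ : 0 ≤ δ) (hδy : δ ≤ y) (hy : y ≤ 1)
    (hn : ((p + l : ℕ) : ℝ) ≤ δ * n) : LDense ((y - δ) ^ l) l Q := by
  classical
  unfold LDense at h ⊢
  rw [denseIn_iff, card_vector, Fintype.card_fin] at h ⊢
  have hy0 : 0 ≤ y := hδ.trans hδy
  have hn0 : (0 : ℝ) ≤ n := n.cast_nonneg
  set q := ⌊y * n⌋₊ with hq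
  have hqn : q ≤ n := by
    refine Nat.floor_le_of_le ?_
    nlinarith
  have hmq : p + l ≤ q := Nat.le_floor (hn.trans (by gcongr))
  set 𝒜 : Finset (Finset (Fin n)) :=
    (Finset.univ.filter fun L : List.Vector (Fin n) (p + l) => P L.toList).image
      fun L => L.toList.toFinset with h𝒜
  have hsize : ∀ s ∈ 𝒜, s.card = p + l := by
    intro s hs
    obtain ⟨L, hL, rfl⟩ := Finset.mem_image.1 hs
    rw [List.toFinset_card_of_nodup (hP _ (by simpa using hL)), L.toList_length]
  have hle : q.choose (p + l) ≤ 𝒜.card := by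
    refine Nat.le_of_mul_le_mul_left ?_ (Nat.factorial_pos (p + l))
    rw [← Nat.descFactorial_eq_factorial_mul_choose, ← card_filter_toFinset_mem 𝒜 hsize]
    refine (Nat.descFactorial_le_pow _ _).trans (le_trans ?_ (Finset.card_le_card
      (s := Finset.univ.filter fun L : List.Vector (Fin n) (p + l) => P L.toList) ?_))
    · have : (q : ℝ) ^ (p + l) ≤ (y * n) ^ (p + l) := by
        gcongr
        exact Nat.floor_le (by positivity)
      rw [mul_pow] at this
      rw [Nat.cast_pow] at h
      have h' := this.trans h
      exact_mod_cast h'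
    · intro L hL
      simp only [Finset.mem_filter, Finset.mem_univ, true_and] at hL ⊢
      exact Finset.mem_image.2 ⟨L, by simpa using hL, rfl⟩
  have hKK := Finset.kruskal_katona_lovasz_form (i := p) (by omega) hmq hqn
    (fun s hs => hsize s (by simpa using hs)) hle
  rw [show p + l - p = l by omega] at hKK
  set 𝒞 := Finset.shadow^[p] 𝒜 with h𝒞
  have hmem : ∀ F ∈ 𝒞, ∃ L, P L ∧ L.length = p + l ∧ F ⊆ L.toFinset ∧
      (L.toFinset \ F).card = p := by
    intro F hF
    obtain ⟨s, hs, hFs, hc⟩ := Finset.mem_shadow_iterate_iff_exists_sdiff.1 hF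
    obtain ⟨L, hL, rfl⟩ := Finset.mem_image.1 hs
    exact ⟨L.toList, by simpa using hL, L.toList_length, hFs, hc⟩
  have hsize' : ∀ F ∈ 𝒞, F.card = l := by
    intro F hF
    obtain ⟨L, hL, hLl, hFL, hc⟩ := hmem F hF
    rw [Finset.card_sdiff_of_subset hFL, List.toFinset_card_of_nodup (hP _ hL), hLl] at hc
    have := Finset.card_le_card hFL
    rw [List.toFinset_card_of_nodup (hP _ hL), hLl] at this
    omega
  have h3 : l.factorial * 𝒞.card ≤
      (Finset.univ.filter fun L : List.Vector (Fin n) l => Q L.toList).card := by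
    rw [← card_filter_toFinset_mem 𝒞 hsize']
    refine Finset.card_le_card fun C hC => ?_
    simp only [Finset.mem_filter, Finset.mem_univ, true_and] at hC ⊢
    obtain ⟨L, hL, hLl, hFL, hc⟩ := hmem _ hC
    refine hPQ L (L.toFinset \ C.toList.toFinset).toList C.toList hL ?_ C.toList_length
    refine List.perm_of_nodup_nodup_toFinset_eq (hP _ hL)
      (List.nodup_of_card_toFinset ?_) ?_
    · rw [List.toFinset_append, Finset.toList_toFinset, Finset.sdiff_union_of_subset hFL,
        List.toFinset_card_of_nodup (hP _ hL), List.length_append, Finset.length_toList, hc,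
        C.toList_length, hLl]
    · rw [List.toFinset_append, Finset.toList_toFinset, Finset.sdiff_union_of_subset hFL]
  have h4 : (q + 1 - l) ^ l ≤ (Finset.univ.filter fun L : List.Vector (Fin n) l =>
      Q L.toList).card := by
    refine (Nat.pow_sub_le_descFactorial q l).trans (le_trans ?_ h3)
    rw [Nat.descFactorial_eq_factorial_mul_choose]
    exact Nat.mul_le_mul_left _ hKK
  have h5 : (((q + 1 - l) ^ l : ℕ) : ℝ) ≤ (Finset.univ.filter fun L : List.Vector (Fin n) l =>
      Q L.toList).card := by exact_mod_cast h4
  refine le_trans ?_ h5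
  push_cast [Nat.cast_sub (show l ≤ q + 1 by omega)]
  rw [← mul_pow]
  have h6 := Nat.lt_floor_add_one (y * n)
  have h7 : (l : ℝ) ≤ δ * n := le_trans (by exact_mod_cast (by omega : l ≤ p + l)) hn
  refine pow_le_pow_left₀ (mul_nonneg (by linarith) hn0) ?_ _
  rw [← hq] at h6
  nlinarith

theorem DenseIn.not_of_fibers {α β : Type*} [Fintype α] [Fintype β] [Nonempty β] {ε : ℝ}
    {Φ : α → β → Prop} (h : ∀ b, ¬ DenseIn ε fun a => Φ a b) :
    ¬ DenseIn ε fun x : α × β => Φ x.1 x.2 := by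
  classical
  intro hΦ
  have h2 : DenseIn ε fun x : β × α => Φ x.2 x.1 :=
    hΦ.map Prod.swap Prod.swap_injective (by simp [mul_comm]) fun x hx => hx
  simp only [denseIn_iff] at h h2
  rw [DenseIn.card_filter_prod, Fintype.card_prod] at h2
  push_cast at h2
  have h3 : ∑ b : β, ((Finset.univ.filter fun a => Φ a b).card : ℝ)
      < ∑ _b : β, ε * (Fintype.card α : ℝ) :=
    Finset.sum_lt_sum_of_nonempty Finset.univ_nonempty fun b _ => not_le.1 (h b)
  rw [Finset.sum_const, Finset.card_univ, nsmul_eq_mul] at h3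
  nlinarith

variable {l p : ℕ}

/-- Most ends are joined to a given end `A` by a positive proportion of the interiors. -/
theorem dense_rich {n : ℕ} {E : List (Fin n) → Prop} {ρ ε y δ : ℝ}
    (hE : IsEdgeFamily (2 * l + p) E) (h : DegDense E (2 * l + p) l ρ) (hε : 0 < ε)
    (hρ : y ^ (p + l) ≤ ρ - (p + l).factorial * ε) (hδ : 0 ≤ δ) (hδy : δ ≤ y) (hy : y ≤ 1)
    (hn : ((p + l : ℕ) : ℝ) ≤ δ * n) (hn0 : 0 < n) {A : List (Fin n)} (hA : A.length = l)
    (hAn : A.Nodup) :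
    LDense ((y - δ) ^ l) l fun C => LDense ε p fun X => E (A ++ X ++ C) := by
  have : Nonempty (Fin n) := ⟨⟨0, hn0⟩⟩
  have : Nonempty (List.Vector (Fin n) l) := ⟨List.Vector.replicate _ ⟨0, hn0⟩⟩
  let R : List (Fin n) → Prop := fun C => LDense ε p fun X => E (A ++ X ++ C)
  have h1 := h A hA hAn
  rw [show 2 * l + p - l = p + l by omega] at h1
  let Bad : List (Fin n) → Prop := fun L => E (A ++ L) ∧ ∃ X C, L ~ X ++ C ∧ C.length = l ∧ ¬ R C
  have h2 : ¬ LDense ((p + l).factorial * ε) (p + l) Bad := by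
    intro hb
    have h3 := hb.perm_of_forall (Q := fun L => E (A ++ L) ∧ ¬ R (L.drop p)) fun L hL => by
      obtain ⟨hL, X, C, hp, hC, hR⟩ := hL
      have hX : X.length = p := by
        have h4 := hE.length_eq hL
        have h5 := hp.length_eq
        simp only [List.length_append] at h4 h5
        omega
      refine ⟨X ++ C, hp, hE.perm (hp.append_left A) hL, ?_⟩
      rwa [List.drop_left' hX]
    rw [mul_div_cancel_left₀ _ (by positivity)] at h3
    refine DenseIn.not_of_fibers (ε := ε)
      (Φ := fun (X : List.Vector (Fin n) p) (C : List.Vector (Fin n) l) =>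
        E (A ++ X.toList ++ C.toList) ∧ ¬ R C.toList) ?_ (h3.split.mono le_rfl ?_)
    · intro C hC
      by_cases hR : R C.toList
      · have : Nonempty (List.Vector (Fin n) p) := ⟨List.Vector.replicate _ ⟨0, hn0⟩⟩
        obtain ⟨X, hX⟩ := hC.exists_of_pos hε
        exact hX.2 hR
      · exact hR (hC.mono le_rfl fun X hX => hX.1)
    · rintro ⟨X, C⟩ ⟨h4, h5⟩
      rw [List.drop_left' X.toList_length] at h5
      exact ⟨by simpa using h4, h5⟩
  have h3 := h1.and_of_dense (Q := fun L => ¬ Bad L) (DenseIn.compl h2)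
  refine (h3.mono hρ fun _ _ h => h).shadow (Q := R) ?_ ?_ hδ hδy hy hn
  · rintro L ⟨hL, -⟩
    exact (List.nodup_append.1 (hE.nodup hL)).2.1
  · rintro L X C ⟨hL, hb⟩ hp hC
    by_contra hR
    exact hb ⟨hL, X, C, hp, hC, hR⟩

/-- A degree condition on `l`-sets suffices to connect ends robustly. -/
theorem connDense_of_degDense_ends {n : ℕ} {E : List (Fin n) → Prop} {ρ ε y δ η : ℝ}
    (hE : IsEdgeFamily (2 * l + p) E) (h : DegDense E (2 * l + p) l ρ) (hε : 0 < ε)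
    (hρ : y ^ (p + l) ≤ ρ - (p + l).factorial * ε) (hδ : 0 ≤ δ) (hδy : δ ≤ y) (hy : y ≤ 1)
    (hη : 1 / 2 + η ≤ (y - δ) ^ l) (hn : ((p + l : ℕ) : ℝ) ≤ δ * n) (hn0 : 0 < n) :
    ConnDense E l p (2 * η * ε ^ 2) (1 * (l + p) + p) := by
  intro A B hA hAn hB hBn
  have hrich := (dense_rich hE h hε hρ hδ hδy hy hn hn0 hA hAn).and_of_dense
    ((dense_rich hE h hε hρ hδ hδy hy hn hn0 hB hBn).mono
      (show 1 - (1 / 2 - η) ≤ _ by linarith) fun _ _ h => h)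
  have h1 := DenseIn.bind (c' := ε ^ 2)
    (Ψ := fun (C : List.Vector (Fin n) l) (x : List.Vector (Fin n) p × List.Vector (Fin n) p) =>
      E (A ++ x.1.toList ++ C.toList) ∧ E (B ++ x.2.toList ++ C.toList))
    hrich (by positivity) fun C hC => by
      rw [sq]
      exact DenseIn.bind (Ψ := fun _ (Y : List.Vector (Fin n) p) => E (B ++ Y.toList ++ C.toList))
        hC.1 hε.le fun _ _ => hC.2
  refine (h1.toLDense (fun x => x.2.1.toList ++ x.1.toList ++ x.2.2.toList) ?_ ?_ ?_
    (P := fun K => Conn E l p A K B) ?_).mono ?_ fun _ _ h => h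
  · rintro ⟨C, X, Y⟩
    simp only [List.length_append, List.Vector.toList_length]
    omega
  · rintro ⟨C, X, Y⟩ ⟨C', X', Y'⟩ hx
    dsimp only at hx
    obtain ⟨hx, hY⟩ := List.append_inj hx (by simp)
    obtain ⟨hX, hC⟩ := List.append_inj hx (by simp)
    rw [Subtype.ext hY, Subtype.ext hX, Subtype.ext hC]
  · simp only [Fintype.card_prod, card_vector, Fintype.card_fin]; ring
  · rintro ⟨C, X, Y⟩ ⟨-, h2, h3⟩
    refine .cons hA (by simp) (by simp) h2 (.edge (by simp) (by simp) hB (hE.perm ?_ h3))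
    classical
    rw [List.perm_iff_count]; intro a
    simp only [List.count_append]; omega
  · have : 0 ≤ ε ^ 2 := by positivity
    nlinarith

end Shadow

section Assembly

open scoped List

variable {V : Type*} {E : List V → Prop} {l p : ℕ}

/-- `L` is an `l`-path whose interior can absorb `S`. -/
def AbsorbsList (E : List V → Prop) (l p : ℕ) (S L : List V) : Prop :=
  ∃ A Z B, L = A ++ Z ++ B ∧ Conn E l p A Z B ∧ ∃ Z', Z' ~ S ++ Z ∧ Conn E l p A Z' B

theorem Flex.exists_absorbs {S L : List V} (h : Flex E l p [] S L) :
    ∃ L', L ~ L' ∧ AbsorbsList E l p S L' := by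
  obtain ⟨A, Z, B, Z₁, Z₂, hL, h1, h2, h3, h4⟩ := h
  exact ⟨A ++ Z₁ ++ B, hL.trans ((h1.symm.append_left A).append_right B), A, Z₁, B, rfl, h3, Z₂,
    h2.trans (h1.symm.append_left S), h4⟩

/-- The interior `W` of a path from `A` to `B` can absorb simultaneously any sequence of lists
absorbed by the corresponding gadgets in `gs`. -/
def AbsorbsAll (E : List V → Prop) (l p : ℕ) (A W B : List V) (gs : List (List V)) : Prop :=
  ∀ Ss, List.Forall₂ (fun L S => S = [] ∨ AbsorbsList E l p S L) gs Ss →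
    ∃ W', W' ~ W ++ Ss.flatten ∧ Conn E l p A W' B

theorem AbsorbsAll.nil {A W B : List V} (h : Conn E l p A W B) : AbsorbsAll E l p A W B [] := by
  intro Ss hS
  cases hS
  exact ⟨W, by simp, h⟩

theorem AbsorbsAll.conn_cons {A W B K A' Z' B' : List V} {gs : List (List V)}
    (h : AbsorbsAll E l p A W B gs) (hK : Conn E l p B K A') (hZ : Conn E l p A' Z' B') :
    AbsorbsAll E l p A (W ++ B ++ K ++ A' ++ Z') B' ((A' ++ Z' ++ B') :: gs) := by
  intro Ss hS
  obtain _ | ⟨hS, hSs⟩ := hS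
  rename_i S Ss
  obtain ⟨W', hW, hA⟩ := h Ss hSs
  have key : ∃ Z₂, Z₂ ~ S ++ Z' ∧ Conn E l p A' Z₂ B' := by
    rcases hS with rfl | ⟨A₁, Z₁, B₁, he, -, Z₂, h2, h3⟩
    · exact ⟨Z', by simp, hZ⟩
    · obtain ⟨he', hB⟩ := List.append_inj' he (by rw [h3.length_right, hZ.length_right])
      obtain ⟨hA', hZ'⟩ := List.append_inj he' (by rw [h3.length_left, hZ.length_left])
      subst hA' hZ' hB
      exact ⟨Z₂, h2, h3⟩
  obtain ⟨Z₂, h2, h3⟩ := key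
  refine ⟨_, ?_, (hA.trans hK).trans h3⟩
  classical
  rw [List.perm_iff_count] at hW h2 ⊢
  intro a
  have := hW a
  have := h2 a
  simp only [List.count_append, List.flatten_cons] at *
  omega

theorem exists_forall₂_of_length_le_countP {α β : Type*} {R : α → List β → Prop} :
    ∀ (Ss : List (List β)) (gs : List α), (∀ S ∈ Ss, ∃ q : α → Bool, (∀ a, q a → R a S) ∧
      Ss.length ≤ gs.countP q) → ∃ Ts, List.Forall₂ (fun a S => S = [] ∨ R a S) gs Ts ∧
      Ts.flatten ~ Ss.flatten
  | [], gs, _ => ⟨gs.map fun _ => [], List.forall₂_map_right_iff.2 (List.forall₂_same.2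
      fun _ _ => Or.inl rfl), by simp⟩
  | S :: Ss, gs, h => by
    obtain ⟨q, hq, hlen⟩ := h S (by simp)
    obtain ⟨a, ha, haq⟩ := List.countP_pos_iff.1 (lt_of_lt_of_le (by simp) hlen)
    obtain ⟨g₁, g₂, rfl⟩ := List.append_of_mem ha
    obtain ⟨Ts, hT, hp⟩ := exists_forall₂_of_length_le_countP Ss (g₁ ++ g₂) fun S' hS' => by
      obtain ⟨q', hq', hlen'⟩ := h S' (by simp [hS'])
      refine ⟨q', hq', ?_⟩
      simp only [List.countP_append, List.countP_cons, List.length_cons] at hlen' ⊢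
      split at hlen' <;> omega
    refine ⟨Ts.take g₁.length ++ S :: Ts.drop g₁.length,
      List.rel_append (List.forall₂_take_append _ _ _ hT.flip).flip
        (.cons (Or.inr (hq a haq)) (List.forall₂_drop_append _ _ _ hT.flip).flip), ?_⟩
    rw [List.flatten_append, List.flatten_cons, List.flatten_cons]
    refine (List.perm_append_comm_assoc _ _ _).trans ?_
    rw [← List.flatten_append, List.take_append_drop]
    exact hp.append_left S

theorem exists_chunks {α : Type*} (r : ℕ) : ∀ (t : ℕ) (X : List α), X.length = t * r →
    ∃ Ss : List (List α), Ss.flatten = X ∧ Ss.length = t ∧ ∀ S ∈ Ss, S.length = r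
  | 0, X, hX => ⟨[], by simpa using (List.length_eq_zero_iff.1 (by simpa using hX)).symm, rfl, by
      simp⟩
  | t + 1, X, hX => by
    rw [Nat.succ_mul] at hX
    obtain ⟨Ss, h1, h2, h3⟩ := exists_chunks r t (X.drop r) (by simp [hX])
    refine ⟨X.take r :: Ss, by simp [h1], by simp [h2], ?_⟩
    intro S hS
    rcases List.mem_cons.1 hS with rfl | hS
    · simp [hX]
    · exact h3 S hS

/-- Choosing `b` well, a proportion of the weight is halved. -/
theorem exists_sum_ite_le {α β : Type*} [Fintype α] [Fintype β] [Nonempty β] {c : ℝ}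
    {G : α → β → Prop} [∀ a b, Decidable (G a b)] (w : α → ℝ) (hw : ∀ a, 0 ≤ w a)
    (hG : ∀ a, DenseIn c (G a)) :
    ∃ b, ∑ a, w a * (if G a b then 1 / 2 else 1) ≤ (1 - c / 2) * ∑ a, w a := by
  simp only [denseIn_iff] at hG
  by_contra! hlt
  have h1 : ∑ _b : β, (1 - c / 2) * ∑ a, w a
      < ∑ b, ∑ a, w a * (if G a b then (1 : ℝ) / 2 else 1) :=
    Finset.sum_lt_sum_of_nonempty Finset.univ_nonempty fun b _ => hlt b
  rw [Finset.sum_comm, Finset.sum_const, Finset.card_univ, nsmul_eq_mul] at h1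
  have h2 : ∀ a, ∑ b, w a * (if G a b then (1 : ℝ) / 2 else 1)
      ≤ w a * ((1 - c / 2) * Fintype.card β) := by
    intro a
    rw [← Finset.mul_sum]
    refine mul_le_mul_of_nonneg_left ?_ (hw a)
    have h3 : ∀ b, (if G a b then (1 : ℝ) / 2 else 1) = 1 - (1 / 2) * (if G a b then 1 else 0) := by
      intro b; split <;> norm_num
    simp only [h3]
    rw [Finset.sum_sub_distrib, ← Finset.mul_sum, ← Finset.sum_filter, Finset.sum_const,
      Finset.sum_const, Finset.card_univ, nsmul_eq_mul, nsmul_eq_mul]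
    have := hG a
    linarith
  have h4 := Finset.sum_le_sum fun a (_ : a ∈ Finset.univ) => h2 a
  rw [← Finset.sum_mul] at h4
  nlinarith


variable [Fintype V] {β c δ : ℝ} {b m₀ : ℕ}

theorem dense_absorbing_extension (hE : IsEdgeFamily (2 * l + p) E) {S : List V}
    (hS : LDense β b (AbsorbsList E l p S)) (hC : ConnDense E l p c m₀) (hc : 0 ≤ c)
    {A W B : List V} (hP : (A ++ W ++ B).Nodup) (hB : B.length = l) (hδ : δ ≤ 1)
    (hδβ : ((b + m₀ : ℕ) : ℝ) * δ ≤ β * c / 2)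
    (hV : (((A ++ W ++ B).length + (b + m₀) : ℕ) : ℝ) ≤ δ * Fintype.card V) :
    LDense (β * c / 2) (b + m₀) fun M => ((A ++ W ++ B) ++ M).Nodup ∧
      ∃ A' Z' B' K, M = (A' ++ Z' ++ B') ++ K ∧ (A' ++ Z' ++ B').length = b ∧
        AbsorbsList E l p S (A' ++ Z' ++ B') ∧ Conn E l p A' Z' B' ∧ Conn E l p B K A' := by
  have h1 : LDense (β * c) (b + m₀) fun M => ∃ A' Z' B' K, M = (A' ++ Z' ++ B') ++ K ∧
      (A' ++ Z' ++ B').length = b ∧ AbsorbsList E l p S (A' ++ Z' ++ B') ∧ Conn E l p A' Z' B' ∧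
      Conn E l p B K A' := by
    refine hS.append hc (Q := fun L K => Conn E l p B K (L.take l)) ?_ ?_
    · rintro L hL ⟨A', Z', B', rfl, hZ, -⟩
      rw [List.append_assoc, List.take_left' hZ.length_left]
      exact hC _ _ hB (List.nodup_append.1 hP).2.1 hZ.length_left (hZ.nodup_left hE)
    · rintro L K hL hK ⟨A', Z', B', rfl, hZ, h⟩ hconn
      rw [List.append_assoc, List.take_left' hZ.length_left] at hconn
      exact ⟨A', Z', B', K, rfl, hL, ⟨A', Z', B', rfl, hZ, h⟩, hZ, hconn⟩
  exact (h1.and_of_dense (LDense.nodup_append _ hP hδ _ hV)).mono (by linarith)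
    fun M _ h => ⟨h.2, h.1⟩

open Classical in
/-- After `j` steps of the greedy construction, most lists are absorbed by many gadgets. -/
theorem exists_greedy_path [Nonempty V] {r : ℕ} (hE : IsEdgeFamily (2 * l + p) E)
    (h₀ : ∃ L, E L) (hS : ∀ S, S.length = r → LDense β b (AbsorbsList E l p S)) (hβ : 0 < β)
    (hC : ConnDense E l p c m₀) (hc : 0 < c) (hδ : δ ≤ 1)
    (hδβ : ((b + m₀ : ℕ) : ℝ) * δ ≤ β * c / 2) : ∀ j : ℕ,
    ((2 * l + p + j * (b + m₀) : ℕ) : ℝ) ≤ δ * Fintype.card V →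
    ∃ A W B gs, AbsorbsAll E l p A W B gs ∧ Conn E l p A W B ∧ (A ++ W ++ B).Nodup ∧
      (A ++ W ++ B).length = 2 * l + p + j * (b + m₀) ∧
      ∑ S : List.Vector V r, (1 / 2 : ℝ) ^ gs.countP (AbsorbsList E l p S.toList ·)
        ≤ (1 - β * c / 4) ^ j * (Fintype.card V : ℝ) ^ r
  | 0, _ => by
    obtain ⟨L, hL⟩ := h₀
    have hLl := hE.length_eq hL
    have e : L.take l ++ (L.drop l).take p ++ (L.drop l).drop p = L := by simp
    refine ⟨L.take l, (L.drop l).take p, (L.drop l).drop p, [], AbsorbsAll.nil (.edge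
      (by simp; omega) (by simp; omega) (by simp; omega) (by rwa [e])),
      .edge (by simp; omega) (by simp; omega) (by simp; omega) (by rwa [e]), ?_, ?_, ?_⟩
    · rw [e]; exact hE.nodup hL
    · rw [e, hLl]; simp
    · simp [card_vector]
  | j + 1, hj => by
    obtain ⟨A, W, B, gs, hA, hB, hn, hlen, hsum⟩ := exists_greedy_path hE h₀ hS hβ hC hc hδ hδβ j
      (le_trans (by gcongr; omega) hj)
    have hV : (((A ++ W ++ B).length + (b + m₀) : ℕ) : ℝ) ≤ δ * Fintype.card V := by
      rw [hlen]
      refine le_trans (le_of_eq ?_) hj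
      push_cast; ring
    have hG := fun S : List.Vector V r => dense_absorbing_extension hE
      (hS S.toList S.toList_length) hC hc.le hn hB.length_right hδ hδβ hV
    have : Nonempty (List.Vector V (b + m₀)) := ⟨List.Vector.replicate _ (Classical.arbitrary V)⟩
    have : Nonempty (List.Vector V r) := ⟨List.Vector.replicate _ (Classical.arbitrary V)⟩
    obtain ⟨M, hM⟩ := exists_sum_ite_le (fun S : List.Vector V r =>
      (1 / 2 : ℝ) ^ gs.countP (AbsorbsList E l p S.toList ·)) (fun _ => by positivity) hG
    set w := fun S : List.Vector V r => (1 / 2 : ℝ) ^ gs.countP (AbsorbsList E l p S.toList ·)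
    have hw : 0 < ∑ S, w S := Finset.sum_pos (fun _ _ => by positivity) Finset.univ_nonempty
    have hex : ∃ S : List.Vector V r, ((A ++ W ++ B) ++ M.toList).Nodup ∧
      ∃ A' Z' B' K, M.toList = (A' ++ Z' ++ B') ++ K ∧ (A' ++ Z' ++ B').length = b ∧
        AbsorbsList E l p S.toList (A' ++ Z' ++ B') ∧ Conn E l p A' Z' B' ∧ Conn E l p B K A' := by
      by_contra! hno
      rw [Finset.sum_congr rfl fun S _ => by rw [if_neg (by push Not; exact hno S)]] at hM
      simp only [mul_one] at hM
      nlinarith [mul_pos hβ hc]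
    obtain ⟨-, hMn, A', Z', B', K, hMe, hb, -, hZ, hK⟩ := hex
    refine ⟨A, W ++ B ++ K ++ A' ++ Z', B', (A' ++ Z' ++ B') :: gs, hA.conn_cons hK hZ,
      (hB.trans hK).trans hZ, ?_, ?_, ?_⟩
    · refine (List.Perm.nodup_iff ?_).1 hMn
      rw [hMe, List.perm_iff_count]
      intro a
      simp only [List.count_append]
      omega
    · have := congrArg List.length hMe
      simp only [List.length_append, M.toList_length] at this hlen hb ⊢
      rw [Nat.add_one_mul j]
      omega
    · have hβc : 1 - β * c / 4 = 1 - β * c / 2 / 2 := by ring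
      have h4 : 0 ≤ 1 - β * c / 2 / 2 := by
        by_contra! hneg
        have := (Finset.sum_nonneg fun S _ => mul_nonneg (show 0 ≤ w S by positivity)
          (by split_ifs <;> norm_num)).trans hM
        nlinarith
      rw [pow_succ', mul_assoc, hβc]
      rw [hβc] at hsum
      refine le_trans ?_ (hM.trans (mul_le_mul_of_nonneg_left hsum h4))
      refine Finset.sum_le_sum fun S _ => ?_
      rw [List.countP_cons, pow_add]
      refine mul_le_mul_of_nonneg_left ?_ (by positivity)
      by_cases h5 : ((A ++ W ++ B) ++ M.toList).Nodup ∧ ∃ A' Z' B' K,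
          M.toList = (A' ++ Z' ++ B') ++ K ∧ (A' ++ Z' ++ B').length = b ∧
          AbsorbsList E l p S.toList (A' ++ Z' ++ B') ∧ Conn E l p A' Z' B' ∧ Conn E l p B K A'
      · rw [if_pos h5]
        obtain ⟨-, A₁, Z₁, B₁, K₁, hMe₁, hb₁, h6, -⟩ := h5
        rw [← (List.append_inj (hMe.symm.trans hMe₁) (hb.trans hb₁.symm)).1] at h6
        rw [if_pos (decide_eq_true h6), pow_one]
      · rw [if_neg h5]
        exact pow_le_one₀ (by norm_num) (by norm_num)

end Assembly

section AbsorbingPath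

open scoped List

theorem exists_pow_le_two_pow_div (r D : ℕ) (hD : 0 < D) :
    ∃ N : ℕ, ∀ n, N ≤ n → n ^ r ≤ 2 ^ (n / D) := by
  have h := (tendsto_pow_const_mul_const_pow_of_abs_lt_one r (r := (1 / 2 : ℝ))
    (by rw [abs_of_pos] <;> norm_num)).eventually_le_const
    (show (0 : ℝ) < 1 / (2 * (D : ℝ) ^ r) by positivity)
  obtain ⟨N, hN⟩ := Filter.eventually_atTop.1 h
  refine ⟨D * N, fun n hn => ?_⟩
  have h1 : N ≤ n / D := (Nat.le_div_iff_mul_le hD).2 (by rwa [mul_comm])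
  have h2 := hN (n / D + 1) (by omega)
  have h3 : n ≤ D * (n / D + 1) := (Nat.lt_mul_div_succ n hD).le
  have h4 : ((n : ℝ)) ^ r ≤ (D : ℝ) ^ r * ((n / D + 1 : ℕ) : ℝ) ^ r := by
    rw [← mul_pow]
    gcongr
    exact_mod_cast h3
  rw [le_div_iff₀ (by positivity), one_div, inv_pow, mul_right_comm, ← div_eq_mul_inv,
    div_le_iff₀ (by positivity), pow_succ] at h2
  have h5 : (n : ℝ) ^ r ≤ 2 ^ (n / D) := by linarith
  exact_mod_cast h5

/-- Dense absorbers and robust connections yield a short absorbing path. -/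
theorem exists_absorbing_path {l p : ℕ} (hp : 1 ≤ p) {β c γ : ℝ} (hβ : 0 < β)
    (hc : 0 < c) (hγ : 0 < γ) (b m₀ : ℕ) : ∃ θ : ℝ, 0 < θ ∧ ∃ N : ℕ, ∀ (V : Type) [Fintype V],
    N ≤ Fintype.card V → ∀ E : List V → Prop, IsEdgeFamily (2 * l + p) E → (∃ L, E L) →
      (∀ S, S.length = l + p → LDense β b (Flex E l p [] S)) → ConnDense E l p c m₀ →
      ∃ A W B, Conn E l p A W B ∧ (A ++ W ++ B).Nodup ∧
        ((A ++ W ++ B).length : ℝ) ≤ γ * Fintype.card V ∧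
        ∀ X : List V, (X.length : ℝ) ≤ θ * Fintype.card V → l + p ∣ X.length →
          ∃ W', W' ~ W ++ X ∧ Conn E l p A W' B := by
  classical
  set β' := min β 1 / b.factorial with hβ'
  set c' := min c 1 with hc'
  have hβ0 : 0 < β' := div_pos (lt_min hβ one_pos) (by positivity)
  have hc0 : 0 < c' := lt_min hc one_pos
  have hβ1 : β' ≤ 1 := div_le_one_of_le₀ ((min_le_right _ _).trans
    (by exact_mod_cast Nat.factorial_pos b)) (by positivity)
  have hβc : β' * c' ≤ 1 := mul_le_one₀ hβ1 hc0.le (min_le_right _ _)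
  obtain ⟨δ, hδ0, hδ⟩ : ∃ δ : ℝ, 0 < δ ∧ δ ≤ 1 ∧ δ ≤ γ ∧ ((b + m₀ : ℕ) : ℝ) * δ ≤ β' * c' / 2 := by
    refine ⟨min (min 1 γ) (β' * c' / 2 / ((b + m₀ : ℕ) + 1)), by positivity,
      (min_le_left _ _).trans (min_le_left _ _), (min_le_left _ _).trans (min_le_right _ _), ?_⟩
    calc ((b + m₀ : ℕ) : ℝ) * min (min 1 γ) (β' * c' / 2 / ((b + m₀ : ℕ) + 1))
        ≤ ((b + m₀ : ℕ) + 1) * (β' * c' / 2 / ((b + m₀ : ℕ) + 1)) := by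
          gcongr
          · linarith
          · exact min_le_right _ _
      _ = β' * c' / 2 := by field_simp
  obtain ⟨hδ1, hδγ, hδβ⟩ := hδ
  obtain ⟨T, hT⟩ := exists_pow_lt_of_lt_one (show (0 : ℝ) < 1 / 4 by norm_num)
    (show 1 - β' * c' / 4 < 1 by linarith [mul_pos hβ0 hc0])
  obtain ⟨D, hD⟩ := exists_nat_gt (2 * (T * (b + m₀ : ℕ)) / δ)
  rw [div_lt_iff₀ hδ0] at hD
  have hD0 : 0 < D := by
    rcases Nat.eq_zero_or_pos D with rfl | h
    · have : (0 : ℝ) ≤ 2 * (T * (b + m₀ : ℕ)) := by positivity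
      simp only [Nat.cast_zero, zero_mul] at hD
      linarith
    · exact h
  obtain ⟨N₁, hN₁⟩ := exists_pow_le_two_pow_div (l + p) D hD0
  obtain ⟨N₂, hN₂⟩ := exists_nat_gt (2 * (2 * l + p : ℕ) / δ)
  rw [div_lt_iff₀ hδ0] at hN₂
  refine ⟨1 / (2 * D), by positivity, max (max N₁ N₂) D, fun V _ hV E hE h₀ hS hC => ?_⟩
  set n := Fintype.card V with hn
  obtain ⟨hV12, hVD⟩ := max_le_iff.1 hV
  obtain ⟨hV1, hV2⟩ := max_le_iff.1 hV12
  have : Nonempty V := Fintype.card_pos_iff.1 (by omega)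
  set h := n / D with hh
  have hDh : D * h ≤ n := Nat.mul_div_le n D
  have hDh' : (D : ℝ) * h ≤ n := by exact_mod_cast hDh
  have hS' : ∀ S, S.length = l + p → LDense β' b (AbsorbsList E l p S) := fun S hSl =>
    ((hS S hSl).mono (min_le_left _ 1) fun _ _ h => h).perm_of_forall fun _ h => h.exists_absorbs
  have hC' : ConnDense E l p c' m₀ := fun A B hA hAn hB hBn =>
    (hC A B hA hAn hB hBn).mono (min_le_left _ _) fun _ _ h => h
  have hlen : ((2 * l + p + T * h * (b + m₀) : ℕ) : ℝ) ≤ δ * n := by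
    have h1 : ((N₂ : ℕ) : ℝ) ≤ n := by exact_mod_cast hV2
    have h2 : (2 : ℝ) * (T * (b + m₀ : ℕ)) * h ≤ D * δ * h := by gcongr
    have h3 : ((2 * l + p + T * h * (b + m₀) : ℕ) : ℝ)
      = (2 * l + p : ℕ) + T * (b + m₀ : ℕ) * h := by push_cast; ring
    rw [h3]
    nlinarith
  obtain ⟨A, W, B, gs, hA, hconn, hnd, hl, hsum⟩ := exists_greedy_path (r := l + p) hE h₀ hS' hβ0 hC'
    hc0 hδ1 hδβ (T * h) hlen
  refine ⟨A, W, B, hconn, hnd, ?_, fun X hX hdvd => ?_⟩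
  · rw [hl]
    exact hlen.trans (mul_le_mul_of_nonneg_right hδγ n.cast_nonneg)
  have hhits : ∀ S : List V, S.length = l + p → h ≤ gs.countP (AbsorbsList E l p S ·) := by
    intro S hSl
    by_contra! hlt
    have h1 := (Finset.single_le_sum (f := fun S : List.Vector V (l + p) =>
      (1 / 2 : ℝ) ^ gs.countP (AbsorbsList E l p S.toList ·)) (fun _ _ => by positivity)
      (Finset.mem_univ ⟨S, hSl⟩)).trans hsum
    have h2 : (1 / 2 : ℝ) ^ h * 2 ≤ (1 / 2 : ℝ) ^ gs.countP (AbsorbsList E l p S ·) := by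
      have := pow_le_pow_of_le_one (show (0 : ℝ) ≤ 1 / 2 by norm_num) (by norm_num) hlt
      rw [Nat.succ_eq_add_one, pow_succ] at this
      linarith
    have h3 : (1 - β' * c' / 4) ^ (T * h) ≤ (1 / 4) ^ h := by
      rw [pow_mul]
      exact pow_le_pow_left₀ (pow_nonneg (by linarith) _) hT.le _
    have h4 : (n : ℝ) ^ (l + p) ≤ 2 ^ h := by exact_mod_cast hN₁ n hV1
    have h5 : (1 / 2 : ℝ) ^ h * 2 ≤ (1 / 4) ^ h * 2 ^ h :=
      (h2.trans h1).trans (mul_le_mul h3 h4 (by positivity) (by positivity))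
    rw [← mul_pow] at h5
    norm_num at h5
  obtain ⟨t, ht⟩ := hdvd
  obtain ⟨Ss, rfl, hSt, hSr⟩ := exists_chunks (l + p) t X (by rw [ht, mul_comm])
  have hth : t ≤ h := by
    have h1 : t ≤ Ss.flatten.length := by rw [ht]; nlinarith
    have h2 : (t : ℝ) ≤ 1 / (2 * D) * n := le_trans (by exact_mod_cast h1) hX
    have h3 : n < D * (h + 1) := Nat.lt_mul_div_succ n hD0
    have h4 : 1 ≤ h := (Nat.le_div_iff_mul_le hD0).2 (by simpa using hVD)
    rw [one_div, inv_mul_eq_div, le_div_iff₀ (by positivity)] at h2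
    have h5 : t * (2 * D) ≤ n := by exact_mod_cast h2
    nlinarith
  obtain ⟨Ts, hTs, hp⟩ := exists_forall₂_of_length_le_countP
    (R := fun L S => AbsorbsList E l p S L) Ss gs fun S hS =>
      ⟨fun L => AbsorbsList E l p S L, by simp, by rw [hSt]; exact hth.trans (hhits S (hSr S hS))⟩
  obtain ⟨W', hW', hW⟩ := hA Ts hTs
  exact ⟨W', hW'.trans (hp.append_left W), hW⟩

end AbsorbingPath

section Translation

open scoped List

variable {n k l p : ℕ}

/-- The orderings of the edges of a `k`-graph. -/
def EdgeOrder (k : ℕ) (H : Finset (Finset (Fin n))) (L : List (Fin n)) : Prop :=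
  L.length = k ∧ L.toFinset ∈ H

theorem IsKGraph.isEdgeFamily {H : Finset (Finset (Fin n))} (hH : IsKGraph n k H) :
    IsEdgeFamily k (EdgeOrder k H) where
  length_eq h := h.1
  nodup h := List.nodup_of_card_toFinset (by rw [h.1, hH _ h.2])
  perm hp h := ⟨hp.length_eq.symm.trans h.1, by rw [← List.toFinset_eq_of_perm _ _ hp]; exact h.2⟩

/-- Large binomial minimum degree gives large degree in terms of ordered edges. -/
theorem degDense_of_minDeg {d : ℕ} (hd : d ≤ k) {ρ ε : ℝ} (hρ : 0 ≤ ρ)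
    (hε : ρ * (k * k : ℕ) ≤ ε * n) (hn : k ≤ n) (hn0 : 0 < n) {H : Finset (Finset (Fin n))}
    (h : ρ * (n.choose (k - d) : ℝ) ≤ (minDeg n k d H : ℝ)) :
    DegDense (EdgeOrder k H) k d (ρ - ε) := by
  classical
  intro A hA hAn
  obtain ⟨m, rfl⟩ := Nat.exists_eq_add_of_le hd
  rw [Nat.add_sub_cancel_left] at h ⊢
  have hcard : A.toFinset.card = d := by rw [List.toFinset_card_of_nodup hAn, hA]
  have h1 : minDeg n (d + m) d H ≤ hDeg n (d + m) H A.toFinset := Nat.sInf_le ⟨_, hcard, rfl⟩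
  set 𝒮 := Finset.univ.filter fun T : Finset (Fin n) =>
    T.card = m ∧ Disjoint A.toFinset T ∧ A.toFinset ∪ T ∈ H with h𝒮
  have h2 : hDeg n (d + m) H A.toFinset = 𝒮.card := by
    rw [hDeg, hcard, Nat.add_sub_cancel_left, Nat.card_eq_fintype_card, Fintype.card_subtype]
  have h3 := card_filter_toFinset_mem 𝒮 (m := m) fun s hs => (Finset.mem_filter.1 hs).2.1
  have h4 : (m.factorial * 𝒮.card : ℕ) ≤
      (Finset.univ.filter fun Y : List.Vector (Fin n) m => EdgeOrder (d + m) H (A ++ Y.toList)).card := by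
    rw [← h3]
    refine Finset.card_le_card fun Y hY => ?_
    simp only [Finset.mem_filter, Finset.mem_univ, true_and, h𝒮] at hY ⊢
    exact ⟨by simp [hA], by rw [List.toFinset_append]; exact hY.2.2⟩
  unfold LDense
  rw [denseIn_iff, card_vector, Fintype.card_fin]
  have h6 : ρ * n.descFactorial m ≤ m.factorial * 𝒮.card := by
    rw [Nat.descFactorial_eq_factorial_mul_choose]
    push_cast
    have : ρ * (n.choose m : ℝ) ≤ 𝒮.card := h.trans (by rw [← h2]; exact_mod_cast h1)
    calc ρ * (m.factorial * n.choose m : ℝ) = m.factorial * (ρ * n.choose m) := by ring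
      _ ≤ _ := by gcongr
  refine le_trans ?_ (h6.trans (by exact_mod_cast h4))
  have h7 : (n : ℝ) ^ m * (1 - m * (m / n)) ≤ n.descFactorial m := by
    have hmn : m ≤ n := by omega
    calc (n : ℝ) ^ m * (1 - m * (m / n)) ≤ (n : ℝ) ^ m * (1 + -(m / n : ℝ)) ^ m := by
          gcongr
          have h8 := one_add_mul_le_pow (a := -(m / n : ℝ)) (by
            have : (m / n : ℝ) ≤ 1 := div_le_one_of_le₀ (by exact_mod_cast hmn) (by positivity)
            linarith) m
          linarith
      _ = ((n - m : ℕ) : ℝ) ^ m := by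
          rw [← mul_pow, Nat.cast_sub hmn]
          field_simp
          ring
      _ ≤ ((n + 1 - m : ℕ) : ℝ) ^ m := by
          gcongr
          omega
      _ ≤ n.descFactorial m := by exact_mod_cast Nat.pow_sub_le_descFactorial n m
  have h8 : ρ * (m * (m / n)) ≤ ε := by
    rw [← mul_div_assoc, ← mul_div_assoc, div_le_iff₀ (by exact_mod_cast hn0)]
    refine le_trans ?_ hε
    gcongr
    exact_mod_cast Nat.mul_le_mul (Nat.le_add_left m d) (Nat.le_add_left m d)
  calc (ρ - ε) * ((n ^ m : ℕ) : ℝ) ≤ (ρ - ρ * (m * (m / n))) * ((n ^ m : ℕ) : ℝ) := by gcongr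
    _ = ρ * ((n : ℝ) ^ m * (1 - m * (m / n))) := by push_cast; ring
    _ ≤ _ := by gcongr

theorem Conn.exists_edges {V : Type*} {E : List V → Prop} {A Z B : List V}
    (h : Conn E l p A Z B) : ∃ t, (A ++ Z ++ B).length = t * (l + p) + l ∧
      ∀ j < t, E (((A ++ Z ++ B).drop (j * (l + p))).take (2 * l + p)) := by
  induction h with
  | @edge A X B hA hX hB hE =>
    refine ⟨1, by simp only [List.length_append]; omega, fun j hj => ?_⟩
    obtain rfl : j = 0 := by omega
    rwa [zero_mul, List.drop_zero, List.take_of_length_le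
      (by simp only [List.length_append]; omega)]
  | @cons A X C Z B hA hX hC hE _ ih =>
    obtain ⟨t, ht, hEt⟩ := ih
    refine ⟨t + 1, ?_, fun j hj => ?_⟩
    · simp only [List.length_append] at ht ⊢
      rw [Nat.add_one_mul]
      omega
    · rcases j with _ | j
      · have e : A ++ (X ++ C ++ Z) ++ B = (A ++ X ++ C) ++ (Z ++ B) := by simp
        rwa [zero_mul, List.drop_zero, e, List.take_left' (by simp; omega)]
      · have e : A ++ (X ++ C ++ Z) ++ B = (A ++ X) ++ (C ++ Z ++ B) := by simp
        rw [add_mul j, one_mul, add_comm (j * _), ← List.drop_drop, e, List.drop_left' (by simp; omega)]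
        exact hEt j (by omega)

theorem List.toFinset_take_drop {V : Type*} [DecidableEq V] (L : List V) (x : V) {a k : ℕ}
    (h : a + k ≤ L.length) :
    ((L.drop a).take k).toFinset = (Finset.range k).image fun i => L.getD (a + i) x := by
  ext v
  simp only [List.mem_toFinset, List.mem_iff_getElem, Finset.mem_image, Finset.mem_range,
    List.length_take, List.length_drop, List.getElem_take, List.getElem_drop]
  constructor
  · rintro ⟨i, hi, rfl⟩
    exact ⟨i, by omega, List.getD_eq_getElem _ _ (by omega)⟩
  · rintro ⟨i, hi, rfl⟩
    exact ⟨i, by omega, (List.getD_eq_getElem _ _ (by omega)).symm⟩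

/-- A walk without repeated vertices is an `l`-path. -/
theorem Conn.exists_isLPath {H : Finset (Finset (Fin n))} {A Z B : List (Fin n)} (x : Fin n)
    (h : Conn (EdgeOrder (2 * l + p) H) l p A Z B) (hnd : (A ++ Z ++ B).Nodup) :
    ∃ (t : ℕ) (f : ℕ → Fin n), IsLPath n (2 * l + p) l t H f ∧
      pathVerts n (2 * l + p) l t f = (A ++ Z ++ B).toFinset ∧
      (pathBeg n l f = fun i : Fin l => A.getD i x) ∧
      pathEnd n (2 * l + p) l t f = fun i : Fin l => B.getD i x := by
  obtain ⟨t, ht, hE⟩ := h.exists_edges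
  have hA := h.length_left
  have hB := h.length_right
  have hk : 2 * l + p - l = l + p := by omega
  refine ⟨t, fun i => (A ++ Z ++ B).getD i x, ⟨?_, fun j hj => ?_⟩, ?_, ?_, ?_⟩
  · rw [hk, ← ht]
    intro i hi j hj hij
    simp only [List.getD_eq_getElem _ _ (Set.mem_Iio.1 hi),
      List.getD_eq_getElem _ _ (Set.mem_Iio.1 hj)] at hij
    exact (hnd.getElem_inj_iff).1 hij
  · have := Nat.mul_le_mul_right (l + p) hj
    rw [Nat.succ_mul] at this
    rw [hk, ← List.toFinset_take_drop _ x (by omega)]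
    exact (hE j hj).2
  · have := List.toFinset_take_drop (A ++ Z ++ B) x (a := 0) (k := t * (l + p) + l) (by omega)
    rw [List.drop_zero, ← ht, List.take_length] at this
    simp only [zero_add] at this
    rw [pathVerts, hk, ← ht, this]
  · funext i
    rw [pathBeg, List.append_assoc, List.getD_append _ _ _ _ (by omega)]
  · funext i
    have : (A ++ Z).length = t * (l + p) := by
      simp only [List.length_append] at ht ⊢
      omega
    rw [pathEnd, hk, List.getD_append_right _ _ _ _ (by omega), this, Nat.add_sub_cancel_left]

/-- `H` has an absorbing path on at most `γ * n` vertices for sets of size at most `θ * n`. -/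
def AbsorbingPathExists (k l : ℕ) (γ θ : ℝ) (H : Finset (Finset (Fin n))) : Prop :=
  ∃ (t : ℕ) (f : ℕ → Fin n), IsLPath n k l t H f ∧
    ((pathVerts n k l t f).card : ℝ) ≤ γ * n ∧
    ∀ X : Finset (Fin n), Disjoint X (pathVerts n k l t f) →
      (X.card : ℝ) ≤ θ * n → (k - l) ∣ X.card →
      ∃ (t' : ℕ) (g : ℕ → Fin n), IsLPath n k l t' H g ∧
        pathVerts n k l t' g = pathVerts n k l t f ∪ X ∧
        pathBeg n l g = pathBeg n l f ∧ pathEnd n k l t' g = pathEnd n k l t f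

theorem AbsorbingPathExists.mono {γ θ θ' : ℝ} {H : Finset (Finset (Fin n))}
    (h : AbsorbingPathExists k l γ θ H) (hθ : θ' ≤ θ) : AbsorbingPathExists k l γ θ' H := by
  obtain ⟨t, f, hf, hγ, habs⟩ := h
  exact ⟨t, f, hf, hγ, fun X hX hXc =>
    habs X hX (hXc.trans (mul_le_mul_of_nonneg_right hθ n.cast_nonneg))⟩

theorem Robust.exists_absorbing_path (hl : 1 ≤ l) (hp : 1 ≤ p) (s : ℕ) {ε c γ : ℝ} (hε : 0 < ε)
    (hc : 0 < c) (hγ : 0 < γ) : ∃ θ : ℝ, 0 < θ ∧ ∃ N : ℕ, ∀ n, N ≤ n →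
      ∀ H : Finset (Finset (Fin n)), Robust (EdgeOrder (2 * l + p) H) l p (s * (l + p) + p) ε c →
      AbsorbingPathExists (2 * l + p) l γ θ H := by
  obtain ⟨β, hβ, b, N₁, h₁⟩ := Robust.exists_dense_absorbers hl hp s hε hc
  obtain ⟨θ, hθ, N₂, h₂⟩ :=
    _root_.exists_absorbing_path (l := l) hp hβ hc hγ b (s * (l + p) + p)
  refine ⟨θ, hθ, max (max N₁ N₂) 1, fun n hn H hR => ?_⟩
  obtain ⟨hn12, hn0⟩ := max_le_iff.1 hn
  obtain ⟨hn1, hn2⟩ := max_le_iff.1 hn12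
  have x : Fin n := ⟨0, hn0⟩
  have h₀ : ∃ L, EdgeOrder (2 * l + p) H L := by
    have : Nonempty (Fin n) := ⟨x⟩
    obtain ⟨Y, -, hY⟩ := (hR.deg_one [x] rfl (by simp)).exists_of_pos (by linarith)
    exact ⟨_, hY⟩
  obtain ⟨A, W, B, hW, hnd, hlen, habs⟩ := h₂ (Fin n) (by rwa [Fintype.card_fin]) _
    hR.isEdgeFamily h₀ (h₁ (Fin n) (by rwa [Fintype.card_fin]) _ hR) hR.conn
  rw [Fintype.card_fin] at hlen habs
  obtain ⟨t, f, hf, hfv, hfb, hfe⟩ := hW.exists_isLPath x hnd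
  refine ⟨t, f, hf, ?_, fun X hX hXc hXd => ?_⟩
  · rwa [hfv, List.toFinset_card_of_nodup hnd]
  obtain ⟨W', hW', hW'c⟩ := habs X.toList (by rwa [Finset.length_toList])
    (by rwa [Finset.length_toList, show l + p = 2 * l + p - l by omega])
  have hperm : A ++ W' ++ B ~ (A ++ W ++ B) ++ X.toList := by
    rw [List.perm_iff_count] at hW' ⊢
    intro a
    have := hW' a
    simp only [List.count_append] at this ⊢
    omega
  have hnd' : (A ++ W' ++ B).Nodup := by
    rw [hperm.nodup_iff]
    refine List.Nodup.append hnd X.nodup_toList fun v hv hvX => ?_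
    rw [hfv] at hX
    exact Finset.disjoint_left.1 hX (Finset.mem_toList.1 hvX) (List.mem_toFinset.2 hv)
  obtain ⟨t', g, hg, hgv, hgb, hge⟩ := hW'c.exists_isLPath x hnd'
  refine ⟨t', g, hg, ?_, hgb.trans hfb.symm, hge.trans hfe.symm⟩
  rw [hgv, hfv, List.toFinset_eq_of_perm _ _ hperm, List.toFinset_append, Finset.toList_toFinset]

theorem DegDense.step_down_of_le {V : Type*} [Fintype V] {E : List V → Prop} {d : ℕ} {ρ ε : ℝ}
    (hρ : ρ ≤ 1) (hε : 0 ≤ ε) (hk : (k : ℝ) ≤ ε * Fintype.card V) :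
    ∀ j, d + j ≤ k → j * ε ≤ ρ → DegDense E k (d + j) ρ → DegDense E k d (ρ - j * ε)
  | 0, _, _, h => by simpa using h
  | j + 1, hj, hjρ, h => by
    push_cast at hjρ ⊢
    have hjε : (0 : ℝ) ≤ j * ε := by positivity
    have h1 := DegDense.step_down h hj (by linarith) hρ hε hk
    have h2 := step_down_of_le (by linarith) hε hk j (by omega) (by linarith) h1
    rwa [sub_sub, show ε + j * ε = (j + 1) * ε by ring] at h2

/-- A large minimum degree passes to ordered edges and to smaller sets. -/
theorem exists_degDense_of_minDeg {d : ℕ} (hd : d ≤ k) {ρ σ : ℝ} (hσ : 0 < σ) (hσρ : σ ≤ ρ)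
    (hρ : ρ ≤ 1) : ∃ N : ℕ, ∀ n, N ≤ n → ∀ H : Finset (Finset (Fin n)),
      ρ * (n.choose (k - d) : ℝ) ≤ (minDeg n k d H : ℝ) →
      ∀ d' ≤ d, DegDense (EdgeOrder k H) k d' (ρ - σ) := by
  set ε := σ / (k + 1) with hε
  have hε0 : 0 < ε := by positivity
  have hεσ : (k + 1) * ε = σ := by rw [hε]; field_simp
  obtain ⟨N, hN⟩ := exists_nat_gt ((k * k + k + 1 : ℝ) / ε)
  rw [div_lt_iff₀ hε0] at hN
  refine ⟨max N (k + 1), fun n hn H hH d' hd' => ?_⟩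
  obtain ⟨hn1, hn2⟩ := max_le_iff.1 hn
  have hn3 : (k * k + k + 1 : ℝ) ≤ ε * n := by
    have : (N : ℝ) ≤ n := by exact_mod_cast hn1
    nlinarith
  have hkk : (0 : ℝ) ≤ (k : ℝ) * k := by positivity
  have hk0 : (0 : ℝ) ≤ k := by positivity
  have h1 : DegDense (EdgeOrder k H) k d (ρ - ε) := by
    refine degDense_of_minDeg hd (by linarith) ?_ (by omega) (by omega) hH
    push_cast
    nlinarith
  obtain ⟨j, rfl⟩ := Nat.exists_eq_add_of_le hd'
  have hjk : (j : ℝ) ≤ k := by exact_mod_cast (by omega : j ≤ k)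
  have h2 := DegDense.step_down_of_le (by linarith) hε0.le
    (by rw [Fintype.card_fin]; linarith) j hd (by nlinarith) h1
  exact fun A hA hAn => (h2 A hA hAn).mono (by nlinarith) fun _ _ h => h

theorem exists_robust_of_minDeg_succ (hl : 1 ≤ l) (hp : 1 ≤ p) {η : ℝ} (hη : 0 < η) :
    ∃ s : ℕ, ∃ ε c : ℝ, 0 < ε ∧ 0 < c ∧ ∃ N : ℕ, ∀ n, N ≤ n → ∀ H : Finset (Finset (Fin n)),
      IsKGraph n (2 * l + p) H →
      (1 / 3 + η) * (n.choose (2 * l + p - l - 1) : ℝ) ≤ (minDeg n (2 * l + p) (l + 1) H : ℝ) →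
      Robust (EdgeOrder (2 * l + p) H) l p (s * (l + p) + p) ε c := by
  set η' := min η (1 / 2) with hη'
  have hη0 : 0 < η' := lt_min hη (by norm_num)
  have hη1 : η' ≤ 1 / 2 := min_le_right _ _
  obtain ⟨N, hN⟩ := exists_degDense_of_minDeg (k := 2 * l + p) (d := l + 1) (by omega)
    (ρ := 1 / 3 + η') (σ := η' / 2) (by positivity) (by linarith) (by linarith)
  obtain ⟨l, rfl⟩ := Nat.exists_eq_add_of_le' hl
  obtain ⟨p, rfl⟩ := Nat.exists_eq_add_of_le' hp
  obtain ⟨δ, hδ0, hδ1, hδ⟩ : ∃ δ : ℝ, 0 < δ ∧ δ ≤ 1 ∧ ((l + p + 2 : ℕ) : ℝ) * δ ≤ 1 / 3 / 2 := by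
    refine ⟨1 / 6 / (l + p + 2 : ℕ), by positivity, ?_, le_of_eq ?_⟩
    · rw [div_le_one (by positivity)]
      push_cast
      linarith [(l.cast_nonneg : (0 : ℝ) ≤ l), (p.cast_nonneg : (0 : ℝ) ≤ p)]
    · field_simp
      norm_num
  obtain ⟨N', hN'⟩ := exists_nat_gt (((l + 1 + (l + p + 2) : ℕ) : ℝ) / δ)
  rw [div_lt_iff₀ hδ0] at hN'
  set c : ℝ := (1 / 3 * (1 / 3 / 2 * (1 / 3) ^ (l + 1))) ^ 2 ^ (l + 1) with hc
  refine ⟨2 * (l + 1) + 1, η' / 2, min (1 / 3) c, by positivity, by positivity,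
    max N (N' + 1), fun n hn H hH hdeg => ?_⟩
  obtain ⟨hn1, hn2⟩ := max_le_iff.1 hn
  have hD := hN n hn1 H (le_trans (by
    rw [Nat.sub_sub]
    exact mul_le_mul_of_nonneg_right (by linarith [min_le_left η (1 / 2)]) (Nat.cast_nonneg _)) hdeg)
  have hD' : ∀ d ≤ l + 1 + 1, ∀ c ≤ (1 / 3 : ℝ),
      DegDense (EdgeOrder (2 * (l + 1) + (p + 1)) H) (2 * (l + 1) + (p + 1)) d c :=
    fun d hd c hc A hA hAn => (hD d hd A hA hAn).mono (by linarith) fun _ _ h => h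
  have : Nonempty (Fin n) := ⟨⟨0, by omega⟩⟩
  exact {
    isEdgeFamily := hH.isEdgeFamily
    deg_one := fun A hA hAn => (hD 1 (by omega) A hA hAn).mono (by linarith) fun _ _ h => h
    deg_two := hD' 2 (by omega) _ (min_le_left _ _)
    deg_ends := hD' _ (by omega) _ (min_le_left _ _)
    conn := fun A B hA hAn hB hBn => (connDense_of_degDense hH.isEdgeFamily
      (hD' _ (by omega) _ le_rfl) (hD' _ le_rfl _ le_rfl) (by norm_num) hδ1 hδ (by
        rw [Fintype.card_fin]
        have : (N' : ℝ) ≤ n := by exact_mod_cast (by omega : N' ≤ n)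
        nlinarith) A B hA hAn hB hBn).mono (min_le_right _ _) fun _ _ h => h }

theorem exists_robust_of_minDeg (hl : 2 ≤ l) (hp : 1 ≤ p) {η : ℝ} (hη : 0 < η) :
    ∃ s : ℕ, ∃ ε c : ℝ, 0 < ε ∧ 0 < c ∧ ∃ N : ℕ, ∀ n, N ≤ n → ∀ H : Finset (Finset (Fin n)),
      IsKGraph n (2 * l + p) H →
      (max ((1 : ℝ) / 3) (((1 : ℝ) / 2) ^ ((((2 * l + p : ℕ) : ℝ) - (l : ℝ)) / (l : ℝ))) + η) *
        (n.choose (2 * l + p - l) : ℝ) ≤ (minDeg n (2 * l + p) l H : ℝ) →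
      Robust (EdgeOrder (2 * l + p) H) l p (s * (l + p) + p) ε c := by
  have hl0 : (l : ℝ) ≠ 0 := by positivity
  set x : ℝ := (1 / 2 : ℝ) ^ (1 / (l : ℝ)) with hx
  have hx0 : 0 < x := by positivity
  have hxl : x ^ l = 1 / 2 := by
    rw [hx, ← Real.rpow_natCast, ← Real.rpow_mul (by norm_num), one_div_mul_cancel hl0,
      Real.rpow_one]
  have hx1 : x < 1 := Real.rpow_lt_one (by norm_num) (by norm_num) (by positivity)
  have hxk : ((1 : ℝ) / 2) ^ ((((2 * l + p : ℕ) : ℝ) - (l : ℝ)) / (l : ℝ)) = x ^ (p + l) := by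
    rw [hx, ← Real.rpow_natCast, ← Real.rpow_mul (by norm_num)]
    congr 1
    push_cast
    field_simp
    ring
  rw [hxk]
  have hxk2 : x ^ (p + l) ≤ 1 / 2 := by
    rw [← hxl]
    exact pow_le_pow_of_le_one hx0.le hx1.le (by omega)
  set μ := max ((1 : ℝ) / 3) (x ^ (p + l)) with hμ
  have hμ1 : 1 / 3 ≤ μ := le_max_left _ _
  have hμ2 : x ^ (p + l) ≤ μ := le_max_right _ _
  have hμ3 : μ ≤ 1 / 2 := max_le (by norm_num) hxk2
  set η' := min η (1 / 2) with hη'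
  have hη0 : 0 < η' := lt_min hη (by norm_num)
  have hη1 : η' ≤ 1 / 2 := min_le_right _ _
  obtain ⟨N, hN⟩ := exists_degDense_of_minDeg (k := 2 * l + p) (d := l) (by omega)
    (ρ := μ + η') (σ := η' / 2) (by positivity) (by linarith) (by linarith)
  obtain ⟨y, hxy, hy1, hy⟩ : ∃ y, x < y ∧ y ≤ 1 ∧ y ^ (p + l) ≤ x ^ (p + l) + η' / 4 := by
    have h1 : Filter.Tendsto (fun y : ℝ => y ^ (p + l)) (nhdsWithin x (Set.Ioi x))
        (nhds (x ^ (p + l))) := ((continuous_pow (p + l)).tendsto x).mono_left nhdsWithin_le_nhds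
    obtain ⟨y, ⟨hy1, hy2⟩, hy3⟩ := ((h1.eventually_le_const
      (show x ^ (p + l) < x ^ (p + l) + η' / 4 by linarith)).and
      (Ioc_mem_nhdsGT hx1)).exists.imp fun y hy => hy.symm
    exact ⟨y, hy1, hy2, hy3⟩
  set ε := η' / 4 / (p + l).factorial with hε
  have hε0 : 0 < ε := by positivity
  have hεη : (p + l).factorial * ε = η' / 4 := by rw [hε]; field_simp
  have hxyl : 0 < (y - (y - x) / 2) ^ l - 1 / 2 := by
    rw [← hxl, sub_pos]
    exact pow_lt_pow_left₀ (by linarith) hx0.le (by omega)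
  set c := 2 * ((y - (y - x) / 2) ^ l - 1 / 2) * ε ^ 2 with hc
  have hc0 : 0 < c := by positivity
  obtain ⟨N', hN'⟩ := exists_nat_gt (((p + l : ℕ) : ℝ) / ((y - x) / 2))
  rw [div_lt_iff₀ (by linarith)] at hN'
  refine ⟨1, η' / 2, min (1 / 3) c, by positivity, by positivity,
    max N (N' + 1), fun n hn H hH hdeg => ?_⟩
  obtain ⟨hn1, hn2⟩ := max_le_iff.1 hn
  have hD := hN n hn1 H (le_trans
    (mul_le_mul_of_nonneg_right (by linarith [min_le_left η (1 / 2)]) (Nat.cast_nonneg _)) hdeg)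
  have hD' : ∀ d ≤ l, DegDense (EdgeOrder (2 * l + p) H) (2 * l + p) d (min (1 / 3) c) :=
    fun d hd A hA hAn => (hD d hd A hA hAn).mono (by linarith [min_le_left (1 / 3) c])
      fun _ _ h => h
  exact {
    isEdgeFamily := hH.isEdgeFamily
    deg_one := fun A hA hAn => (hD 1 (by omega) A hA hAn).mono (by linarith) fun _ _ h => h
    deg_two := hD' 2 hl
    deg_ends := hD' l le_rfl
    conn := fun A B hA hAn hB hBn => (connDense_of_degDense_ends hH.isEdgeFamily (hD l le_rfl) hε0
      (y := y) (δ := (y - x) / 2) (by linarith) (by linarith) (by linarith) hy1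
      (by linarith) (by
        have : (N' : ℝ) ≤ n := by exact_mod_cast (by omega : N' ≤ n)
        nlinarith) (by omega) A B hA hAn hB hBn).mono (min_le_right _ _) fun _ _ h => h }

end Translation

/-- **Absorbing path lemma.** For `k ≥ 3`, `1 ≤ ℓ < k/2` and `η > 0`
there are `0 < θ < γ < η` and `n₀` such that every `k`-graph `H` on `n ≥ n₀` vertices
with `δ_ℓ(H) ≥ (max{1/3, (1/2)^{(k-ℓ)/ℓ}} + η) C(n, k-ℓ)` and `ℓ ≥ 2`, or
`δ_{ℓ+1}(H) ≥ (1/3 + η) C(n, k-ℓ-1)`, contains an `ℓ`-path `P` with `|V(P)| ≤ γ n` that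
can absorb every vertex set `X ⊆ V(H) ∖ V(P)` with `|X| ≤ θ n` and `(k - ℓ) ∣ |X|`. -/
theorem absorbing_path_lemma (k l : ℕ) (hk : 3 ≤ k) (hl1 : 1 ≤ l) (hlk : 2 * l < k)
    (η : ℝ) (hη : 0 < η) :
    ∃ γ θ : ℝ, 0 < θ ∧ θ < γ ∧ γ < η ∧ ∃ n₀ : ℕ, ∀ n : ℕ, n₀ ≤ n →
      ∀ H : Finset (Finset (Fin n)), IsKGraph n k H →
        ((2 ≤ l ∧
            (max ((1 : ℝ) / 3) (((1 : ℝ) / 2) ^ (((k : ℝ) - (l : ℝ)) / (l : ℝ))) + η) *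
              (n.choose (k - l) : ℝ) ≤ (minDeg n k l H : ℝ)) ∨
          ((1 / 3 + η) * (n.choose (k - l - 1) : ℝ) ≤ (minDeg n k (l + 1) H : ℝ))) →
        ∃ (t : ℕ) (f : ℕ → Fin n), IsLPath n k l t H f ∧
          ((pathVerts n k l t f).card : ℝ) ≤ γ * n ∧
          ∀ X : Finset (Fin n), Disjoint X (pathVerts n k l t f) →
            (X.card : ℝ) ≤ θ * n → (k - l) ∣ X.card →
            ∃ (t' : ℕ) (g : ℕ → Fin n), IsLPath n k l t' H g ∧
              pathVerts n k l t' g = pathVerts n k l t f ∪ X ∧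
              pathBeg n l g = pathBeg n l f ∧ pathEnd n k l t' g = pathEnd n k l t f := by
  obtain ⟨p, rfl⟩ := Nat.exists_eq_add_of_le hlk.le
  have hp : 1 ≤ p := by omega
  set γ := min η 1 / 2 with hγ
  have hγ0 : 0 < γ := by positivity
  have hγη : γ < η := by linarith [min_le_left η 1, lt_min hη one_pos]
  have key : ∃ θ : ℝ, 0 < θ ∧ ∃ N : ℕ, ∀ n, N ≤ n → ∀ H : Finset (Finset (Fin n)),
      IsKGraph n (2 * l + p) H →
      (1 / 3 + η) * (n.choose (2 * l + p - l - 1) : ℝ) ≤ (minDeg n (2 * l + p) (l + 1) H : ℝ) →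
      AbsorbingPathExists (2 * l + p) l γ θ H := by
    obtain ⟨s, ε, c, hε, hc, N₁, h₁⟩ := exists_robust_of_minDeg_succ hl1 hp hη
    obtain ⟨θ, hθ, N₂, h₂⟩ := Robust.exists_absorbing_path hl1 hp s hε hc hγ0
    exact ⟨θ, hθ, max N₁ N₂, fun n hn H hH hd => h₂ n (le_of_max_le_right hn) H
      (h₁ n (le_of_max_le_left hn) H hH hd)⟩
  obtain ⟨θ₁, hθ₁, N₁, h₁⟩ := key
  have key : ∃ θ : ℝ, 0 < θ ∧ ∃ N : ℕ, ∀ n, N ≤ n → ∀ H : Finset (Finset (Fin n)),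
      IsKGraph n (2 * l + p) H → 2 ≤ l →
      (max ((1 : ℝ) / 3) (((1 : ℝ) / 2) ^ ((((2 * l + p : ℕ) : ℝ) - (l : ℝ)) / (l : ℝ))) + η) *
        (n.choose (2 * l + p - l) : ℝ) ≤ (minDeg n (2 * l + p) l H : ℝ) →
      AbsorbingPathExists (2 * l + p) l γ θ H := by
    by_cases hl2 : 2 ≤ l
    · obtain ⟨s, ε, c, hε, hc, N₁, h₁⟩ := exists_robust_of_minDeg hl2 hp hη
      obtain ⟨θ, hθ, N₂, h₂⟩ := Robust.exists_absorbing_path hl1 hp s hε hc hγ0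
      exact ⟨θ, hθ, max N₁ N₂, fun n hn H hH _ hd => h₂ n (le_of_max_le_right hn) H
        (h₁ n (le_of_max_le_left hn) H hH hd)⟩
    · exact ⟨1, one_pos, 0, fun _ _ _ _ h => absurd h hl2⟩
  obtain ⟨θ₂, hθ₂, N₂, h₂⟩ := key
  refine ⟨γ, min (min θ₁ θ₂) (γ / 2), by positivity,
    (min_le_right _ _).trans_lt (half_lt_self hγ0), hγη, max N₁ N₂, fun n hn H hH hdeg => ?_⟩
  rcases hdeg with ⟨hl2, hd⟩ | hd
  · exact (h₂ n (le_of_max_le_right hn) H hH hl2 hd).mono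
      ((min_le_left _ _).trans (min_le_right _ _))
  · exact (h₁ n (le_of_max_le_left hn) H hH hd).mono
      ((min_le_left _ _).trans (min_le_left _ _))
end

section
/- Let k ≥ 3, 1 ≤ ℓ < k/2, d ≥ 2, and let constants satisfy 1/n ≪ β ≪ β' ≪ μ ≪ δ ≪ η, 1/k. Let H be a k-graph on n vertices with δ_d(H) ≥ (1/3 + η)·C(n, k−d), and let 𝒫 = {V₁, V₂, U} be a partition of V(H) with |V₁|, |V₂| ≥ (δ − β')n and |U| ≤ 2δn. Let H' := H − U. Then there exists an integer a with 1 ≤ a ≤ k−1 such that (a, k−a) is a μ-robust edge-vector of H' with respect to the partition {V₁, V₂} of V(H'), i.e. H' has at least μn^k edges e with |e ∩ V₁| = a and |e ∩ V₂| = k−a. -/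
/-- A polynomial lower bound for binomial coefficients, in terms of a real lower bound `x`
for the upper argument. -/
lemma pow_div_factorial_le_choose {k r N : ℕ} (hr : r ≤ k) {x : ℝ} (hx : 2 * (k : ℝ) ≤ x)
    (hN : x ≤ N) : (x / 2) ^ r / (k.factorial : ℝ) ≤ (N.choose r : ℝ) := by
  have hrk : (r : ℝ) ≤ k := by exact_mod_cast hr
  have hk0 : (0 : ℝ) ≤ k := Nat.cast_nonneg k
  have hrN : r ≤ N + 1 := by
    have : (r : ℝ) ≤ N + 1 := by linarith
    exact_mod_cast this
  have h1 : x / 2 ≤ ((N + 1 - r : ℕ) : ℝ) := by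
    rw [Nat.cast_sub hrN]; push_cast; linarith
  calc (x / 2) ^ r / (k.factorial : ℝ)
      ≤ ((N + 1 - r : ℕ) : ℝ) ^ r / (r.factorial : ℝ) := by
        have : (r.factorial : ℝ) ≤ k.factorial := by exact_mod_cast Nat.factorial_le hr
        have hpos : (0 : ℝ) < r.factorial := by exact_mod_cast Nat.factorial_pos r
        have hx2 : 0 ≤ x / 2 := by linarith
        gcongr
    _ ≤ _ := by exact_mod_cast Nat.pow_le_choose r N

/-- There are at most `|U| n ^ (m - 1)` sets of size `m` meeting `U`. -/
lemma card_meeting_mul_le (n m : ℕ) (U : Finset (Fin n)) :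
    ((Finset.univ.powersetCard m).filter fun T => ¬ Disjoint T U).card * n
      ≤ U.card * n ^ m := by
  cases m with
  | zero =>
    rw [Finset.filter_false_of_mem (by simp)]
    simp
  | succ m =>
    have hsub : ((Finset.univ.powersetCard (m + 1)).filter fun T => ¬ Disjoint T U) ⊆
        (U ×ˢ (Finset.univ : Finset (Fin n)).powersetCard m).image fun p => insert p.1 p.2 := by
      intro T hT
      simp only [Finset.mem_filter, Finset.mem_powersetCard, Finset.subset_univ, true_and] at hT
      obtain ⟨hc, hd⟩ := hT
      obtain ⟨u, huT, huU⟩ := Finset.not_disjoint_iff.1 hd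
      refine Finset.mem_image.2 ⟨(u, T.erase u), ?_, Finset.insert_erase huT⟩
      simp [huU, Finset.card_erase_of_mem huT, hc]
    have h := (Finset.card_le_card hsub).trans Finset.card_image_le
    rw [Finset.card_product, Finset.card_powersetCard, Finset.card_univ, Fintype.card_fin] at h
    calc _ ≤ U.card * n.choose m * n := Nat.mul_le_mul_right _ h
      _ ≤ U.card * n ^ m * n := by gcongr; exact Nat.choose_le_pow n m
      _ = _ := by ring

/-- The edges through `S` avoiding `U`, where `S` is disjoint from `U`. -/
lemma hDeg_le_card_add (n k : ℕ) (H : Finset (Finset (Fin n))) (S U : Finset (Fin n))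
    (hSU : Disjoint S U) :
    hDeg n k H S ≤ (H.filter fun e => Disjoint e U ∧ S ⊆ e).card +
      ((Finset.univ.powersetCard (k - S.card)).filter fun T => ¬ Disjoint T U).card := by
  classical
  set D : Finset (Finset (Fin n)) :=
    Finset.univ.filter fun T => T.card = k - S.card ∧ Disjoint S T ∧ S ∪ T ∈ H with hD
  have hdeg : hDeg n k H S = D.card := by
    rw [hDeg, Nat.card_eq_fintype_card, Fintype.card_subtype]
  rw [hdeg, ← Finset.card_filter_add_card_filter_not (s := D) (fun T => Disjoint T U)]
  apply Nat.add_le_add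
  · apply Finset.card_le_card_of_injOn (fun T => S ∪ T)
    · intro T hT
      simp only [hD, Finset.coe_filter, Finset.mem_filter, Finset.mem_univ, true_and,
        Set.mem_ofPred_eq] at hT ⊢
      exact ⟨hT.1.2.2, Finset.disjoint_union_left.2 ⟨hSU, hT.2⟩, Finset.subset_union_left⟩
    · intro T hT T' hT' h
      simp only [hD, Finset.coe_filter, Finset.mem_filter, Finset.mem_univ, true_and,
        Set.mem_ofPred_eq] at hT hT'
      have h' : S ∪ T = S ∪ T' := h
      rw [← Finset.union_sdiff_cancel_left hT.1.2.1, h',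
        Finset.union_sdiff_cancel_left hT'.1.2.1]
  · apply Finset.card_le_card
    intro T hT
    simp only [hD, Finset.mem_filter, Finset.mem_univ, true_and, Finset.mem_powersetCard,
      Finset.subset_univ] at hT ⊢
    exact ⟨hT.1.1, hT.2⟩

lemma minDeg_le_hDeg {n k d : ℕ} (H : Finset (Finset (Fin n))) {S : Finset (Fin n)}
    (hS : S.card = d) : minDeg n k d H ≤ hDeg n k H S :=
  Nat.sInf_le ⟨S, hS, rfl⟩

/-- The minimum `d`-degree of a `k`-graph vanishes for `d > k`. -/
lemma minDeg_eq_zero_of_lt {n k d : ℕ} {H : Finset (Finset (Fin n))} (hH : IsKGraph n k H)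
    (hkd : k < d) : minDeg n k d H = 0 := by
  by_cases hS : ∃ S : Finset (Fin n), S.card = d
  · obtain ⟨S, hS⟩ := hS
    refine Nat.le_zero.1 ((minDeg_le_hDeg H hS).trans (le_of_eq ?_))
    have : IsEmpty {T : Finset (Fin n) // T.card = k - S.card ∧ Disjoint S T ∧ S ∪ T ∈ H} := by
      refine ⟨fun ⟨T, _, _, hT⟩ => ?_⟩
      have h1 := hH _ hT
      have h2 := Finset.card_le_card (Finset.subset_union_left (s₁ := S) (s₂ := T))
      omega
    simp [hDeg]
  · have : {m : ℕ | ∃ S : Finset (Fin n), S.card = d ∧ hDeg n k H S = m} = ∅ := by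
      ext m
      simp only [Set.mem_ofPred_eq, Set.mem_empty_iff_false, iff_false]
      rintro ⟨S, h, _⟩
      exact hS ⟨S, h⟩
    simp [minDeg, this]

/-- The sets consisting of one vertex of `V₁` and `r` vertices of `V₂`. -/
def crossingSets {n : ℕ} (V₁ V₂ : Finset (Fin n)) (r : ℕ) : Finset (Finset (Fin n)) :=
  (V₁ ×ˢ V₂.powersetCard r).image fun p => insert p.1 p.2

lemma card_crossingSets {n : ℕ} {V₁ V₂ : Finset (Fin n)} (h : Disjoint V₁ V₂) (r : ℕ) :
    (crossingSets V₁ V₂ r).card = V₁.card * V₂.card.choose r := by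
  rw [crossingSets, Finset.card_image_of_injOn, Finset.card_product, Finset.card_powersetCard]
  rintro ⟨x, B⟩ hx ⟨y, C⟩ hy hxy
  simp only [Finset.coe_product, Set.mem_prod, Finset.mem_coe, Finset.mem_powersetCard] at hx hy
  obtain ⟨hx, hB, -⟩ := hx
  obtain ⟨hy, hC, -⟩ := hy
  have hxy' : insert x B = insert y C := hxy
  have hxB : x ∉ B := fun hb => Finset.disjoint_left.1 h hx (hB hb)
  have hxC : x ∉ C := fun hb => Finset.disjoint_left.1 h hx (hC hb)
  have hyC : y ∉ C := fun hb => Finset.disjoint_left.1 h hy (hC hb)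
  have hxy'' : x = y := by
    have : x ∈ insert y C := hxy' ▸ Finset.mem_insert_self x B
    exact (Finset.mem_insert.1 this).resolve_right hxC
  subst hxy''
  have hBC : B = C := by rw [← Finset.erase_insert hxB, hxy', Finset.erase_insert hxC]
  rw [hBC]

lemma mem_crossingSets {n : ℕ} {V₁ V₂ S : Finset (Fin n)} (h : Disjoint V₁ V₂) {r : ℕ}
    (hS : S ∈ crossingSets V₁ V₂ r) (hr : 1 ≤ r) :
    S.card = r + 1 ∧ (S ∩ V₁).Nonempty ∧ (S ∩ V₂).Nonempty ∧ S ⊆ V₁ ∪ V₂ := by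
  obtain ⟨⟨x, B⟩, hxB, rfl⟩ := Finset.mem_image.1 hS
  simp only [Finset.mem_product, Finset.mem_powersetCard] at hxB
  obtain ⟨hx, hB, hc⟩ := hxB
  have hxB : x ∉ B := fun hb => Finset.disjoint_left.1 h hx (hB hb)
  obtain ⟨y, hy⟩ : B.Nonempty := Finset.card_pos.1 (by omega)
  refine ⟨by simp [Finset.card_insert_of_notMem hxB, hc], ⟨x, by simp [hx]⟩,
    ⟨y, by simp [hy, hB hy]⟩, ?_⟩
  exact Finset.insert_subset (Finset.mem_union_left _ hx)
    (hB.trans Finset.subset_union_right)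

/-- If every set of a family is contained in at least `q` members of a family of `k`-sets,
then the latter has at least `q / 2 ^ k` times as many members as the former. -/
lemma card_mul_le_card_mul_two_pow {n k : ℕ} {q : ℝ} (F E : Finset (Finset (Fin n)))
    (hE : ∀ e ∈ E, e.card = k) (hF : ∀ S ∈ F, q ≤ ((E.filter fun e => S ⊆ e).card : ℝ)) :
    (F.card : ℝ) * q ≤ (E.card : ℝ) * 2 ^ k := by
  have hdc := Finset.sum_card_bipartiteAbove_eq_sum_card_bipartiteBelow
    (s := F) (t := E) (fun S e => S ⊆ e)
  have h1 : (F.card : ℝ) * q ≤ ∑ S ∈ F, ((E.filter fun e => S ⊆ e).card : ℝ) := by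
    rw [← nsmul_eq_mul]
    exact Finset.card_nsmul_le_sum _ _ _ hF
  have h2 : ∑ e ∈ E, (F.filter fun S => S ⊆ e).card ≤ E.card * 2 ^ k := by
    rw [← smul_eq_mul]
    refine Finset.sum_le_card_nsmul _ _ _ fun e he => ?_
    rw [← hE e he, ← Finset.card_powerset]
    exact Finset.card_le_card fun S hS => Finset.mem_powerset.2 (Finset.mem_filter.1 hS).2
  refine h1.trans ?_
  simp only [Finset.bipartiteAbove, Finset.bipartiteBelow] at hdc
  have h3 : ∑ S ∈ F, (E.filter fun e => S ⊆ e).card ≤ E.card * 2 ^ k := hdc ▸ h2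
  exact_mod_cast h3

/-- An edge avoiding `U` and meeting both `V₁` and `V₂` has index vector `(a, k - a)` for some
`1 ≤ a ≤ k - 1`. -/
lemma card_crossing_edges_le {n k : ℕ} {H : Finset (Finset (Fin n))} (hH : IsKGraph n k H)
    {V₁ V₂ U : Finset (Fin n)} (h12 : Disjoint V₁ V₂) (huniv : V₁ ∪ V₂ ∪ U = Finset.univ) :
    (H.filter fun e => Disjoint e U ∧ (e ∩ V₁).Nonempty ∧ (e ∩ V₂).Nonempty).card ≤
      ∑ a ∈ Finset.Icc 1 (k - 1), Nat.card {e : Finset (Fin n) // e ∈ H ∧ Disjoint e U ∧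
        (e ∩ V₁).card = a ∧ (e ∩ V₂).card = k - a} := by
  classical
  have hmem : ∀ e ∈ H, Disjoint e U → (e ∩ V₁).card + (e ∩ V₂).card = k := by
    intro e he heU
    rw [← hH e he, ← Finset.card_union_of_disjoint
      (h12.mono Finset.inter_subset_right Finset.inter_subset_right),
      ← Finset.inter_union_distrib_left]
    congr 1
    refine Finset.inter_eq_left.2 fun x hx => ?_
    have : x ∈ V₁ ∪ V₂ ∪ U := huniv ▸ Finset.mem_univ x
    exact (Finset.mem_union.1 this).resolve_right (Finset.disjoint_left.1 heU hx)
  rw [Finset.card_eq_sum_card_fiberwise (f := fun e => (e ∩ V₁).card)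
    (t := Finset.Icc 1 (k - 1))]
  · refine Finset.sum_le_sum fun a ha => ?_
    rw [Nat.card_eq_fintype_card, Fintype.card_subtype]
    refine Finset.card_le_card fun e he => ?_
    simp only [Finset.mem_filter, Finset.mem_univ, true_and] at he ⊢
    have := hmem e he.1.1 he.1.2.1
    exact ⟨he.1.1, he.1.2.1, he.2, by omega⟩
  · intro e he
    simp only [Finset.coe_filter, Set.mem_ofPred_eq, ← Finset.card_pos] at he
    have := hmem e he.1 he.2.1
    simp only [Finset.coe_Icc, Set.mem_Icc]
    omega

/-- For `k ≥ 3`, `1 ≤ ℓ < k/2`, `d ≥ 2`, `η > 0` and constants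
`1/n ≪ β ≪ β' ≪ μ ≪ δ ≪ η, 1/k`: if `δ_d(H) ≥ (1/3 + η) C(n, k-d)` and
`{V₁, V₂, U}` is a partition of `V(H)` with `|V₁|, |V₂| ≥ (δ - β') n` and `|U| ≤ 2δn`,
then some `(a, k-a)` with `1 ≤ a ≤ k-1` is a `μ`-robust edge-vector of `H - U`. -/
theorem robust_edge_vector (k l d : ℕ) (hk : 3 ≤ k) (hl1 : 1 ≤ l) (hlk : 2 * l < k)
    (hd : 2 ≤ d) (η : ℝ) (hη : 0 < η) :
    ∃ δ₀ : ℝ, 0 < δ₀ ∧ ∀ δ : ℝ, 0 < δ → δ ≤ δ₀ →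
    ∃ μ₀ : ℝ, 0 < μ₀ ∧ ∀ μ : ℝ, 0 < μ → μ ≤ μ₀ →
    ∃ β'₀ : ℝ, 0 < β'₀ ∧ ∀ β' : ℝ, 0 < β' → β' ≤ β'₀ →
    ∃ β₀ : ℝ, 0 < β₀ ∧ ∀ β : ℝ, 0 < β → β ≤ β₀ →
    ∃ n₀ : ℕ, ∀ n : ℕ, n₀ ≤ n →
      ∀ H : Finset (Finset (Fin n)), IsKGraph n k H →
        ((1 / 3 : ℝ) + η) * (n.choose (k - d) : ℝ) ≤ (minDeg n k d H : ℝ) →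
        ∀ V₁ V₂ U : Finset (Fin n),
          Disjoint V₁ V₂ → Disjoint V₁ U → Disjoint V₂ U → V₁ ∪ V₂ ∪ U = Finset.univ →
          (δ - β') * (n : ℝ) ≤ (V₁.card : ℝ) → (δ - β') * (n : ℝ) ≤ (V₂.card : ℝ) →
          (U.card : ℝ) ≤ 2 * δ * (n : ℝ) →
          ∃ a : ℕ, 1 ≤ a ∧ a ≤ k - 1 ∧
            μ * (n : ℝ) ^ k ≤
              (Nat.card {e : Finset (Fin n) // e ∈ H ∧ Disjoint e U ∧
                (e ∩ V₁).card = a ∧ (e ∩ V₂).card = k - a} : ℝ) := by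
  set c : ℝ := (1 / 3) * ((1 / 2) ^ k / (k.factorial : ℝ)) with hc
  have hfac : (0 : ℝ) < k.factorial := by exact_mod_cast Nat.factorial_pos k
  have hcpos : 0 < c := by positivity
  have hkpos : (0 : ℝ) < k := by exact_mod_cast (by omega : 0 < k)
  refine ⟨c / 4, by positivity, fun δ hδ hδc => ?_⟩
  set c' : ℝ := (δ / 4) ^ d / (k.factorial : ℝ) with hc'
  have hc'pos : 0 < c' := by positivity
  refine ⟨c' * (c / 2) / 2 ^ k / k, by positivity, fun μ hμ hμ0 => ?_⟩
  refine ⟨δ / 2, by positivity, fun β' hβ' hβ'0 => ?_⟩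
  refine ⟨1, one_pos, fun β _ _ => ?_⟩
  refine ⟨2 * k + ⌈4 * k / δ⌉₊, fun n hn H hH hdeg V₁ V₂ U h12 h1U h2U huniv hV₁ hV₂ hU => ?_⟩
  have hdk : d ≤ k := by
    by_contra hlt
    rw [minDeg_eq_zero_of_lt hH (by omega), Nat.sub_eq_zero_of_le (by omega)] at hdeg
    norm_num at hdeg
    linarith
  have hn' : (2 * k : ℝ) + 4 * k / δ ≤ n := by
    have h := Nat.le_ceil (4 * k / δ)
    have : ((2 * k + ⌈4 * k / δ⌉₊ : ℕ) : ℝ) ≤ n := by exact_mod_cast hn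
    push_cast at this
    linarith
  have hkδ : 0 < 4 * k / δ := by positivity
  have hn2k : 2 * (k : ℝ) ≤ n := by linarith
  have hnpos : (0 : ℝ) < n := by linarith
  have hδn : 2 * (k : ℝ) ≤ δ / 2 * n := by
    have h : 4 * k / δ ≤ n := by linarith
    rw [div_le_iff₀ hδ] at h
    linarith
  have hV₁' : δ / 2 * n ≤ V₁.card := le_trans (by gcongr; linarith) hV₁
  have hV₂' : δ / 2 * n ≤ V₂.card := le_trans (by gcongr; linarith) hV₂
  have hdegree : c * (n : ℝ) ^ (k - d) ≤ minDeg n k d H := by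
    have h := pow_div_factorial_le_choose (Nat.sub_le k d) hn2k le_rfl
    calc c * (n : ℝ) ^ (k - d)
        ≤ 1 / 3 * ((n / 2 : ℝ) ^ (k - d) / (k.factorial : ℝ)) := by
          have h2 : (1 / 2 : ℝ) ^ k ≤ (1 / 2) ^ (k - d) :=
            pow_le_pow_of_le_one (by norm_num) (by norm_num) (Nat.sub_le k d)
          calc c * (n : ℝ) ^ (k - d)
              ≤ (1 / 3) * ((1 / 2) ^ (k - d) / (k.factorial : ℝ)) * (n : ℝ) ^ (k - d) := by
                rw [hc]; gcongr
            _ = _ := by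
              rw [div_eq_mul_one_div (n : ℝ) 2, mul_pow]
              ring
      _ ≤ 1 / 3 * (n.choose (k - d) : ℝ) := by gcongr
      _ ≤ (1 / 3 + η) * (n.choose (k - d) : ℝ) := by gcongr; linarith
      _ ≤ _ := hdeg
  set E := H.filter fun e => Disjoint e U ∧ (e ∩ V₁).Nonempty ∧ (e ∩ V₂).Nonempty with hE
  have hcross : ∀ S ∈ crossingSets V₁ V₂ (d - 1),
      c / 2 * (n : ℝ) ^ (k - d) ≤ ((E.filter fun e => S ⊆ e).card : ℝ) := by
    intro S hS
    obtain ⟨hScard, hS1, hS2, hSsub⟩ := mem_crossingSets h12 hS (by omega)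
    have hSd : S.card = d := by omega
    have hSU : Disjoint S U := (Finset.disjoint_union_left.2 ⟨h1U, h2U⟩).mono_left hSsub
    have hmeet := card_meeting_mul_le n (k - d) U
    have hmeet' : (((Finset.univ.powersetCard (k - d)).filter
        fun T : Finset (Fin n) => ¬ Disjoint T U).card : ℝ) ≤ c / 2 * (n : ℝ) ^ (k - d) := by
      refine le_of_mul_le_mul_right ?_ hnpos
      calc _ ≤ (U.card : ℝ) * (n : ℝ) ^ (k - d) := by exact_mod_cast hmeet
        _ ≤ (c / 2 * n) * (n : ℝ) ^ (k - d) := by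
          gcongr
          refine hU.trans ?_
          gcongr
          linarith
        _ = _ := by ring
    have hsub : (H.filter fun e => Disjoint e U ∧ S ⊆ e) ⊆ E.filter fun e => S ⊆ e := by
      intro e he
      simp only [hE, Finset.mem_filter] at he ⊢
      exact ⟨⟨he.1, he.2.1, hS1.mono (Finset.inter_subset_inter_right he.2.2),
        hS2.mono (Finset.inter_subset_inter_right he.2.2)⟩, he.2.2⟩
    have h := (minDeg_le_hDeg (k := k) H hSd).trans (hDeg_le_card_add n k H S U hSU)
    rw [hSd] at h
    have h' : (minDeg n k d H : ℝ) ≤ ((E.filter fun e => S ⊆ e).card : ℝ) +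
        ((Finset.univ.powersetCard (k - d)).filter
          fun T : Finset (Fin n) => ¬ Disjoint T U).card := by
      exact_mod_cast h.trans (Nat.add_le_add_right (Finset.card_le_card hsub) _)
    linarith
  have hcount := card_mul_le_card_mul_two_pow (k := k) _ E
    (fun e he => hH e (Finset.mem_filter.1 he).1) hcross
  have hF : c' * (n : ℝ) ^ d ≤ ((crossingSets V₁ V₂ (d - 1)).card : ℝ) := by
    rw [card_crossingSets h12]
    push_cast
    have h := pow_div_factorial_le_choose (k := k) (r := d - 1) (by omega) hδn hV₂'
    calc c' * (n : ℝ) ^ d = δ / 4 * n * ((δ / 2 * n / 2) ^ (d - 1) / (k.factorial : ℝ)) := by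
          obtain ⟨r, rfl⟩ : ∃ r, d = r + 1 := ⟨d - 1, by omega⟩
          rw [hc', Nat.add_sub_cancel, show δ / 2 * n / 2 = δ / 4 * n by ring, mul_pow]
          ring
      _ ≤ V₁.card * (V₂.card.choose (d - 1) : ℝ) := by
          gcongr
          refine le_trans ?_ hV₁'
          gcongr
          norm_num
  have hEcard : k * (μ * (n : ℝ) ^ k) ≤ E.card := by
    rw [div_div, le_div_iff₀ (by positivity)] at hμ0
    refine le_of_mul_le_mul_right ?_ (show (0 : ℝ) < 2 ^ k by positivity)
    calc k * (μ * (n : ℝ) ^ k) * 2 ^ k = μ * (2 ^ k * k) * (n : ℝ) ^ k := by ring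
      _ ≤ c' * (c / 2) * (n : ℝ) ^ k := by gcongr
      _ = c' * (n : ℝ) ^ d * (c / 2 * (n : ℝ) ^ (k - d)) := by
          rw [← Nat.add_sub_of_le hdk, pow_add, Nat.add_sub_cancel_left]
          ring
      _ ≤ (crossingSets V₁ V₂ (d - 1)).card * (c / 2 * (n : ℝ) ^ (k - d)) := by gcongr
      _ ≤ _ := hcount
  have hsum : (E.card : ℝ) ≤ ∑ a ∈ Finset.Icc 1 (k - 1),
      (Nat.card {e : Finset (Fin n) // e ∈ H ∧ Disjoint e U ∧
        (e ∩ V₁).card = a ∧ (e ∩ V₂).card = k - a} : ℝ) := by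
    exact_mod_cast card_crossing_edges_le hH h12 huniv
  obtain ⟨a, ha, hle⟩ := Finset.exists_le_of_sum_le (s := Finset.Icc 1 (k - 1))
    (f := fun _ => μ * (n : ℝ) ^ k) ⟨1, Finset.mem_Icc.2 ⟨le_rfl, by omega⟩⟩ (by
      refine le_trans ?_ (hEcard.trans hsum)
      rw [Finset.sum_const, nsmul_eq_mul, Nat.card_Icc, Nat.add_sub_cancel]
      gcongr
      exact Nat.sub_le k 1)
  exact ⟨a, (Finset.mem_Icc.1 ha).1, (Finset.mem_Icc.1 ha).2, hle⟩
end
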